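/- Let Σ_A ⊆ Σ be an aperiodic and irreducible subshift of finite type, let ν be a quasi-Bernoulli σ-invariant ergodic measure on Ω, and let f : Γ_A → ℝ^d be continuous with bounded variation. Then for every α ∈ 𝒫_A^o and for ν-almost every 𝐰 ∈ Ω, h_top(E_𝐰(α)) = sup{h_μ : μ ∈ ℰ_ν(Γ_A) and ∫ f dμ = α} − h_ν = sup{h_μ : μ ∈ M_ν(Γ_A) and ∫ f dμ = α} − h_ν = inf_{p∈ℝ^d} P_ν(⟨p, f − α⟩). Furthermore, there exists α_0 ∈ ℝ^d such that for ν-almost every 𝐰, h_top(E_𝐰(α_0)) = h_top(Σ_A). -/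

import Mathlib

open Filter Set
open scoped ENNReal

/-- The left shift on one-sided sequence spaces. -/
def shift {α : Type*} (x : ℕ → α) : ℕ → α := fun n => x (n + 1)

/-- The cylinder set determined by a finite word `w`. -/
def cyl {α : Type*} {n : ℕ} (w : Fin n → α) : Set (ℕ → α) :=
  {x | ∀ k : Fin n, x (k : ℕ) = w k}

/-- Finite words over `α`, encoded with their length. -/
def Word (α : Type*) : Type _ := Σ n : ℕ, Fin n → α

/-- The length (level) of a word/cylinder. -/
def Word.len {α : Type*} (w : Word α) : ℕ := w.1

/-- The cylinder set of a word. -/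
def Word.cylSet {α : Type*} (w : Word α) : Set (ℕ → α) := cyl w.2

/-- `H^s_r(E)`: infimum over covers of `E` by cylinders of level `> r` of
`∑ e^{-s·l(C)}`. -/
noncomputable def Hsr {α : Type*} (E : Set (ℕ → α)) (s : ℝ) (r : ℕ) : ℝ≥0∞ :=
  ⨅ (S : Set (Word α)) (_ : ∀ w ∈ S, r < w.len) (_ : E ⊆ ⋃ w ∈ S, w.cylSet),
    ∑' w : S, ENNReal.ofReal (Real.exp (-s * ((w : Word α).len : ℝ)))

/-- `H^s(E) = lim_{r→∞} H^s_r(E)` (the quantities are nondecreasing in `r`). -/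
noncomputable def Hentm {α : Type*} (E : Set (ℕ → α)) (s : ℝ) : ℝ≥0∞ :=
  ⨆ r : ℕ, Hsr E s r

open scoped Classical in
/-- Topological entropy of `E ⊆ Σ`, with the convention `htop ∅ = -∞`. -/
noncomputable def htop {α : Type*} (E : Set (ℕ → α)) : EReal :=
  if E = ∅ then ⊥ else ((sInf {s : ℝ | 0 ≤ s ∧ Hentm E s ≠ ⊤} : ℝ) : EReal)

/-- The subshift of finite type determined by the 0-1 (Boolean) matrix `M`. -/
def SigmaA {K : ℕ} (M : Fin K → Fin K → Bool) : Set (ℕ → Fin K) :=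
  {x | ∀ k : ℕ, M (x k) (x (k + 1)) = true}

/-- `Σ_A` is aperiodic and irreducible: some power of the adjacency matrix is
strictly positive, i.e. there is `r ≥ 1` such that any two symbols are joined
by an admissible path of length `r`. -/
def ApIrr {K : ℕ} (M : Fin K → Fin K → Bool) : Prop :=
  ∃ r : ℕ, 0 < r ∧ ∀ i j : Fin K, ∃ p : ℕ → Fin K, p 0 = i ∧ p r = j ∧
    ∀ k < r, M (p k) (p (k + 1)) = true

/-- The (non-autonomous) Birkhoff average `(1/n) ∑_{k<n} φ_k(σ^k x)`. -/
noncomputable def birk {K : ℕ} (φ : ℕ → (ℕ → Fin K) → ℝ) (n : ℕ) (x : ℕ → Fin K) : ℝ :=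
  (∑ k ∈ Finset.range n, φ k (shift^[k] x)) / n

/-- The sequence of potentials `φ` has uniformly decreasing variations on `Σ_A`:
`ρ_n := sup_i sup_{|𝐢|=n} sup_{𝐣,𝐤 ∈ [𝐢]} |φ_i(𝐣) - φ_i(𝐤)| → 0`. -/
def UDV {K : ℕ} (M : Fin K → Fin K → Bool) (φ : ℕ → (ℕ → Fin K) → ℝ) : Prop :=
  ∀ ε > (0 : ℝ), ∃ N : ℕ, ∀ n ≥ N, ∀ i : ℕ, ∀ x ∈ SigmaA M, ∀ y ∈ SigmaA M,
    (∀ k < n, x k = y k) → |φ i x - φ i y| < ε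

/-- `L_A(α,β)`: points of `Σ_A` with lower Birkhoff average `α` and upper
Birkhoff average `β`. -/
def LAb {K : ℕ} (M : Fin K → Fin K → Bool) (φ : ℕ → (ℕ → Fin K) → ℝ) (a b : ℝ) :
    Set (ℕ → Fin K) :=
  {x | x ∈ SigmaA M ∧ Filter.liminf (fun n => birk φ n x) Filter.atTop = a ∧
    Filter.limsup (fun n => birk φ n x) Filter.atTop = b}

/-- `L_A(α) = L_A(α,α)`. -/
def LA {K : ℕ} (M : Fin K → Fin K → Bool) (φ : ℕ → (ℕ → Fin K) → ℝ) (a : ℝ) :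
    Set (ℕ → Fin K) := LAb M φ a a

open MeasureTheory

/-- The product space `Γ = Ω × Σ`. -/
abbrev GaSp (N K : ℕ) := (ℕ → Fin N) × (ℕ → Fin K)

/-- The simultaneous left shift on `Γ`. -/
def shift2 {N K : ℕ} (p : GaSp N K) : GaSp N K := (shift p.1, shift p.2)

/-- Cylinder in `Γ` given by a pair of words of equal length. -/
def cylP {N K : ℕ} {n : ℕ} (w : Fin n → Fin N) (v : Fin n → Fin K) : Set (GaSp N K) :=
  {p | (∀ k : Fin n, p.1 (k : ℕ) = w k) ∧ (∀ k : Fin n, p.2 (k : ℕ) = v k)}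

/-- Cylinder determined by a `List` word (used for concatenations). -/
def cylL {α : Type*} (w : List α) : Set (ℕ → α) :=
  {x | ∀ (k : ℕ) (h : k < w.length), x k = w.get ⟨k, h⟩}

/-- `ν` is quasi-Bernoulli. -/
def QuasiBernoulli {N : ℕ} (ν : Measure (ℕ → Fin N)) : Prop :=
  ∃ C : ℝ≥0∞, 0 < C ∧ C ≠ ⊤ ∧ ∀ w z : List (Fin N),
    C⁻¹ * (ν (cylL w) * ν (cylL z)) ≤ ν (cylL (w ++ z)) ∧
    ν (cylL (w ++ z)) ≤ C * (ν (cylL w) * ν (cylL z))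

/-- Birkhoff sums `S_n g` on `Γ`. -/
noncomputable def SnS {N K : ℕ} (g : GaSp N K → ℝ) (n : ℕ) (p : GaSp N K) : ℝ :=
  ∑ k ∈ Finset.range n, g (shift2^[k] p)

/-- The fiberwise partition function
`Z_n(g,𝐰) = Σ_{𝐢∈Σ_{A,n}} sup_{𝐣∈[𝐢]} e^{S_n g(𝐰,𝐣)}`
(words with no admissible extension contribute `sSup ∅ = 0`). -/
noncomputable def Zn {N K : ℕ} (M : Fin K → Fin K → Bool) (g : GaSp N K → ℝ)
    (w : ℕ → Fin N) (n : ℕ) : ℝ :=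
  ∑ v : Fin n → Fin K,
    sSup ((fun j => Real.exp (SnS g n (w, j))) ''
      {j | j ∈ SigmaA M ∧ ∀ k : Fin n, j (k : ℕ) = v k})

/-- The conditional pressure `P_ν(g) = lim (1/n) ∫ log Z_n(g,𝐰) dν(𝐰)`
(realized as a `limsup`; the limit exists in the situations considered). -/
noncomputable def condPressure {N K : ℕ} (M : Fin K → Fin K → Bool)
    (ν : Measure (ℕ → Fin N)) (g : GaSp N K → ℝ) : ℝ :=
  Filter.limsup (fun n : ℕ => (∫ w, Real.log (Zn M g w n) ∂ν) / n) Filter.atTop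

/-- `g : Γ_A → E` has bounded variation:
`Σ_k max_{(𝐰,𝐢)∧(𝐳,𝐣) = k} ‖g(𝐰,𝐢) − g(𝐳,𝐣)‖ < ∞`. -/
def BddVar {N K : ℕ} {E : Type*} [NormedAddCommGroup E] (M : Fin K → Fin K → Bool)
    (g : GaSp N K → E) : Prop :=
  ∃ B : ℝ, ∀ m : ℕ,
    ∑ k ∈ Finset.range m,
      sSup {d : ℝ | ∃ p q : GaSp N K, p.2 ∈ SigmaA M ∧ q.2 ∈ SigmaA M ∧
        (∀ t < k, p.1 t = q.1 t) ∧ (∀ t < k, p.2 t = q.2 t) ∧ d = ‖g p - g q‖} ≤ B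

/-- `-x log x` (with the convention `0 · log 0 = 0`). -/
noncomputable def nlog (x : ℝ) : ℝ := -(x * Real.log x)

/-- The Kolmogorov–Sinai entropy of a shift-invariant measure on `Ω`,
computed through cylinders (realized as a `limsup`; the limit exists by
subadditivity). -/
noncomputable def entOm {N : ℕ} (ν : Measure (ℕ → Fin N)) : ℝ :=
  Filter.limsup
    (fun n : ℕ => (∑ w : Fin n → Fin N, nlog ((ν (cyl w)).toReal)) / n) Filter.atTop

/-- The Kolmogorov–Sinai entropy of a shift-invariant measure on `Γ`,
computed through cylinders. -/
noncomputable def entGa {N K : ℕ} (μ : Measure (GaSp N K)) : ℝ :=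
  Filter.limsup
    (fun n : ℕ =>
      (∑ w : Fin n → Fin N, ∑ v : Fin n → Fin K, nlog ((μ (cylP w v)).toReal)) / n)
    Filter.atTop

/-- `μ ∈ M_ν(Γ_A)`: a shift-invariant probability measure on `Γ_A` with
marginal `ν`. -/
def MemMnu {N K : ℕ} (M : Fin K → Fin K → Bool) (ν : Measure (ℕ → Fin N))
    (μ : Measure (GaSp N K)) : Prop :=
  IsProbabilityMeasure μ ∧ MeasurePreserving shift2 μ μ ∧
    μ.map Prod.fst = ν ∧ μ {p | p.2 ∈ SigmaA M} = 1

/-- The level set `E_𝐰(α)` for a vector-valued potential on `Γ_A`. -/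
def EwVec {N K d : ℕ} (M : Fin K → Fin K → Bool) (f : GaSp N K → (Fin d → ℝ))
    (w : ℕ → Fin N) (α : Fin d → ℝ) : Set (ℕ → Fin K) :=
  {j | j ∈ SigmaA M ∧
    Tendsto (fun n : ℕ => (n : ℝ)⁻¹ • ∑ k ∈ Finset.range n, f (shift2^[k] (w, j)))
      atTop (nhds α)}

/-- `𝒫_A`: the possible space averages of `f`. -/
def PAset {N K d : ℕ} (M : Fin K → Fin K → Bool) (ν : Measure (ℕ → Fin N))
    (f : GaSp N K → (Fin d → ℝ)) : Set (Fin d → ℝ) :=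
  {α | ∃ μ : Measure (GaSp N K), MemMnu M ν μ ∧ (∫ p, f p ∂μ) = α}

/-! ### The pointwise ergodic theorem -/

section Birkhoff

variable {X : Type*}

/-- The running maximum `max_{0 ≤ k ≤ n} S_k g` of the Birkhoff sums, defined recursively. -/
noncomputable def birkhoffMax (T : X → X) (g : X → ℝ) : ℕ → X → ℝ
  | 0 => fun _ => 0
  | n + 1 => fun x => max 0 (g x + birkhoffMax T g n (T x))

theorem birkhoffMax_nonneg (T : X → X) (g : X → ℝ) (n : ℕ) (x : X) :
    0 ≤ birkhoffMax T g n x := by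
  cases n with
  | zero => exact le_rfl
  | succ n => exact le_max_left _ _

theorem birkhoffMax_le_succ (T : X → X) (g : X → ℝ) (n : ℕ) (x : X) :
    birkhoffMax T g n x ≤ birkhoffMax T g (n + 1) x := by
  induction n generalizing x with
  | zero => exact birkhoffMax_nonneg T g 1 x
  | succ n ih => exact max_le_max le_rfl (by gcongr; exact ih _)

theorem birkhoffSum_le_birkhoffMax (T : X → X) (g : X → ℝ) (n : ℕ) (x : X) :
    birkhoffSum T g n x ≤ birkhoffMax T g n x := by
  induction n generalizing x with
  | zero => simp [birkhoffMax]
  | succ n ih =>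
    rw [birkhoffSum_succ']
    exact le_max_of_le_right (by gcongr; exact ih _)

theorem bddAbove_birkhoffMax_iff (T : X → X) (g : X → ℝ) (x : X) :
    BddAbove (range fun n => birkhoffMax T g n (T x)) ↔
      BddAbove (range fun n => birkhoffMax T g n x) := by
  constructor
  · rintro ⟨b, hb⟩
    refine ⟨max 0 (g x + b), ?_⟩
    rintro _ ⟨n, rfl⟩
    cases n with
    | zero => exact le_max_left _ _
    | succ n => exact max_le_max le_rfl (by gcongr; exact hb ⟨n, rfl⟩)
  · rintro ⟨b, hb⟩
    refine ⟨b - g x, ?_⟩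
    rintro _ ⟨n, rfl⟩
    have h1 : birkhoffMax T g (n + 1) x ≤ b := hb ⟨n + 1, rfl⟩
    have h2 : g x + birkhoffMax T g n (T x) ≤ birkhoffMax T g (n + 1) x := le_max_right _ _
    dsimp only
    linarith

variable [MeasurableSpace X]

theorem measurable_birkhoffMax {T : X → X} {g : X → ℝ} (hT : Measurable T) (hg : Measurable g)
    (n : ℕ) : Measurable (birkhoffMax T g n) := by
  induction n with
  | zero => exact measurable_const
  | succ n ih => exact measurable_const.max (hg.add (ih.comp hT))

theorem integrable_birkhoffMax {μ : Measure X} [IsFiniteMeasure μ] {T : X → X} {g : X → ℝ}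
    (hT : MeasurePreserving T μ μ) (hg : Integrable g μ) (n : ℕ) :
    Integrable (birkhoffMax T g n) μ := by
  induction n with
  | zero => exact integrable_const _
  | succ n ih => exact (integrable_const _).sup (hg.add (hT.integrable_comp_of_integrable ih))

theorem measurableSet_bddAbove_birkhoffMax {T : X → X} {g : X → ℝ} (hT : Measurable T)
    (hg : Measurable g) : MeasurableSet {x | BddAbove (range fun n => birkhoffMax T g n x)} :=
  measurableSet_bddAbove_range fun n => measurable_birkhoffMax hT hg n

/-- If `∫ g < 0` then the Birkhoff sums of `g` are almost surely bounded above. -/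
theorem ae_bddAbove_birkhoffMax {μ : Measure X} [IsProbabilityMeasure μ] {T : X → X} {g : X → ℝ}
    (hT : Ergodic T μ) (hgm : Measurable g) (hg : Integrable g μ) (hneg : ∫ x, g x ∂μ < 0) :
    ∀ᵐ x ∂μ, BddAbove (range fun n => birkhoffMax T g n x) := by
  set B := {x | BddAbove (range fun n => birkhoffMax T g n x)} with hB
  have hBm : MeasurableSet B := measurableSet_bddAbove_birkhoffMax hT.measurable hgm
  have hBinv : T ⁻¹' B = B := by
    ext x; exact bddAbove_birkhoffMax_iff T g x
  rcases hT.toPreErgodic.ae_empty_or_univ hBm hBinv with h0 | h1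
  · exfalso
    have hae : ∀ᵐ x ∂μ, Tendsto (fun n => birkhoffMax T g (n + 1) x - birkhoffMax T g n (T x))
        atTop (nhds (g x)) := by
      filter_upwards [h0] with x hx
      have hxB : ¬ BddAbove (range fun n => birkhoffMax T g n (T x)) := by
        rw [bddAbove_birkhoffMax_iff]
        intro hcon
        have : x ∈ (∅ : Set X) := hx.mp hcon
        exact this
      have ht : Tendsto (fun n => birkhoffMax T g n (T x)) atTop atTop :=
        (tendsto_atTop_of_monotone (monotone_nat_of_le_succ fun n => birkhoffMax_le_succ T g n (T x))).elim
          id fun ⟨l, hl⟩ => absurd hl.bddAbove_range hxB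
      refine tendsto_const_nhds.congr' ?_
      filter_upwards [ht.eventually_ge_atTop (-g x)] with n hn
      have : birkhoffMax T g (n + 1) x = g x + birkhoffMax T g n (T x) :=
        max_eq_right (by linarith)
      rw [this]; ring
    have hlim := tendsto_integral_of_dominated_convergence (fun x => |g x|)
      (fun n => ((measurable_birkhoffMax hT.measurable hgm (n + 1)).sub
        ((measurable_birkhoffMax hT.measurable hgm n).comp hT.measurable)).aestronglyMeasurable)
      hg.abs (fun n => ae_of_all _ fun x => ?_) hae
    · refine absurd (ge_of_tendsto' hlim fun n => ?_) (not_le.mpr hneg)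
      have hi := integrable_birkhoffMax hT.toMeasurePreserving hg
      have e1 : ∫ x, birkhoffMax T g n (T x) ∂μ = ∫ x, birkhoffMax T g n x ∂μ := by
        rw [← integral_map hT.measurable.aemeasurable
          (measurable_birkhoffMax hT.measurable hgm n).aestronglyMeasurable, hT.map_eq]
      rw [Pi.sub_def, integral_sub (hi (n + 1))
        (hT.toMeasurePreserving.integrable_comp_of_integrable (hi n))]
      simp only [Function.comp_apply]
      rw [e1, sub_nonneg]
      exact integral_mono (hi n) (hi (n + 1)) fun x => birkhoffMax_le_succ T g n x
    · have h0 := birkhoffMax_nonneg T g n (T x)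
      simp only [Pi.sub_apply, Function.comp_apply, birkhoffMax, Real.norm_eq_abs]
      rcases le_total 0 (g x + birkhoffMax T g n (T x)) with h | h
      · rw [max_eq_right h]; simp
      · rw [max_eq_left h, zero_sub, abs_neg, abs_of_nonneg h0]
        have := neg_abs_le (g x)
        have h2 : g x ≤ 0 := by linarith
        rw [abs_of_nonpos h2]; linarith
  · filter_upwards [h1] with x hx
    exact hx.mpr trivial

theorem ae_eventually_birkhoffSum_le {μ : Measure X} [IsProbabilityMeasure μ] {T : X → X}
    {g : X → ℝ} (hT : Ergodic T μ) (hgm : Measurable g) (hg : Integrable g μ) {ε : ℝ}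
    (hε : 0 < ε) :
    ∀ᵐ x ∂μ, ∀ᶠ n : ℕ in atTop, birkhoffSum T g n x ≤ n * (∫ x, g x ∂μ + ε) := by
  set c := ∫ x, g x ∂μ + ε / 2 with hc
  have h := ae_bddAbove_birkhoffMax (g := fun x => g x - c) hT (hgm.sub_const c)
    (hg.sub (integrable_const c)) (by
      rw [integral_sub hg (integrable_const c)]; simp [hc, hε])
  filter_upwards [h] with x hx
  obtain ⟨b, hb⟩ := hx
  filter_upwards [(tendsto_natCast_atTop_atTop (R := ℝ)).eventually_ge_atTop (b / (ε / 2))]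
    with n hn
  have h1 := (birkhoffSum_le_birkhoffMax T (fun x => g x - c) n x).trans (hb ⟨n, rfl⟩)
  have h2 : birkhoffSum T (fun x => g x - c) n x = birkhoffSum T g n x - n * c := by
    simp [birkhoffSum, Finset.sum_sub_distrib]
  rw [h2] at h1
  rw [div_le_iff₀ (by positivity)] at hn
  have h3 : (n : ℝ) * (∫ x, g x ∂μ + ε) = n * c + n * (ε / 2) := by rw [hc]; ring
  linarith

/-- **Pointwise ergodic theorem** for an ergodic transformation of a probability space. -/
theorem Ergodic.ae_tendsto_birkhoffSum_div {μ : Measure X} [IsProbabilityMeasure μ] {T : X → X}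
    {g : X → ℝ} (hT : Ergodic T μ) (hgm : Measurable g) (hg : Integrable g μ) :
    ∀ᵐ x ∂μ, Tendsto (fun n : ℕ => birkhoffSum T g n x / n) atTop (nhds (∫ x, g x ∂μ)) := by
  have hup : ∀ᵐ x ∂μ, ∀ m : ℕ, ∀ᶠ n : ℕ in atTop,
      birkhoffSum T g n x ≤ n * (∫ x, g x ∂μ + 1 / ((m : ℝ) + 1)) :=
    ae_all_iff.2 fun m => ae_eventually_birkhoffSum_le hT hgm hg (by positivity)
  have hlo : ∀ᵐ x ∂μ, ∀ m : ℕ, ∀ᶠ n : ℕ in atTop,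
      birkhoffSum T (fun x => -g x) n x ≤ n * (∫ x, -g x ∂μ + 1 / ((m : ℝ) + 1)) :=
    ae_all_iff.2 fun m => ae_eventually_birkhoffSum_le hT hgm.neg hg.neg (by positivity)
  filter_upwards [hup, hlo] with x h1 h2
  rw [Metric.tendsto_nhds]
  intro ε hε
  obtain ⟨m, hm⟩ := exists_nat_one_div_lt hε
  filter_upwards [h1 m, h2 m, eventually_gt_atTop 0] with n hn1 hn2 hn0
  have hn : (0 : ℝ) < n := by exact_mod_cast hn0
  have e : birkhoffSum T (fun x => -g x) n x = - birkhoffSum T g n x := by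
    simp [birkhoffSum]
  rw [e, integral_neg] at hn2
  rw [Real.dist_eq, abs_lt]
  constructor
  · rw [neg_lt_sub_iff_lt_add, add_comm, ← sub_lt_iff_lt_add, lt_div_iff₀ hn]
    nlinarith
  · rw [sub_lt_iff_lt_add, div_lt_iff₀ hn]
    nlinarith

end Birkhoff

/-! ### Generating sequences of finite partitions -/

section FinitePartitions

/-- A refining sequence of partitions, given by maps `q n : X → F n`, which generates the
`σ`-algebra. -/
structure IsGeneratingSeq {X : Type*} [MeasurableSpace X] {F : ℕ → Type*}
    (q : ∀ n, X → F n) : Prop where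
  refine' : ∀ {m n : ℕ}, m ≤ n → ∃ c : F n → F m, ∀ x, q m x = c (q n x)
  measurable : ∀ n S, MeasurableSet (q n ⁻¹' S)
  generate : ‹MeasurableSpace X› ≤ MeasurableSpace.generateFrom {U | ∃ n S, U = q n ⁻¹' S}

variable {X : Type*} [MeasurableSpace X] {F : ℕ → Type*} {q : ∀ n, X → F n}

theorem IsGeneratingSeq.isSetAlgebra (hq : IsGeneratingSeq q) :
    IsSetAlgebra {U | ∃ n S, U = q n ⁻¹' S} where
  empty_mem := ⟨0, ∅, by simp⟩
  compl_mem := by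
    rintro _ ⟨n, S, rfl⟩
    exact ⟨n, Sᶜ, rfl⟩
  union_mem := by
    rintro _ _ ⟨n, S, rfl⟩ ⟨m, S', rfl⟩
    obtain ⟨c, hc⟩ := hq.refine' (le_max_left n m)
    obtain ⟨c', hc'⟩ := hq.refine' (le_max_right n m)
    refine ⟨max n m, c ⁻¹' S ∪ c' ⁻¹' S', ?_⟩
    ext x
    simp [hc, hc']

theorem IsGeneratingSeq.measureDense (hq : IsGeneratingSeq q) (μ : Measure X)
    [IsFiniteMeasure μ] : μ.MeasureDense {U | ∃ n S, U = q n ⁻¹' S} := by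
  refine Measure.MeasureDense.of_generateFrom_isSetAlgebra_finite μ hq.isSetAlgebra
    (le_antisymm hq.generate (MeasurableSpace.generateFrom_le ?_))
  rintro _ ⟨n, S, rfl⟩
  exact hq.measurable n S

theorem IsGeneratingSeq.exists_real_symmDiff_lt (hq : IsGeneratingSeq q) (μ : Measure X)
    [IsFiniteMeasure μ] {B : Set X} (hB : MeasurableSet B) {ε : ℝ} (hε : 0 < ε) :
    ∃ n S, μ.real (B \ q n ⁻¹' S) < ε ∧ μ.real (q n ⁻¹' S \ B) < ε := by
  obtain ⟨_, ⟨n, S, rfl⟩, h⟩ := (hq.measureDense μ).approx B hB (measure_ne_top _ _) ε hε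
  have h1 : μ.real (symmDiff B (q n ⁻¹' S)) < ε := by
    rw [measureReal_def]
    exact (ENNReal.lt_ofReal_iff_toReal_lt (measure_ne_top _ _)).1 h
  exact ⟨n, S, (measureReal_mono le_sup_left).trans_lt h1,
    (measureReal_mono le_sup_right).trans_lt h1⟩

theorem IsGeneratingSeq.measureReal_preimage [∀ n, Fintype (F n)] (hq : IsGeneratingSeq q)
    (μ : Measure X) [IsFiniteMeasure μ] (n : ℕ) (S : Finset (F n)) :
    μ.real (q n ⁻¹' S) = ∑ a ∈ S, μ.real (q n ⁻¹' {a}) := by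
  rw [← measureReal_biUnion_finset]
  · congr 1
    ext x
    simp
  · intro a _ b _ hab
    exact Disjoint.preimage _ (by simpa using hab)
  · intro a _
    exact hq.measurable n _

theorem IsGeneratingSeq.measureReal_inter_preimage [∀ n, Fintype (F n)]
    (hq : IsGeneratingSeq q) (μ : Measure X) [IsFiniteMeasure μ] (n : ℕ) (S : Finset (F n))
    {E : Set X} (hE : MeasurableSet E) :
    μ.real (E ∩ q n ⁻¹' S) = ∑ a ∈ S, μ.real (E ∩ q n ⁻¹' {a}) := by
  rw [← measureReal_biUnion_finset]
  · congr 1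
    ext x
    simp
  · intro a _ b _ hab
    exact (Disjoint.preimage _ (by simpa using hab)).mono inter_subset_right inter_subset_right
  · intro a _
    exact hE.inter (hq.measurable n _)

/-- Comparison of two finite measures on the atoms of a generating sequence of partitions. -/
theorem IsGeneratingSeq.measureReal_le [∀ n, Fintype (F n)] (hq : IsGeneratingSeq q)
    {ρ₁ ρ₂ : Measure X} [IsFiniteMeasure ρ₁] [IsFiniteMeasure ρ₂]
    (h : ∀ n a, ρ₁.real (q n ⁻¹' {a}) ≤ ρ₂.real (q n ⁻¹' {a})) {B : Set X}
    (hB : MeasurableSet B) : ρ₁.real B ≤ ρ₂.real B := by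
  classical
  refine le_of_forall_pos_le_add fun ε hε => ?_
  obtain ⟨n, S, h1, h2⟩ := hq.exists_real_symmDiff_lt (ρ₁ + ρ₂) hB (half_pos hε)
  rw [measureReal_add_apply] at h1 h2
  have hS : ρ₁.real (q n ⁻¹' S) ≤ ρ₂.real (q n ⁻¹' S) := by
    have := hq.measureReal_preimage ρ₁ n S.toFinset
    have := hq.measureReal_preimage ρ₂ n S.toFinset
    simp only [coe_toFinset] at *
    simp_all only
    exact Finset.sum_le_sum fun a _ => h n a
  have e1 : ρ₁.real B ≤ ρ₁.real (q n ⁻¹' S) + ρ₁.real (B \ q n ⁻¹' S) :=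
    (measureReal_mono (by intro x hx; by_cases h : x ∈ q n ⁻¹' S <;> simp_all)).trans
      (measureReal_union_le _ _)
  have e2 : ρ₂.real (q n ⁻¹' S) ≤ ρ₂.real B + ρ₂.real (q n ⁻¹' S \ B) :=
    (measureReal_mono (by intro x hx; by_cases h : x ∈ B <;> simp_all)).trans
      (measureReal_union_le _ _)
  have := measureReal_nonneg (μ := ρ₂) (s := B \ q n ⁻¹' S)
  have := measureReal_nonneg (μ := ρ₁) (s := q n ⁻¹' S \ B)
  linarith

theorem IsGeneratingSeq.measure_ext [∀ n, Fintype (F n)] (hq : IsGeneratingSeq q)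
    {ρ₁ ρ₂ : Measure X} [IsFiniteMeasure ρ₁] [IsFiniteMeasure ρ₂]
    (h : ∀ n a, ρ₁.real (q n ⁻¹' {a}) = ρ₂.real (q n ⁻¹' {a})) : ρ₁ = ρ₂ := by
  ext B hB
  have := le_antisymm (hq.measureReal_le (fun n a => (h n a).le) hB)
    (hq.measureReal_le (fun n a => (h n a).ge) hB)
  exact (measureReal_eq_measureReal_iff).1 this

/-- A criterion for ergodicity: cylinders of the same level are asymptotically not too far from
being independent. -/
theorem IsGeneratingSeq.ergodic [∀ n, Fintype (F n)] (hq : IsGeneratingSeq q)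
    {μ : Measure X} [IsProbabilityMeasure μ] {T : X → X} (hT : MeasurePreserving T μ μ)
    {c : ℝ} (hc : 0 < c) (h : ∀ l, ∃ n, ∀ a b : F l,
      c * μ.real (q l ⁻¹' {a}) * μ.real (q l ⁻¹' {b}) ≤
        μ.real (q l ⁻¹' {a} ∩ T^[n] ⁻¹' (q l ⁻¹' {b}))) : Ergodic T μ := by
  classical
  refine ⟨hT, ⟨fun B hB hinv => ?_⟩⟩
  have key : ∀ ε : ℝ, 0 < ε → ε < 1 → c * (μ.real B * μ.real Bᶜ) ≤ (2 + 2 * c) * ε := by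
    intro ε hε hε1
    obtain ⟨l, S, h1, h2⟩ := hq.exists_real_symmDiff_lt μ hB hε
    set U := q l ⁻¹' S with hU
    have hUm : MeasurableSet U := hq.measurable l S
    obtain ⟨n, hn⟩ := h l
    have hTn := hT.iterate n
    have hinvn : T^[n] ⁻¹' B = B := by
      rw [Set.preimage_iterate_eq]
      exact Function.iterate_fixed hinv n
    have hsum : c * μ.real Uᶜ * μ.real U ≤ μ.real (Uᶜ ∩ T^[n] ⁻¹' U) := by
      have e1 : μ.real U = ∑ b ∈ S.toFinset, μ.real (q l ⁻¹' {b}) := by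
        rw [← hq.measureReal_preimage]; simp [hU]
      have e2 : μ.real Uᶜ = ∑ a ∈ Sᶜ.toFinset, μ.real (q l ⁻¹' {a}) := by
        rw [← hq.measureReal_preimage]; simp [hU]
      have e3 : μ.real (Uᶜ ∩ T^[n] ⁻¹' U) = ∑ a ∈ Sᶜ.toFinset, ∑ b ∈ S.toFinset,
          μ.real (q l ⁻¹' {a} ∩ T^[n] ⁻¹' (q l ⁻¹' {b})) := by
        have : Uᶜ = q l ⁻¹' (Sᶜ.toFinset : Set (F l)) := by simp [hU]
        rw [inter_comm, this, hq.measureReal_inter_preimage _ _ _ (hTn.measurable hUm)]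
        refine Finset.sum_congr rfl fun a _ => ?_
        rw [← measureReal_biUnion_finset]
        · congr 1
          ext x
          simp [hU, and_comm]
        · intro b _ b' _ hb
          refine Disjoint.mono inter_subset_right inter_subset_right ?_
          exact Disjoint.preimage _ (Disjoint.preimage _ (by simpa using hb))
        · intro b _
          exact (hq.measurable l _).inter (hTn.measurable (hq.measurable l _))
      rw [e1, e2, e3, mul_assoc, Finset.sum_mul_sum, Finset.mul_sum]
      refine Finset.sum_le_sum fun a _ => ?_
      rw [Finset.mul_sum]
      refine Finset.sum_le_sum fun b _ => ?_
      rw [← mul_assoc]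
      exact hn a b
    have hup : μ.real (Uᶜ ∩ T^[n] ⁻¹' U) ≤ μ.real (B \ U) + μ.real (U \ B) := by
      rw [← hTn.measureReal_preimage (hUm.diff hB).nullMeasurableSet]
      refine (measureReal_mono ?_).trans (measureReal_union_le _ _)
      rintro x ⟨hx1, hx2⟩
      by_cases hx : x ∈ B
      · exact Or.inl ⟨hx, hx1⟩
      · refine Or.inr ⟨hx2, fun hx' => hx ?_⟩
        rw [← hinvn]; exact hx'
    have b1 : μ.real B ≤ μ.real U + ε := by
      refine ((measureReal_mono (s₂ := U ∪ B \ U) ?_).trans (measureReal_union_le _ _)).trans ?_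
      · intro x hx; by_cases h : x ∈ U <;> simp_all
      · linarith
    have b2 : μ.real Bᶜ ≤ μ.real Uᶜ + ε := by
      refine ((measureReal_mono (s₂ := Uᶜ ∪ U \ B) ?_).trans (measureReal_union_le _ _)).trans ?_
      · intro x hx; by_cases h : x ∈ U <;> simp_all
      · linarith
    have hU1 : μ.real U + μ.real Uᶜ = 1 := by
      rw [measureReal_compl hUm]; simp
    have n1 := measureReal_nonneg (μ := μ) (s := B)
    have n2 := measureReal_nonneg (μ := μ) (s := Bᶜ)
    have n3 := measureReal_nonneg (μ := μ) (s := U)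
    have n4 := measureReal_nonneg (μ := μ) (s := Uᶜ)
    have : μ.real B * μ.real Bᶜ ≤ (μ.real U + ε) * (μ.real Uᶜ + ε) := by gcongr
    calc c * (μ.real B * μ.real Bᶜ) ≤ c * ((μ.real U + ε) * (μ.real Uᶜ + ε)) := by gcongr
      _ = c * μ.real Uᶜ * μ.real U + c * (ε * (μ.real U + μ.real Uᶜ) + ε * ε) := by ring
      _ ≤ (ε + ε) + c * (ε * 1 + ε * 1) := by
          rw [hU1]; gcongr; linarith
      _ = _ := by ring
  have hle : c * (μ.real B * μ.real Bᶜ) ≤ 0 := by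
    have ht : Tendsto (fun n : ℕ => (2 + 2 * c) * (1 / ((n : ℝ) + 2))) atTop
        (nhds ((2 + 2 * c) * 0)) := by
      refine Tendsto.const_mul _ ?_
      have := (tendsto_one_div_add_atTop_nhds_zero_nat (𝕜 := ℝ)).comp (tendsto_add_atTop_nat 1)
      refine this.congr fun n => ?_
      simp; ring
    rw [mul_zero] at ht
    refine ge_of_tendsto' ht fun n => key _ (by positivity) ?_
    rw [div_lt_one (by positivity)]
    have : (0 : ℝ) ≤ n := n.cast_nonneg
    linarith
  have hz : μ.real B = 0 ∨ μ.real Bᶜ = 0 := by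
    have h0 : μ.real B * μ.real Bᶜ ≤ 0 := by
      by_contra hcon
      exact absurd hle (not_le.2 (mul_pos hc (not_le.1 hcon)))
    exact mul_eq_zero.1 (le_antisymm h0 (by positivity))
  rw [eventuallyConst_set']
  rcases hz with h0 | h0
  · left
    rw [measureReal_eq_zero_iff] at h0
    exact ae_eq_empty.2 h0
  · right
    rw [measureReal_eq_zero_iff] at h0
    exact ae_eq_univ.2 h0

end FinitePartitions

/-! ### Almost additive sequences -/

theorem exists_forall_abs_sub_mul_le {a : ℕ → ℝ} {C : ℝ}
    (h : ∀ m n, |a (m + n) - a m - a n| ≤ C) : ∃ L : ℝ, ∀ n : ℕ, |a n - n * L| ≤ C := by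
  have h0 : |a 0| ≤ C := by simpa using h 0 0
  have hC : 0 ≤ C := (abs_nonneg _).trans h0
  have hlin : ∀ n : ℕ, |a n| ≤ n * (|a 1| + C) + C := by
    intro n
    induction n with
    | zero => simpa using h0
    | succ n ih =>
      have := h n 1
      push_cast
      rw [abs_le] at *
      have h1 := neg_abs_le (a 1)
      have h2 := le_abs_self (a 1)
      constructor <;> linarith [this.1, this.2, ih.1, ih.2]
  have hu : Subadditive fun n => a n + C := by
    intro m n
    have := (abs_le.1 (h m n)).2
    dsimp only; linarith
  have hv : Subadditive fun n => C - a n := by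
    intro m n
    have := (abs_le.1 (h m n)).1
    dsimp only; linarith
  have hb : ∀ u : ℕ → ℝ, (∀ n, |u n| ≤ |a n| + C) → BddBelow (range fun n => u n / n) := by
    intro u hu
    refine ⟨-(|a 1| + C + C + C), ?_⟩
    rintro _ ⟨n, rfl⟩
    rcases Nat.eq_zero_or_pos n with rfl | hn
    · have := abs_nonneg (a 1)
      simp only [Nat.cast_zero, div_zero]
      linarith
    · have hn' : (1 : ℝ) ≤ n := by exact_mod_cast hn
      dsimp only
      rw [le_div_iff₀ (by linarith)]
      have h1 := (abs_le.1 (hu n)).1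
      have h2 := hlin n
      have h3 : C * 1 ≤ C * n := by gcongr
      nlinarith
  have hbu := hb (fun n => a n + C) fun n => (abs_add_le _ _).trans (by rw [abs_of_nonneg hC])
  have hbv := hb (fun n => C - a n) fun n => (abs_sub _ _).trans (by
    rw [abs_of_nonneg hC, add_comm])
  have hLu := hu.tendsto_lim hbu
  have hLv := hv.tendsto_lim hbv
  have hsum : hu.lim + hv.lim = 0 := by
    refine tendsto_nhds_unique (hLu.add hLv) ?_
    have := tendsto_const_div_atTop_nhds_zero_nat (2 * C)
    refine this.congr fun n => ?_
    ring
  refine ⟨hu.lim, fun n => ?_⟩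
  rcases Nat.eq_zero_or_pos n with rfl | hn
  · simpa using h0
  · have hn' : (0 : ℝ) < n := by exact_mod_cast hn
    have h1 := hu.lim_le_div hbu hn.ne'
    have h2 := hv.lim_le_div hbv hn.ne'
    rw [le_div_iff₀ hn'] at h1 h2
    rw [abs_le]
    constructor <;> nlinarith

/-! ### Shifts and gluing of orbits -/

section Symbolic

theorem shift_iterate_apply {α : Type*} (x : ℕ → α) (k n : ℕ) : shift^[k] x n = x (n + k) := by
  induction k generalizing x with
  | zero => rfl
  | succ k ih => rw [Function.iterate_succ_apply, ih]; exact congrArg x (by omega)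

theorem shift2_iterate {N K : ℕ} (k : ℕ) (p : GaSp N K) :
    shift2^[k] p = (shift^[k] p.1, shift^[k] p.2) := by
  induction k generalizing p with
  | zero => rfl
  | succ k ih => rw [Function.iterate_succ_apply, ih]; rfl

theorem shift_iterate_mem_SigmaA {K : ℕ} {M : Fin K → Fin K → Bool} {x : ℕ → Fin K}
    (hx : x ∈ SigmaA M) (k : ℕ) : shift^[k] x ∈ SigmaA M := by
  intro n
  rw [shift_iterate_apply, shift_iterate_apply, show n + 1 + k = n + k + 1 by omega]
  exact hx _

/-- The specification property with gap `r`: any two admissible orbits can be glued, at the cost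
of forgetting `r` symbols. -/
def HasGap {K : ℕ} (M : Fin K → Fin K → Bool) (r : ℕ) : Prop :=
  ∀ x ∈ SigmaA M, ∀ y ∈ SigmaA M, ∀ n : ℕ,
    ∃ z ∈ SigmaA M, (∀ k, k + r ≤ n → z k = x k) ∧ shift^[n] z = y

theorem ApIrr.exists_hasGap {K : ℕ} {M : Fin K → Fin K → Bool} (hA : ApIrr M) :
    ∃ r, HasGap M r := by
  obtain ⟨r, hr, hp⟩ := hA
  refine ⟨r, fun x hx y hy n => ?_⟩
  obtain ⟨p, p0, pr, hpM⟩ := hp (x (n - r)) (y 0)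
  set z : ℕ → Fin K := fun k =>
    if k + r ≤ n then x k else if k < n then p (k + r - n) else y (k - n) with hz
  have zx : ∀ k, k + r ≤ n → z k = x k := fun k hk => by simp [hz, hk]
  have zp : ∀ k, n ≤ k + r → k ≤ n → z k = p (k + r - n) := by
    intro k h1 h2
    rcases h1.eq_or_lt with h | h
    · rw [zx k h.ge, show k + r - n = 0 by omega, p0, show n - r = k by omega]
    · rcases h2.eq_or_lt with h' | h'
      · subst h'
        simp only [hz]
        rw [if_neg (by omega), if_neg (by omega), show k + r - k = r by omega, pr, Nat.sub_self]
      · simp only [hz]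
        rw [if_neg (by omega), if_pos h']
  have zy : ∀ k, n ≤ k → z k = y (k - n) := by
    intro k hk
    simp only [hz]
    rw [if_neg (by omega), if_neg (by omega)]
  refine ⟨z, fun k => ?_, zx, ?_⟩
  · rcases lt_or_ge (k + r) n with h | h
    · rw [zx k h.le, zx (k + 1) (by omega)]; exact hx k
    · rcases lt_or_ge k n with h' | h'
      · rw [zp k h h'.le, zp (k + 1) (by omega) h', show k + 1 + r - n = k + r - n + 1 by omega]
        exact hpM _ (by omega)
      · rw [zy k h', zy (k + 1) (by omega), show k + 1 - n = k - n + 1 by omega]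
        exact hy _
  · ext k
    rw [shift_iterate_apply, zy _ (by omega), Nat.add_sub_cancel]

theorem HasGap.exists_glue {K : ℕ} {M : Fin K → Fin K → Bool} {r : ℕ} (h : HasGap M r)
    {x j y : ℕ → Fin K} (hx : x ∈ SigmaA M) (hj : j ∈ SigmaA M) (hy : y ∈ SigmaA M) (k l : ℕ) :
    ∃ z ∈ SigmaA M, (∀ i, i + r ≤ k → z i = x i) ∧ (∀ i < l, z (k + i) = j i) ∧
      ∀ i, r ≤ i → z (k + l + i) = y i := by
  obtain ⟨z₁, hz₁, h1, h2⟩ := h j hj _ (shift_iterate_mem_SigmaA hy r) (l + r)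
  obtain ⟨z, hz, h3, h4⟩ := h x hx z₁ hz₁ k
  have h5 : ∀ i, z (k + i) = z₁ i := fun i => by
    rw [← h4, shift_iterate_apply, add_comm]
  refine ⟨z, hz, h3, fun i hi => ?_, fun i hi => ?_⟩
  · rw [h5, h1 i (by omega)]
  · rw [add_assoc, h5]
    have := congrFun h2 (i - r)
    rw [shift_iterate_apply, shift_iterate_apply] at this
    rwa [show i - r + (l + r) = l + i by omega, show i - r + r = i by omega] at this

theorem ApIrr.nonempty_SigmaA {K : ℕ} [NeZero K] {M : Fin K → Fin K → Bool} (hA : ApIrr M) :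
    (SigmaA M).Nonempty := by
  obtain ⟨r, hr, hp⟩ := hA
  have hs : ∀ i, ∃ j, M i j = true := by
    intro i
    obtain ⟨p, p0, -, h⟩ := hp i i
    exact ⟨p 1, p0 ▸ h 0 hr⟩
  choose s hs using hs
  exact ⟨fun n => s^[n] 0, fun k => by
    change M (s^[k] 0) (s^[k + 1] 0) = true
    rw [Function.iterate_succ_apply']; exact hs _⟩

/-- The initial word of length `n` of a sequence. -/
def initWord {α : Type*} (n : ℕ) (x : ℕ → α) : Fin n → α := fun i => x i

end Symbolic

/-! ### Partition functions -/

section Partition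

variable {N K : ℕ}

theorem SnS_add (g : GaSp N K → ℝ) (a b : ℕ) (p : GaSp N K) :
    SnS g (a + b) p = SnS g a p + SnS g b (shift2^[a] p) := by
  unfold SnS
  rw [Finset.sum_range_add]
  congr 1
  refine Finset.sum_congr rfl fun k _ => ?_
  rw [← Function.iterate_add_apply, add_comm]

/-- Continuous potentials which are bounded by `G` and whose Birkhoff sums have
variation at most `V` on cylinders. -/
structure IsPotential (M : Fin K → Fin K → Bool) (g : GaSp N K → ℝ) (V G : ℝ) : Prop where
  cont : Continuous g
  bound : ∀ p, |g p| ≤ G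
  var : ∀ (n : ℕ) (p q : GaSp N K), p.2 ∈ SigmaA M → q.2 ∈ SigmaA M →
    (∀ k < n, p.1 k = q.1 k) → (∀ k < n, p.2 k = q.2 k) → |SnS g n p - SnS g n q| ≤ V

/-- The contribution of the word `v` to the partition function. -/
noncomputable def wordWeight (M : Fin K → Fin K → Bool) (g : GaSp N K → ℝ) (w : ℕ → Fin N)
    (n : ℕ) (v : Fin n → Fin K) : ℝ :=
  sSup ((fun j => Real.exp (SnS g n (w, j))) ''
      {j | j ∈ SigmaA M ∧ ∀ k : Fin n, j (k : ℕ) = v k})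

theorem Zn_eq_sum (M : Fin K → Fin K → Bool) (g : GaSp N K → ℝ) (w : ℕ → Fin N) (n : ℕ) :
    Zn M g w n = ∑ v, wordWeight M g w n v := rfl

theorem abs_SnS_le {g : GaSp N K → ℝ} {G : ℝ} (hg : ∀ p, |g p| ≤ G) (n : ℕ) (p : GaSp N K) :
    |SnS g n p| ≤ n * G :=
  (Finset.abs_sum_le_sum_abs _ _).trans
    ((Finset.sum_le_sum fun _ _ => hg _).trans_eq (by simp))

theorem abs_SnS_sub_le_of_shift_eq {g : GaSp N K → ℝ} {G : ℝ} (hg : ∀ p, |g p| ≤ G) (n r : ℕ)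
    {p q : GaSp N K} (h : shift2^[r] p = shift2^[r] q) :
    |SnS g n p - SnS g n q| ≤ 2 * r * G := by
  have hG : 0 ≤ G := (abs_nonneg _).trans (hg p)
  rcases le_total n r with hn | hn
  · have h1 := abs_SnS_le hg n p
    have h2 := abs_SnS_le hg n q
    have h3 : (n : ℝ) * G ≤ r * G := by gcongr
    calc |SnS g n p - SnS g n q| ≤ |SnS g n p| + |SnS g n q| := abs_sub _ _
      _ ≤ 2 * r * G := by linarith
  · obtain ⟨b, rfl⟩ := Nat.exists_eq_add_of_le hn
    rw [SnS_add, SnS_add, h, add_sub_add_right_eq_sub]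
    calc |SnS g r p - SnS g r q| ≤ |SnS g r p| + |SnS g r q| := abs_sub _ _
      _ ≤ r * G + r * G := add_le_add (abs_SnS_le hg r p) (abs_SnS_le hg r q)
      _ = 2 * r * G := by ring

namespace IsPotential

variable {M : Fin K → Fin K → Bool} {g : GaSp N K → ℝ} {V G : ℝ}

theorem abs_SnS_sub_le_of_gap (hg : IsPotential M g V G) {n r : ℕ} {p q : GaSp N K}
    (hp : p.2 ∈ SigmaA M) (hq : q.2 ∈ SigmaA M) (h1 : ∀ k, k + r ≤ n → p.1 k = q.1 k)
    (h2 : ∀ k, k + r ≤ n → p.2 k = q.2 k) :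
    |SnS g n p - SnS g n q| ≤ V + 2 * r * G := by
  have hG : 0 ≤ G := (abs_nonneg _).trans (hg.bound p)
  obtain ⟨a, b, rfl, ha, hb⟩ : ∃ a b, n = a + b ∧ (∀ k < a, k + r ≤ n) ∧ b ≤ r :=
    ⟨n - r, n - (n - r), by omega, fun k hk => by omega, by omega⟩
  have e1 := hg.var a p q hp hq (fun k hk => h1 k (ha k hk)) (fun k hk => h2 k (ha k hk))
  have e2 := abs_SnS_le hg.bound b (shift2^[a] p)
  have e3 := abs_SnS_le hg.bound b (shift2^[a] q)
  have e4 : (b : ℝ) * G ≤ r * G := by gcongr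
  rw [SnS_add, SnS_add]
  rw [abs_le] at *
  constructor <;> linarith [e1.1, e1.2, e2.1, e2.2, e3.1, e3.2]

theorem bddAbove_image (hg : IsPotential M g V G) (w : ℕ → Fin N) (n : ℕ)
    (s : Set (ℕ → Fin K)) : BddAbove ((fun j => Real.exp (SnS g n (w, j))) '' s) := by
  refine ⟨Real.exp (n * G), ?_⟩
  rintro _ ⟨j, -, rfl⟩
  exact Real.exp_le_exp.2 ((le_abs_self _).trans (abs_SnS_le hg.bound n _))

theorem le_wordWeight (hg : IsPotential M g V G) (w : ℕ → Fin N) (n : ℕ) {j : ℕ → Fin K}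
    (hj : j ∈ SigmaA M) : Real.exp (SnS g n (w, j)) ≤ wordWeight M g w n (initWord n j) :=
  le_csSup (hg.bddAbove_image w n _) ⟨j, ⟨hj, fun _ => rfl⟩, rfl⟩

theorem wordWeight_le (hg : IsPotential M g V G) {w w' : ℕ → Fin N} {n : ℕ}
    (hw : ∀ k < n, w k = w' k) {j : ℕ → Fin K}
    (hj : j ∈ SigmaA M) :
    wordWeight M g w n (initWord n j) ≤ Real.exp V * Real.exp (SnS g n (w', j)) := by
  refine csSup_le ⟨_, j, ⟨hj, fun _ => rfl⟩, rfl⟩ ?_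
  rintro _ ⟨i, ⟨hi, hij⟩, rfl⟩
  rw [← Real.exp_add]
  refine Real.exp_le_exp.2 ?_
  have := hg.var n (w, i) (w', j) hi hj hw (fun k hk => hij ⟨k, hk⟩)
  linarith [le_abs_self (SnS g n (w, i) - SnS g n (w', j))]

end IsPotential

theorem wordWeight_nonneg (M : Fin K → Fin K → Bool) (g : GaSp N K → ℝ) (w : ℕ → Fin N)
    (n : ℕ) (v : Fin n → Fin K) : 0 ≤ wordWeight M g w n v := by
  refine Real.sSup_nonneg ?_
  rintro _ ⟨j, -, rfl⟩
  exact (Real.exp_pos _).le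

/-- Words which extend to a point of the subshift. -/
def IsAdm (M : Fin K → Fin K → Bool) {n : ℕ} (v : Fin n → Fin K) : Prop :=
  ∃ j ∈ SigmaA M, initWord n j = v

theorem wordWeight_eq_zero {M : Fin K → Fin K → Bool} (g : GaSp N K → ℝ) (w : ℕ → Fin N)
    {n : ℕ} {v : Fin n → Fin K} (hv : ¬ IsAdm M v) : wordWeight M g w n v = 0 := by
  unfold wordWeight
  convert Real.sSup_empty
  rw [image_eq_empty, eq_empty_iff_forall_notMem]
  rintro j ⟨hj, hjv⟩
  exact hv ⟨j, hj, funext hjv⟩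

theorem isAdm_initWord {M : Fin K → Fin K → Bool} {j : ℕ → Fin K} (hj : j ∈ SigmaA M) (n : ℕ) :
    IsAdm M (initWord n j) :=
  ⟨j, hj, rfl⟩

/-- A chosen point of the subshift extending the word `v`. -/
noncomputable def wordPt [NeZero K] (M : Fin K → Fin K → Bool) {n : ℕ} (v : Fin n → Fin K) :
    ℕ → Fin K :=
  Classical.epsilon fun j => j ∈ SigmaA M ∧ initWord n j = v

variable [NeZero K] {M : Fin K → Fin K → Bool}

theorem IsAdm.wordPt_mem {n : ℕ} {v : Fin n → Fin K} (hv : IsAdm M v) : wordPt M v ∈ SigmaA M :=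
  (Classical.epsilon_spec (p := fun j => j ∈ SigmaA M ∧ initWord n j = v) hv).1

theorem IsAdm.initWord_wordPt {n : ℕ} {v : Fin n → Fin K} (hv : IsAdm M v) :
    initWord n (wordPt M v) = v :=
  (Classical.epsilon_spec (p := fun j => j ∈ SigmaA M ∧ initWord n j = v) hv).2

theorem wordPt_initWord_mem {j : ℕ → Fin K} (hj : j ∈ SigmaA M) (n : ℕ) :
    wordPt M (initWord n j) ∈ SigmaA M :=
  (isAdm_initWord hj n).wordPt_mem

theorem wordPt_initWord_apply {j : ℕ → Fin K} (hj : j ∈ SigmaA M) {n k : ℕ} (hk : k < n) :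
    wordPt M (initWord n j) k = j k :=
  congrFun (isAdm_initWord hj n).initWord_wordPt ⟨k, hk⟩

open scoped Classical in
/-- The words of length `n` which are admissible and whose chosen extension belongs to `D`. -/
noncomputable def admWords (M : Fin K → Fin K → Bool) (n : ℕ) (D : Set (ℕ → Fin K)) :
    Finset (Fin n → Fin K) :=
  {v | IsAdm M v ∧ wordPt M v ∈ D}

theorem mem_admWords {n : ℕ} {D : Set (ℕ → Fin K)} {v : Fin n → Fin K} :
    v ∈ admWords M n D ↔ IsAdm M v ∧ wordPt M v ∈ D := by
  simp [admWords]

/-- The partition function restricted to the words in `D`. -/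
noncomputable def ZnOn (M : Fin K → Fin K → Bool) (g : GaSp N K → ℝ) (w : ℕ → Fin N) (n : ℕ)
    (D : Set (ℕ → Fin K)) : ℝ :=
  ∑ v ∈ admWords M n D, wordWeight M g w n v

theorem ZnOn_univ (g : GaSp N K → ℝ) (w : ℕ → Fin N) (n : ℕ) :
    ZnOn M g w n univ = Zn M g w n := by
  refine Finset.sum_subset (Finset.subset_univ _) fun v _ hv => ?_
  refine wordWeight_eq_zero g w fun h => hv ?_
  simpa [mem_admWords] using h

theorem ZnOn_nonneg (g : GaSp N K → ℝ) (w : ℕ → Fin N) (n : ℕ) (D : Set (ℕ → Fin K)) :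
    0 ≤ ZnOn M g w n D :=
  Finset.sum_nonneg fun _ _ => wordWeight_nonneg _ _ _ _ _

theorem sum_le_sum_of_injOn {ι κ : Type*} {s : Finset ι} {t : Finset κ} {F : ι → ℝ} {H : κ → ℝ}
    (φ : ι → κ) (hφ : ∀ a ∈ s, φ a ∈ t) (hinj : Set.InjOn φ s) (hFH : ∀ a ∈ s, F a ≤ H (φ a))
    (hH : ∀ b ∈ t, 0 ≤ H b) : ∑ a ∈ s, F a ≤ ∑ b ∈ t, H b := by
  classical
  calc ∑ a ∈ s, F a ≤ ∑ a ∈ s, H (φ a) := Finset.sum_le_sum hFH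
    _ = ∑ b ∈ s.image φ, H b := (Finset.sum_image hinj).symm
    _ ≤ ∑ b ∈ t, H b := Finset.sum_le_sum_of_subset_of_nonneg
        (Finset.image_subset_iff.2 hφ) fun b hb _ => hH b hb

/-- The multiplicative constant in the almost multiplicativity of partition functions. -/
noncomputable def gapConst (K r : ℕ) (V G : ℝ) : ℝ :=
  Real.exp (4 * V + 4 * r * G) * (K : ℝ) ^ (2 * r)

theorem gapConst_pos (r : ℕ) (V G : ℝ) : 0 < gapConst K r V G :=
  mul_pos (Real.exp_pos _) (pow_pos (by exact_mod_cast NeZero.pos K) _)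

namespace IsPotential

variable {g : GaSp N K → ℝ} {V G : ℝ}

theorem ZnOn_mul_le (hg : IsPotential M g V G) {r : ℕ} (hr : HasGap M r) (w : ℕ → Fin N)
    {k : ℕ} {D : Set (ℕ → Fin K)} (hD : ∀ x y : ℕ → Fin K,
      (∀ i < k, i + r ≤ k → x i = y i) → x ∈ D → y ∈ D) {j : ℕ → Fin K} (hj : j ∈ SigmaA M) (l b : ℕ) :
    ZnOn M g w k D * Real.exp (SnS g l (shift^[k] w, j)) * Zn M g (shift^[k + l] w) b ≤
      gapConst K r V G * ZnOn M g w (k + l + b) {x | x ∈ D ∧ ∀ i < l, x (k + i) = j i} := by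
  classical
  set E : Set (ℕ → Fin K) := {x | x ∈ D ∧ ∀ i < l, x (k + i) = j i} with hE
  set n := k + l + b with hn
  have hglue : ∀ a : (Fin k → Fin K) × (Fin b → Fin K), IsAdm M a.1 → IsAdm M a.2 →
      ∃ z ∈ SigmaA M, (∀ i, i + r ≤ k → z i = wordPt M a.1 i) ∧ (∀ i < l, z (k + i) = j i) ∧
        ∀ i, r ≤ i → z (k + l + i) = wordPt M a.2 i :=
    fun a h1 h2 => hr.exists_glue h1.wordPt_mem hj h2.wordPt_mem k l
  choose! z hz hz1 hz2 hz3 using hglue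
  set φ : (Fin k → Fin K) × (Fin b → Fin K) →
      (Fin n → Fin K) × ((Fin r → Fin K) × (Fin r → Fin K)) := fun a =>
    (initWord n (z a), (fun i => wordPt M a.1 (k - r + i)), fun i => wordPt M a.2 i) with hφ
  have hmain : ∑ a ∈ admWords M k D ×ˢ admWords M b univ,
      wordWeight M g w k a.1 * Real.exp (SnS g l (shift^[k] w, j)) *
        wordWeight M g (shift^[k + l] w) b a.2 ≤
      ∑ c ∈ admWords M n E ×ˢ (Finset.univ : Finset ((Fin r → Fin K) × (Fin r → Fin K))),
        Real.exp (4 * V + 4 * r * G) * wordWeight M g w n c.1 := by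
    refine sum_le_sum_of_injOn φ ?_ ?_ ?_ ?_
    · rintro a ha
      rw [Finset.mem_product, mem_admWords, mem_admWords] at ha
      obtain ⟨⟨h1, hD1⟩, h2, -⟩ := ha
      have hza := hz a h1 h2
      simp only [Finset.mem_product, mem_admWords, hφ, Finset.mem_univ, and_true]
      refine ⟨isAdm_initWord hza n, ?_, fun i hi => ?_⟩
      · refine hD _ _ (fun i hik hi => ?_) hD1
        rw [wordPt_initWord_apply hza (by omega), hz1 a h1 h2 i hi]
      · rw [wordPt_initWord_apply hza (by omega), hz2 a h1 h2 i hi]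
    · rintro a ha a' ha' haa
      rw [Finset.mem_coe, Finset.mem_product, mem_admWords, mem_admWords] at ha ha'
      obtain ⟨⟨h1, -⟩, h2, -⟩ := ha
      obtain ⟨⟨h1', -⟩, h2', -⟩ := ha'
      simp only [hφ, Prod.mk.injEq] at haa
      obtain ⟨e1, e2, e3⟩ := haa
      have e1' : ∀ i, i < n → z a i = z a' i := fun i hi => congrFun e1 ⟨i, hi⟩
      refine Prod.ext ?_ ?_
      · rw [← h1.initWord_wordPt, ← h1'.initWord_wordPt]
        ext1 i
        have hi := i.2
        change wordPt M a.1 i = wordPt M a'.1 i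
        rcases le_or_gt ((i : ℕ) + r) k with hir | hir
        · rw [← hz1 a h1 h2 i hir, ← hz1 a' h1' h2' i hir, e1' i (by omega)]
        · have := congrFun e2 ⟨(i : ℕ) - (k - r), by omega⟩
          simpa only [show k - r + ((i : ℕ) - (k - r)) = i by omega] using this
      · rw [← h2.initWord_wordPt, ← h2'.initWord_wordPt]
        ext1 i
        have hi := i.2
        change wordPt M a.2 i = wordPt M a'.2 i
        rcases lt_or_ge (i : ℕ) r with hir | hir
        · exact congrFun e3 ⟨i, hir⟩
        · rw [← hz3 a h1 h2 i hir, ← hz3 a' h1' h2' i hir, e1' _ (by omega)]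
    · rintro a ha
      rw [Finset.mem_product, mem_admWords, mem_admWords] at ha
      obtain ⟨⟨h1, -⟩, h2, -⟩ := ha
      have hza := hz a h1 h2
      have w1 : wordWeight M g w k a.1 ≤
          Real.exp V * Real.exp (SnS g k (w, wordPt M a.1)) := by
        conv_lhs => rw [← h1.initWord_wordPt]
        exact hg.wordWeight_le (fun _ _ => rfl) h1.wordPt_mem
      have w2 : wordWeight M g (shift^[k + l] w) b a.2 ≤
          Real.exp V * Real.exp (SnS g b (shift^[k + l] w, wordPt M a.2)) := by
        conv_lhs => rw [← h2.initWord_wordPt]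
        exact hg.wordWeight_le (fun _ _ => rfl) h2.wordPt_mem
      have d1 : |SnS g k (w, z a) - SnS g k (w, wordPt M a.1)| ≤ V + 2 * r * G :=
        hg.abs_SnS_sub_le_of_gap hza h1.wordPt_mem (fun _ _ => rfl) (hz1 a h1 h2)
      have d2 : |SnS g l (shift^[k] w, shift^[k] (z a)) - SnS g l (shift^[k] w, j)| ≤ V :=
        hg.var l _ _ (shift_iterate_mem_SigmaA hza k) hj (fun _ _ => rfl) fun i hi => by
          change shift^[k] (z a) i = j i
          rw [shift_iterate_apply, add_comm]; exact hz2 a h1 h2 i hi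
      have d3 : |SnS g b (shift^[k + l] w, shift^[k + l] (z a)) -
          SnS g b (shift^[k + l] w, wordPt M a.2)| ≤ 2 * r * G := by
        refine abs_SnS_sub_le_of_shift_eq hg.bound b r ?_
        rw [shift2_iterate, shift2_iterate]
        refine Prod.ext rfl (funext fun i => ?_)
        simp only [shift_iterate_apply]
        rw [show i + r + (k + l) = k + l + (i + r) by omega]
        exact hz3 a h1 h2 _ (by omega)
      have hsum : SnS g n (w, z a) = SnS g k (w, z a) +
          SnS g l (shift^[k] w, shift^[k] (z a)) +
          SnS g b (shift^[k + l] w, shift^[k + l] (z a)) := by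
        rw [hn, SnS_add, SnS_add, shift2_iterate, shift2_iterate]
      have hle := hg.le_wordWeight w n hza
      calc _ ≤ (Real.exp V * Real.exp (SnS g k (w, wordPt M a.1))) *
              Real.exp (SnS g l (shift^[k] w, j)) *
              (Real.exp V * Real.exp (SnS g b (shift^[k + l] w, wordPt M a.2))) := by
            gcongr
            exact wordWeight_nonneg _ _ _ _ _
        _ ≤ Real.exp (4 * V + 4 * r * G) * Real.exp (SnS g n (w, z a)) := by
            simp only [← Real.exp_add]
            refine Real.exp_le_exp.2 ?_
            rw [abs_le] at d1 d2 d3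
            rw [hsum]
            linarith [d1.1, d2.1, d3.1]
        _ ≤ _ := by gcongr
    · intro c _
      exact mul_nonneg (Real.exp_pos _).le (wordWeight_nonneg _ _ _ _ _)
  rw [Finset.sum_product, Finset.sum_product] at hmain
  simp only [← Finset.mul_sum, Finset.sum_const, nsmul_eq_mul] at hmain
  rw [← ZnOn_univ (M := M)]
  unfold ZnOn
  rw [Finset.sum_mul, Finset.sum_mul]
  refine hmain.trans_eq ?_
  simp only [Finset.card_univ, Fintype.card_prod, Fintype.card_fun, Fintype.card_fin, gapConst,
    Finset.mul_sum]
  refine Finset.sum_congr rfl fun v _ => ?_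
  push_cast
  ring

theorem ZnOn_le_mul (hg : IsPotential M g V G) (w : ℕ → Fin N) (k : ℕ) {j : ℕ → Fin K}
    (hj : j ∈ SigmaA M) (l b : ℕ) :
    ZnOn M g w (k + l + b) {x | ∀ i < l, x (k + i) = j i} ≤ Real.exp (2 * V) *
      (Zn M g w k * Real.exp (SnS g l (shift^[k] w, j)) * Zn M g (shift^[k + l] w) b) := by
  set n := k + l + b with hn
  have key : ∑ v ∈ admWords M n {x | ∀ i < l, x (k + i) = j i}, wordWeight M g w n v ≤
      ∑ c ∈ (Finset.univ : Finset (Fin k → Fin K)) ×ˢ (Finset.univ : Finset (Fin b → Fin K)),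
        Real.exp (2 * V) * (wordWeight M g w k c.1 * Real.exp (SnS g l (shift^[k] w, j)) *
          wordWeight M g (shift^[k + l] w) b c.2) := by
    refine sum_le_sum_of_injOn
      (fun v => (initWord k (wordPt M v), initWord b (shift^[k + l] (wordPt M v))))
      (by simp) ?_ ?_ ?_
    · intro v hv v' hv' hvv
      rw [Finset.mem_coe, mem_admWords] at hv hv'
      obtain ⟨h1, h2⟩ := hv
      obtain ⟨h1', h2'⟩ := hv'
      simp only [Prod.mk.injEq] at hvv
      rw [← h1.initWord_wordPt, ← h1'.initWord_wordPt]
      ext1 i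
      have hi := i.2
      change wordPt M v i = wordPt M v' i
      rcases lt_or_ge (i : ℕ) k with h | h
      · exact congrFun hvv.1 ⟨i, h⟩
      · rcases lt_or_ge (i : ℕ) (k + l) with h' | h'
        · have e1 := h2 (i - k) (by omega)
          have e2 := h2' (i - k) (by omega)
          rw [show k + ((i : ℕ) - k) = i by omega] at e1 e2
          rw [e1, e2]
        · have := congrFun hvv.2 ⟨i - (k + l), by omega⟩
          simp only [initWord, shift_iterate_apply] at this
          rwa [show (i : ℕ) - (k + l) + (k + l) = i by omega] at this
    · intro v hv
      rw [mem_admWords] at hv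
      obtain ⟨h1, h2⟩ := hv
      have hx := h1.wordPt_mem
      set x := wordPt M v with hxdef
      have hsum : SnS g n (w, x) = SnS g k (w, x) + SnS g l (shift^[k] w, shift^[k] x) +
          SnS g b (shift^[k + l] w, shift^[k + l] x) := by
        rw [hn, SnS_add, SnS_add, shift2_iterate, shift2_iterate]
      have d2 : |SnS g l (shift^[k] w, shift^[k] x) - SnS g l (shift^[k] w, j)| ≤ V :=
        hg.var l _ _ (shift_iterate_mem_SigmaA hx k) hj (fun _ _ => rfl) fun i hi => by
          change shift^[k] x i = j i
          rw [shift_iterate_apply, add_comm]; exact h2 i hi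
      calc wordWeight M g w n v = wordWeight M g w n (initWord n x) := by
            rw [h1.initWord_wordPt]
        _ ≤ Real.exp V * Real.exp (SnS g n (w, x)) := hg.wordWeight_le (fun _ _ => rfl) hx
        _ ≤ Real.exp (2 * V) * (Real.exp (SnS g k (w, x)) *
              Real.exp (SnS g l (shift^[k] w, j)) *
              Real.exp (SnS g b (shift^[k + l] w, shift^[k + l] x))) := by
            simp only [← Real.exp_add]
            refine Real.exp_le_exp.2 ?_
            rw [abs_le] at d2
            linarith [d2.2]
        _ ≤ _ := by
            have e1 := hg.le_wordWeight w k hx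
            have e2 := hg.le_wordWeight (shift^[k + l] w) b (shift_iterate_mem_SigmaA hx (k + l))
            gcongr
            exact mul_nonneg (wordWeight_nonneg _ _ _ _ _) (Real.exp_pos _).le
    · intro c _
      have := wordWeight_nonneg M g w k c.1
      have := wordWeight_nonneg M g (shift^[k + l] w) b c.2
      positivity
  refine key.trans_eq ?_
  rw [Finset.sum_product, Zn_eq_sum, Zn_eq_sum, Finset.sum_mul, Finset.sum_mul_sum,
    Finset.mul_sum]
  refine Finset.sum_congr rfl fun v _ => ?_
  rw [Finset.mul_sum]

end IsPotential

end Partition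

section PartitionBounds

variable {N K : ℕ} {M : Fin K → Fin K → Bool} {g : GaSp N K → ℝ} {V G : ℝ}

theorem isCompact_SigmaA (M : Fin K → Fin K → Bool) : IsCompact (SigmaA M) := by
  refine IsClosed.isCompact ?_
  have : SigmaA M = ⋂ k : ℕ, (fun x : ℕ → Fin K => M (x k) (x (k + 1))) ⁻¹' {true} := by
    ext x; simp [SigmaA]
  rw [this]
  refine isClosed_iInter fun k => isClosed_singleton.preimage ?_
  have h : Continuous fun x : ℕ → Fin K => (x k, x (k + 1)) :=
    (continuous_apply k).prodMk (continuous_apply (k + 1))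
  exact (continuous_of_discreteTopology (f := fun q : Fin K × Fin K => M q.1 q.2)).comp h

theorem continuous_shift {α : Type*} [TopologicalSpace α] :
    Continuous (shift : (ℕ → α) → ℕ → α) :=
  continuous_pi fun n => continuous_apply (n + 1)

theorem continuous_shift2 : Continuous (shift2 : GaSp N K → GaSp N K) :=
  (continuous_shift.comp continuous_fst).prodMk (continuous_shift.comp continuous_snd)

theorem continuous_SnS (hg : Continuous g) (n : ℕ) : Continuous (SnS g n) :=
  continuous_finsetSum _ fun k _ => hg.comp (continuous_shift2.iterate k)

theorem continuous_initWord {α : Type*} [TopologicalSpace α] (n : ℕ) :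
    Continuous (initWord n : (ℕ → α) → Fin n → α) :=
  continuous_pi fun i => continuous_apply (i : ℕ)

theorem sum_wordWeight_le_of_le {g' : GaSp N K → ℝ} {δ : ℝ} {w : ℕ → Fin N} {n : ℕ}
    (hb : ∀ s : Set (ℕ → Fin K), BddAbove ((fun j => Real.exp (SnS g' n (w, j))) '' s))
    (h : ∀ j ∈ SigmaA M, SnS g n (w, j) ≤ δ + SnS g' n (w, j)) :
    Zn M g w n ≤ Real.exp δ * Zn M g' w n := by
  rw [Zn_eq_sum, Zn_eq_sum, Finset.mul_sum]
  refine Finset.sum_le_sum fun v _ => ?_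
  refine Real.sSup_le ?_ (mul_nonneg (Real.exp_pos _).le (wordWeight_nonneg _ _ _ _ _))
  rintro _ ⟨j, hj, rfl⟩
  calc Real.exp (SnS g n (w, j)) ≤ Real.exp δ * Real.exp (SnS g' n (w, j)) := by
        rw [← Real.exp_add]; exact Real.exp_le_exp.2 (h j hj.1)
    _ ≤ _ := by gcongr; exact le_csSup (hb _) ⟨j, hj, rfl⟩

namespace IsPotential

theorem G_nonneg [NeZero K] (hg : IsPotential M g V G) (w : ℕ → Fin N) : 0 ≤ G :=
  (abs_nonneg _).trans (hg.bound (w, fun _ => 0))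

theorem V_nonneg (hg : IsPotential M g V G) (hne : (SigmaA M).Nonempty) (w : ℕ → Fin N) :
    0 ≤ V := by
  obtain ⟨j, hj⟩ := hne
  exact (abs_nonneg _).trans
    (hg.var 0 (w, j) (w, j) hj hj (fun _ _ => rfl) (fun _ _ => rfl))

theorem continuous_wordWeight (hg : IsPotential M g V G) (n : ℕ) (v : Fin n → Fin K) :
    Continuous fun w => wordWeight M g w n v := by
  refine IsCompact.continuous_sSup (f := fun w j => Real.exp (SnS g n (w, j))) ?_ ?_
  · have : {j | j ∈ SigmaA M ∧ ∀ k : Fin n, j (k : ℕ) = v k} =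
        SigmaA M ∩ initWord n ⁻¹' {v} := by
      ext j; simp [initWord, funext_iff]
    rw [this]
    exact (isCompact_SigmaA M).inter_right (isClosed_singleton.preimage (continuous_initWord n))
  · exact Real.continuous_exp.comp (continuous_SnS hg.cont n)

theorem continuous_Zn (hg : IsPotential M g V G) (n : ℕ) : Continuous fun w => Zn M g w n :=
  continuous_finsetSum _ fun v _ => hg.continuous_wordWeight n v

theorem exp_le_Zn (hg : IsPotential M g V G) (hne : (SigmaA M).Nonempty) (w : ℕ → Fin N)
    (n : ℕ) : Real.exp (-(n * G)) ≤ Zn M g w n := by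
  obtain ⟨j, hj⟩ := hne
  calc Real.exp (-(n * G)) ≤ Real.exp (SnS g n (w, j)) :=
        Real.exp_le_exp.2 (neg_le_of_abs_le (abs_SnS_le hg.bound n _))
    _ ≤ wordWeight M g w n (initWord n j) := hg.le_wordWeight w n hj
    _ ≤ Zn M g w n := Finset.single_le_sum (f := fun v => wordWeight M g w n v)
        (fun _ _ => wordWeight_nonneg _ _ _ _ _) (Finset.mem_univ _)

theorem Zn_pos (hg : IsPotential M g V G) (hne : (SigmaA M).Nonempty) (w : ℕ → Fin N) (n : ℕ) :
    0 < Zn M g w n :=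
  (Real.exp_pos _).trans_le (hg.exp_le_Zn hne w n)

theorem Zn_le_exp (hg : IsPotential M g V G) (w : ℕ → Fin N) (n : ℕ) :
    Zn M g w n ≤ (K : ℝ) ^ n * Real.exp (n * G) := by
  rw [Zn_eq_sum]
  refine (Finset.sum_le_sum (g := fun _ => Real.exp (n * G)) fun v _ => ?_).trans_eq (by simp)
  refine Real.sSup_le ?_ (Real.exp_pos _).le
  rintro _ ⟨j, -, rfl⟩
  exact Real.exp_le_exp.2 ((le_abs_self _).trans (abs_SnS_le hg.bound n _))

theorem abs_log_Zn_le [NeZero K] (hg : IsPotential M g V G) (hne : (SigmaA M).Nonempty)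
    (w : ℕ → Fin N) (n : ℕ) : |Real.log (Zn M g w n)| ≤ n * (G + Real.log K) := by
  have hK : (1 : ℝ) ≤ K := by exact_mod_cast NeZero.one_le
  have hlK := Real.log_nonneg hK
  have h1 := Real.log_le_log (Real.exp_pos _) (hg.exp_le_Zn hne w n)
  have h2 := Real.log_le_log (hg.Zn_pos hne w n) (hg.Zn_le_exp w n)
  rw [Real.log_exp] at h1
  rw [Real.log_mul (by positivity) (by positivity), Real.log_pow, Real.log_exp] at h2
  rw [abs_le]
  constructor <;> nlinarith [mul_nonneg n.cast_nonneg hlK]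

theorem Zn_le_of_agree (hg : IsPotential M g V G) {w w' : ℕ → Fin N} {n : ℕ}
    (h : ∀ k < n, w k = w' k) : Zn M g w n ≤ Real.exp V * Zn M g w' n := by
  rw [Zn_eq_sum, Zn_eq_sum, Finset.mul_sum]
  refine Finset.sum_le_sum fun v _ => ?_
  by_cases hv : IsAdm M v
  · obtain ⟨j, hj, rfl⟩ := hv
    refine (hg.wordWeight_le h hj).trans ?_
    gcongr
    exact hg.le_wordWeight w' n hj
  · rw [wordWeight_eq_zero g w hv]
    exact mul_nonneg (Real.exp_pos _).le (wordWeight_nonneg _ _ _ _ _)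

variable [NeZero K] {r : ℕ}

theorem Zn_add_le (hg : IsPotential M g V G) (hne : (SigmaA M).Nonempty) (w : ℕ → Fin N)
    (a b : ℕ) :
    Zn M g w (a + b) ≤ Real.exp (2 * V) * (Zn M g w a * Zn M g (shift^[a] w) b) := by
  obtain ⟨j, hj⟩ := hne
  have := hg.ZnOn_le_mul w a hj 0 b
  simpa [SnS, ZnOn_univ] using this

theorem Zn_mul_le (hg : IsPotential M g V G) (hr : HasGap M r) (hne : (SigmaA M).Nonempty)
    (w : ℕ → Fin N) (a b : ℕ) :
    Zn M g w a * Zn M g (shift^[a] w) b ≤ gapConst K r V G * Zn M g w (a + b) := by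
  obtain ⟨j, hj⟩ := hne
  have := hg.ZnOn_mul_le hr w (D := univ) (k := a) (by simp) hj 0 b
  simpa [SnS, ZnOn_univ] using this

theorem log_gapConst (r : ℕ) (V G : ℝ) :
    Real.log (gapConst K r V G) = 4 * V + 4 * r * G + 2 * r * Real.log K := by
  have hK : (0 : ℝ) < K := by exact_mod_cast NeZero.pos K
  rw [gapConst, Real.log_mul (by positivity) (by positivity), Real.log_exp, Real.log_pow]
  push_cast; ring

theorem abs_log_Zn_add_le (hg : IsPotential M g V G) (hr : HasGap M r)
    (hne : (SigmaA M).Nonempty) (w : ℕ → Fin N) (a b : ℕ) :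
    |Real.log (Zn M g w (a + b)) - Real.log (Zn M g w a) -
      Real.log (Zn M g (shift^[a] w) b)| ≤ Real.log (gapConst K r V G) := by
  have hV := hg.V_nonneg hne w
  have hG := hg.G_nonneg w
  have hK : (1 : ℝ) ≤ K := by exact_mod_cast NeZero.one_le
  have hlK := Real.log_nonneg hK
  have z1 := hg.Zn_pos hne w (a + b)
  have z2 := hg.Zn_pos hne w a
  have z3 := hg.Zn_pos hne (shift^[a] w) b
  have h1 := Real.log_le_log z1 (hg.Zn_add_le hne w a b)
  have h2 := Real.log_le_log (mul_pos z2 z3) (hg.Zn_mul_le hr hne w a b)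
  rw [Real.log_mul (Real.exp_pos _).ne' (mul_pos z2 z3).ne', Real.log_mul z2.ne' z3.ne',
    Real.log_exp] at h1
  rw [Real.log_mul (gapConst_pos r V G).ne' z1.ne', Real.log_mul z2.ne' z3.ne'] at h2
  have h3 := log_gapConst (K := K) r V G
  have h4 : 0 ≤ r * G := by positivity
  have h5 : 0 ≤ r * Real.log K := by positivity
  rw [abs_le]
  constructor <;> linarith

end IsPotential

end PartitionBounds

section Pressure

variable {N K : ℕ} {M : Fin K → Fin K → Bool} {g : GaSp N K → ℝ} {V G : ℝ}
  {ν : Measure (ℕ → Fin N)} [IsProbabilityMeasure ν]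

theorem integral_comp_of_measurePreserving {X Y : Type*} [MeasurableSpace X] [MeasurableSpace Y]
    {μ : Measure X} {ρ : Measure Y} {T : X → Y} (hT : MeasurePreserving T μ ρ) {h : Y → ℝ}
    (hh : AEStronglyMeasurable h ρ) : ∫ x, h (T x) ∂μ = ∫ y, h y ∂ρ := by
  rw [← hT.map_eq] at hh ⊢
  exact (integral_map hT.measurable.aemeasurable hh).symm

/-- The sum of the increments of step `m` of a sequence, rearranged. -/
theorem sum_range_sub_shift (u : ℕ → ℝ) (m n : ℕ) :
    ∑ k ∈ Finset.range n, (u (k + m) - u k) = ∑ i ∈ Finset.range m, (u (n + i) - u i) := by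
  have h1 := Finset.sum_range_add u m n
  have h2 := Finset.sum_range_add u n m
  rw [add_comm n m] at h2
  simp only [Finset.sum_sub_distrib, fun k => add_comm k m]
  linarith

namespace IsPotential

theorem measurable_log_Zn (hg : IsPotential M g V G) (n : ℕ) :
    Measurable fun w => Real.log (Zn M g w n) :=
  Real.measurable_log.comp (hg.continuous_Zn n).measurable

variable [NeZero K] {r : ℕ}

theorem integrable_log_Zn (hg : IsPotential M g V G) (hne : (SigmaA M).Nonempty) (n : ℕ) :
    Integrable (fun w => Real.log (Zn M g w n)) ν :=
  Integrable.of_bound (hg.measurable_log_Zn n).aestronglyMeasurable (n * (G + Real.log K))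
    (ae_of_all _ fun w => hg.abs_log_Zn_le hne w n)

theorem exists_abs_integral_log_Zn_sub_le (hg : IsPotential M g V G) (hr : HasGap M r)
    (hne : (SigmaA M).Nonempty) (hν : MeasurePreserving shift ν ν) :
    ∃ L, ∀ n : ℕ, |∫ w, Real.log (Zn M g w n) ∂ν - n * L| ≤ Real.log (gapConst K r V G) := by
  refine exists_forall_abs_sub_mul_le fun a b => ?_
  have hb : ∫ w, Real.log (Zn M g (shift^[a] w) b) ∂ν = ∫ w, Real.log (Zn M g w b) ∂ν :=
    integral_comp_of_measurePreserving (hν.iterate a)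
      (h := fun w => Real.log (Zn M g w b)) (hg.measurable_log_Zn b).aestronglyMeasurable
  have hbi : Integrable (fun w => Real.log (Zn M g (shift^[a] w) b)) ν :=
    (hν.iterate a).integrable_comp_of_integrable (hg.integrable_log_Zn hne b)
  have ha := hg.integrable_log_Zn (ν := ν) hne a
  have hab := hg.integrable_log_Zn (ν := ν) hne (a + b)
  have hsub : Integrable (fun w => Real.log (Zn M g w (a + b)) - Real.log (Zn M g w a)) ν :=
    hab.sub ha
  rw [← hb, ← integral_sub hab ha, ← integral_sub hsub hbi]
  have := norm_integral_le_of_norm_le_const (μ := ν) (C := Real.log (gapConst K r V G))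
    (ae_of_all _ fun w => (Real.norm_eq_abs _).trans_le (hg.abs_log_Zn_add_le hr hne w a b))
  simpa using this

theorem tendsto_and_abs_integral_log_Zn_sub_le (hg : IsPotential M g V G) (hr : HasGap M r)
    (hne : (SigmaA M).Nonempty) (hν : MeasurePreserving shift ν ν) :
    Tendsto (fun n : ℕ => (∫ w, Real.log (Zn M g w n) ∂ν) / n) atTop
      (nhds (condPressure M ν g)) ∧
    ∀ n : ℕ, |∫ w, Real.log (Zn M g w n) ∂ν - n * condPressure M ν g| ≤
      Real.log (gapConst K r V G) := by
  obtain ⟨L, hL⟩ := hg.exists_abs_integral_log_Zn_sub_le hr hne hν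
  have h : Tendsto (fun n : ℕ => (∫ w, Real.log (Zn M g w n) ∂ν) / n) atTop (nhds L) := by
    rw [tendsto_iff_norm_sub_tendsto_zero]
    refine squeeze_zero' (Eventually.of_forall fun _ => norm_nonneg _) ?_
      (tendsto_const_div_atTop_nhds_zero_nat (Real.log (gapConst K r V G)))
    filter_upwards [eventually_gt_atTop 0] with n hn
    have hn' : (0 : ℝ) < n := by exact_mod_cast hn
    rw [Real.norm_eq_abs, div_sub' hn'.ne', abs_div, Nat.abs_cast]
    gcongr
    exact hL n
  rw [condPressure, h.limsup_eq]
  exact ⟨h, hL⟩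

theorem tendsto_condPressure (hg : IsPotential M g V G) (hr : HasGap M r)
    (hne : (SigmaA M).Nonempty) (hν : MeasurePreserving shift ν ν) :
    Tendsto (fun n : ℕ => (∫ w, Real.log (Zn M g w n) ∂ν) / n) atTop
      (nhds (condPressure M ν g)) :=
  (hg.tendsto_and_abs_integral_log_Zn_sub_le hr hne hν).1

theorem abs_integral_log_Zn_sub_le (hg : IsPotential M g V G) (hr : HasGap M r)
    (hne : (SigmaA M).Nonempty) (hν : MeasurePreserving shift ν ν) (n : ℕ) :
    |∫ w, Real.log (Zn M g w n) ∂ν - n * condPressure M ν g| ≤ Real.log (gapConst K r V G) :=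
  (hg.tendsto_and_abs_integral_log_Zn_sub_le hr hne hν).2 n

theorem ae_tendsto_log_Zn_div (hg : IsPotential M g V G) (hr : HasGap M r)
    (hne : (SigmaA M).Nonempty) (hν : Ergodic shift ν) :
    ∀ᵐ w ∂ν, Tendsto (fun n : ℕ => Real.log (Zn M g w n) / n) atTop
      (nhds (condPressure M ν g)) := by
  set C := Real.log (gapConst K r V G) with hC
  set P := condPressure M ν g with hP
  set H := G + Real.log K with hH
  have hall : ∀ᵐ w ∂ν, ∀ m : ℕ, Tendsto (fun n : ℕ =>
      birkhoffSum shift (fun w => Real.log (Zn M g w m)) n w / n) atTop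
      (nhds (∫ w, Real.log (Zn M g w m) ∂ν)) :=
    ae_all_iff.2 fun m => hν.ae_tendsto_birkhoffSum_div (hg.measurable_log_Zn m)
      (hg.integrable_log_Zn hne m)
  filter_upwards [hall] with w hw
  have key : ∀ m n : ℕ, |birkhoffSum shift (fun w => Real.log (Zn M g w m)) n w -
      m * Real.log (Zn M g w n)| ≤ n * C + m * (C + m * H + m * H) := by
    intro m n
    set u : ℕ → ℝ := fun k => Real.log (Zn M g w k) with hu
    have hG := hg.G_nonneg w
    have hlK : 0 ≤ Real.log K := Real.log_nonneg (by exact_mod_cast NeZero.one_le)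
    have h1 : |birkhoffSum shift (fun w => Real.log (Zn M g w m)) n w -
        ∑ k ∈ Finset.range n, (u (k + m) - u k)| ≤ n * C := by
      rw [birkhoffSum, ← Finset.sum_sub_distrib]
      refine (Finset.abs_sum_le_sum_abs _ _).trans ?_
      refine (Finset.sum_le_sum (g := fun _ => C) fun k _ => ?_).trans_eq (by simp)
      have := hg.abs_log_Zn_add_le hr hne w k m
      rw [abs_sub_comm] at this
      exact this
    have h2 : |∑ i ∈ Finset.range m, (u (n + i) - u i) - m * u n| ≤
        m * (C + m * H + m * H) := by
      have : ∑ i ∈ Finset.range m, (u (n + i) - u i) - m * u n =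
          ∑ i ∈ Finset.range m, (u (n + i) - u i - u n) := by
        simp [Finset.sum_sub_distrib]
      rw [this]
      refine (Finset.abs_sum_le_sum_abs _ _).trans ?_
      refine (Finset.sum_le_sum (g := fun _ => C + m * H + m * H) fun i hi => ?_).trans_eq
        (by rw [Finset.sum_const, Finset.card_range, nsmul_eq_mul])
      have hi' : (i : ℝ) ≤ m := by exact_mod_cast (Finset.mem_range.1 hi).le
      have e1 := hg.abs_log_Zn_add_le hr hne w n i
      have e2 := hg.abs_log_Zn_le hne w i
      have e3 := hg.abs_log_Zn_le hne (shift^[n] w) i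
      have e4 : i * H ≤ m * H := by gcongr
      simp only [hu]
      rw [abs_le] at *
      constructor <;> linarith [e1.1, e1.2, e2.1, e2.2, e3.1, e3.2]
    rw [sum_range_sub_shift] at h1
    exact (abs_sub_le _ _ _).trans (add_le_add h1 h2)
  rw [Metric.tendsto_atTop']
  intro ε hε
  obtain ⟨m, hm⟩ := exists_nat_gt ((2 * C + 2) / ε)
  have hI := hg.abs_integral_log_Zn_sub_le hr hne hν.toMeasurePreserving m
  have hC0 : 0 ≤ C := (abs_nonneg _).trans hI
  have hm0 : (0 : ℝ) < m := lt_of_le_of_lt (by positivity) hm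
  have hm' : 2 * C + 2 < m * ε := by rwa [div_lt_iff₀ hε] at hm
  have ev1 := (tendsto_const_div_atTop_nhds_zero_nat
    (m * (C + m * H + m * H))).eventually_lt_const one_pos
  have ev2 := (Metric.tendsto_nhds.1 (hw m)) 1 one_pos
  obtain ⟨n₀, hn₀⟩ := eventually_atTop.1 (ev1.and ev2)
  refine ⟨n₀, fun n hn => ?_⟩
  obtain ⟨e1, e2⟩ := hn₀ n hn.le
  have hn' : (0 : ℝ) < n := by exact_mod_cast (Nat.zero_le _).trans_lt hn
  rw [div_lt_one hn'] at e1
  rw [Real.dist_eq] at e2 ⊢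
  have e3 := key m n
  set B := birkhoffSum shift (fun w => Real.log (Zn M g w m)) n w
  have e4 : |B / n - m * (Real.log (Zn M g w n) / n)| ≤ C + 1 := by
    rw [show B / n - m * (Real.log (Zn M g w n) / n) = (B - m * Real.log (Zn M g w n)) / n by
      ring, abs_div, Nat.abs_cast, div_le_iff₀ hn']
    linarith
  have e5 : m * |Real.log (Zn M g w n) / n - P| ≤ 2 * C + 2 := by
    rw [← abs_of_pos hm0, ← abs_mul, mul_sub]
    rw [abs_le] at *
    rw [abs_lt] at e2
    constructor <;> linarith [e2.1, e2.2, e4.1, e4.2, hI.1, hI.2]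
  by_contra! hcon
  have : m * ε ≤ m * |Real.log (Zn M g w n) / n - P| := by gcongr
  linarith

theorem condPressure_le_add {g' : GaSp N K → ℝ} {V' G' δ : ℝ} (hg : IsPotential M g V G)
    (hg' : IsPotential M g' V' G') (hr : HasGap M r) (hne : (SigmaA M).Nonempty)
    (hν : MeasurePreserving shift ν ν) (h : ∀ p, p.2 ∈ SigmaA M → g p ≤ g' p + δ) :
    condPressure M ν g ≤ condPressure M ν g' + δ := by
  refine le_of_tendsto_of_tendsto (hg.tendsto_condPressure hr hne hν)
    ((hg'.tendsto_condPressure hr hne hν).add_const δ) ?_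
  filter_upwards [eventually_gt_atTop 0] with n hn
  have hn' : (0 : ℝ) < n := by exact_mod_cast hn
  have : ∀ w, Real.log (Zn M g w n) ≤ n * δ + Real.log (Zn M g' w n) := by
    intro w
    have := sum_wordWeight_le_of_le (M := M) (g := g) (g' := g') (δ := n * δ) (w := w) (n := n)
      (hg'.bddAbove_image w n) fun j hj => by
        unfold SnS
        calc ∑ k ∈ Finset.range n, g (shift2^[k] (w, j)) ≤
            ∑ k ∈ Finset.range n, (g' (shift2^[k] (w, j)) + δ) :=
              Finset.sum_le_sum fun k _ => h _ (by
                rw [shift2_iterate]; exact shift_iterate_mem_SigmaA hj k)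
          _ = _ := by rw [Finset.sum_add_distrib]; simp; ring
    have h2 := Real.log_le_log (hg.Zn_pos hne w n) this
    rwa [Real.log_mul (Real.exp_pos _).ne' (hg'.Zn_pos hne w n).ne', Real.log_exp] at h2
  have h3 : ∫ w, Real.log (Zn M g w n) ∂ν ≤ ∫ w, (n * δ + Real.log (Zn M g' w n)) ∂ν :=
    integral_mono (hg.integrable_log_Zn hne n)
      ((integrable_const _).add (hg'.integrable_log_Zn hne n)) this
  rw [integral_add (integrable_const _) (hg'.integrable_log_Zn hne n)] at h3
  rw [div_le_iff₀ hn', add_mul, div_mul_cancel₀ _ hn'.ne']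
  simp at h3
  linarith

end IsPotential

end Pressure

/-! ### Invariant measures as limits of orbit averages -/

section OrbitAverage

variable {X : Type*} [MeasurableSpace X]

/-- The average of the first `n + 1` push-forwards of `m` under `T`. -/
noncomputable def orbitAvg (T : X → X) (m : Measure X) (n : ℕ) : Measure X :=
  ((n : ℝ≥0∞) + 1)⁻¹ • ∑ k ∈ Finset.range (n + 1), m.map T^[k]

theorem orbitAvg_real {T : X → X} (hT : Measurable T) (m : Measure X) [IsFiniteMeasure m] (n : ℕ)
    {A : Set X} (hA : MeasurableSet A) :
    (orbitAvg T m n).real A =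
      ((n : ℝ) + 1)⁻¹ * ∑ k ∈ Finset.range (n + 1), m.real (T^[k] ⁻¹' A) := by
  rw [orbitAvg, measureReal_def, Measure.smul_apply, Measure.finsetSum_apply, smul_eq_mul,
    ENNReal.toReal_mul, ENNReal.toReal_sum fun k _ => ?_, ENNReal.toReal_inv]
  · congr 1
    refine Finset.sum_congr rfl fun k _ => ?_
    rw [Measure.map_apply (hT.iterate k) hA, measureReal_def]
  · rw [Measure.map_apply (hT.iterate k) hA]
    exact measure_ne_top _ _

theorem isProbabilityMeasure_orbitAvg {T : X → X} (hT : Measurable T) (m : Measure X)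
    [IsProbabilityMeasure m] (n : ℕ) : IsProbabilityMeasure (orbitAvg T m n) := by
  refine ⟨?_⟩
  rw [orbitAvg, Measure.smul_apply, Measure.finsetSum_apply, smul_eq_mul]
  have : ∀ k ∈ Finset.range (n + 1), (m.map T^[k]) univ = 1 := fun k _ => by
    rw [Measure.map_apply (hT.iterate k) MeasurableSet.univ, preimage_univ, measure_univ]
  rw [Finset.sum_congr rfl this]
  simp only [Finset.sum_const, Finset.card_range, nsmul_eq_mul, Nat.cast_add, Nat.cast_one,
    mul_one]
  exact ENNReal.inv_mul_cancel (by simp) (by simp)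

theorem abs_orbitAvg_preimage_sub_le {T : X → X} (hT : Measurable T) (m : Measure X)
    [IsProbabilityMeasure m] (n : ℕ) {A : Set X} (hA : MeasurableSet A) :
    |(orbitAvg T m n).real (T ⁻¹' A) - (orbitAvg T m n).real A| ≤ 1 / ((n : ℝ) + 1) := by
  rw [orbitAvg_real hT m n (hT hA), orbitAvg_real hT m n hA, ← mul_sub, ← Finset.sum_sub_distrib]
  have : ∀ k, m.real (T^[k] ⁻¹' (T ⁻¹' A)) - m.real (T^[k] ⁻¹' A) =
      m.real (T^[k + 1] ⁻¹' A) - m.real (T^[k] ⁻¹' A) := fun k => by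
    rw [← preimage_comp, ← Function.iterate_succ']
  rw [Finset.sum_congr rfl fun k _ => this k,
    Finset.sum_range_sub fun k => m.real (T^[k] ⁻¹' A), abs_mul, one_div,
    abs_of_pos (by positivity)]
  refine mul_le_of_le_one_right (by positivity) ?_
  rw [abs_le]
  constructor <;> linarith [measureReal_le_one (μ := m) (s := T^[n + 1] ⁻¹' A),
    measureReal_le_one (μ := m) (s := T^[0] ⁻¹' A),
    measureReal_nonneg (μ := m) (s := T^[n + 1] ⁻¹' A),
    measureReal_nonneg (μ := m) (s := T^[0] ⁻¹' A)]

theorem exists_measurePreserving_limit [TopologicalSpace X] [CompactSpace X] [T2Space X]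
    [BorelSpace X] [HasOuterApproxClosed X] {F : ℕ → Type*} [∀ n, Fintype (F n)]
    {q : ∀ n, X → F n} (hq : IsGeneratingSeq q) (hclopen : ∀ n a, IsClopen (q n ⁻¹' {a}))
    {T : X → X} (hT : Continuous T) (m : ℕ → Measure X) [∀ n, IsProbabilityMeasure (m n)] :
    ∃ (U : Ultrafilter ℕ) (μ : Measure X), (U : Filter ℕ) ≤ atTop ∧ IsProbabilityMeasure μ ∧
      MeasurePreserving T μ μ ∧ ∀ A, IsClopen A →
        Tendsto (fun n => (orbitAvg T (m n) n).real A) U (nhds (μ.real A)) := by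
  have hprob : ∀ n, IsProbabilityMeasure (orbitAvg T (m n) n) :=
    fun n => isProbabilityMeasure_orbitAvg hT.measurable (m n) n
  set U : Ultrafilter ℕ := hyperfilter ℕ with hU
  have hUle : (U : Filter ℕ) ≤ atTop := by
    rw [← Nat.cofinite_eq_atTop]; exact hyperfilter_le_cofinite
  set μs : ℕ → ProbabilityMeasure X := fun n => ⟨orbitAvg T (m n) n, hprob n⟩ with hμs
  obtain ⟨μ, -, hμ⟩ := (isCompact_univ (X := ProbabilityMeasure X)).ultrafilter_le_nhds
    (U.map μs) (by simp)
  have hlim : Tendsto μs U (nhds μ) := hμ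
  have hA : ∀ A, IsClopen A →
      Tendsto (fun n => (orbitAvg T (m n) n).real A) U (nhds ((μ : Measure X).real A)) := by
    intro A hA
    have h := ProbabilityMeasure.tendsto_measure_of_null_frontier_of_tendsto' hlim (E := A)
      (by rw [hA.frontier_eq, measure_empty])
    exact (ENNReal.tendsto_toReal (measure_ne_top _ _)).comp h
  refine ⟨U, μ, hUle, inferInstance, ⟨hT.measurable, ?_⟩, hA⟩
  have : IsProbabilityMeasure ((μ : Measure X).map T) :=
    Measure.isProbabilityMeasure_map hT.aemeasurable
  refine hq.measure_ext fun l a => ?_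
  have hc := hclopen l a
  rw [map_measureReal_apply hT.measurable (hq.measurable l _)]
  have h1 := (hA _ (hc.preimage hT)).sub (hA _ hc)
  have h2 : Tendsto (fun n : ℕ => 1 / ((n : ℝ) + 1)) U (nhds 0) :=
    tendsto_one_div_add_atTop_nhds_zero_nat.mono_left hUle
  have h3 := squeeze_zero_norm (fun n => (Real.norm_eq_abs _).trans_le
    (abs_orbitAvg_preimage_sub_le hT.measurable (m n) n hc.1.measurableSet)) h2
  exact sub_eq_zero.1 (tendsto_nhds_unique h1 h3)

end OrbitAverage

section Generating

theorem measurable_initWord {α : Type*} [MeasurableSpace α] (n : ℕ) :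
    Measurable (initWord n : (ℕ → α) → Fin n → α) :=
  measurable_pi_lambda _ fun i => measurable_pi_apply (i : ℕ)

theorem isGeneratingSeq_initWord (N : ℕ) :
    IsGeneratingSeq (fun n => (initWord n : (ℕ → Fin N) → Fin n → Fin N)) where
  refine' {m n} h := ⟨fun v i => v ⟨i, i.2.trans_le h⟩, fun _ => rfl⟩
  measurable n S := measurable_initWord n S.toFinite.measurableSet
  generate := by
    refine iSup_le fun k => ?_
    rintro _ ⟨S, -, rfl⟩
    exact MeasurableSpace.measurableSet_generateFrom
      ⟨k + 1, {v | v (Fin.last k) ∈ S}, by ext x; simp [initWord]⟩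

theorem isGeneratingSeq_initWord_prod (N K : ℕ) :
    IsGeneratingSeq (fun n (p : GaSp N K) => (initWord n p.1, initWord n p.2)) where
  refine' {m n} h := ⟨fun v => (fun i => v.1 ⟨i, i.2.trans_le h⟩,
    fun i => v.2 ⟨i, i.2.trans_le h⟩), fun _ => rfl⟩
  measurable n S := (((measurable_initWord n).comp measurable_fst).prodMk
    ((measurable_initWord n).comp measurable_snd)) S.toFinite.measurableSet
  generate := by
    refine sup_le ((MeasurableSpace.comap_mono (isGeneratingSeq_initWord N).generate).trans ?_)
      ((MeasurableSpace.comap_mono (isGeneratingSeq_initWord K).generate).trans ?_)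
    all_goals
      rw [MeasurableSpace.comap_generateFrom]
      refine MeasurableSpace.generateFrom_mono ?_
      rintro _ ⟨_, ⟨n, S, rfl⟩, rfl⟩
    · exact ⟨n, Prod.fst ⁻¹' S, rfl⟩
    · exact ⟨n, Prod.snd ⁻¹' S, rfl⟩

theorem isClopen_initWord_preimage {N : ℕ} (n : ℕ) (S : Set (Fin n → Fin N)) :
    IsClopen (initWord n ⁻¹' S) :=
  (isClopen_discrete S).preimage (continuous_initWord n)

theorem isClopen_initWord_prod_preimage {N K : ℕ} (n : ℕ)
    (S : Set ((Fin n → Fin N) × (Fin n → Fin K))) :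
    IsClopen ((fun p : GaSp N K => (initWord n p.1, initWord n p.2)) ⁻¹' S) :=
  (isClopen_discrete S).preimage (((continuous_initWord n).comp continuous_fst).prodMk
    ((continuous_initWord n).comp continuous_snd))

end Generating

/-! ### Gibbs measures -/

theorem withDensity_ofReal_real {X : Type*} [MeasurableSpace X] {μ : Measure X} {h : X → ℝ}
    (hm : Measurable h) (h0 : ∀ x, 0 ≤ h x) {B : Set X} (hB : MeasurableSet B) :
    (μ.withDensity fun x => ENNReal.ofReal (h x)).real B = ∫ x in B, h x ∂μ := by
  rw [measureReal_def, withDensity_apply _ hB,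
    integral_eq_lintegral_of_nonneg_ae (ae_of_all _ h0) hm.aestronglyMeasurable]

section Gibbs

variable {N K : ℕ} {M : Fin K → Fin K → Bool} {g : GaSp N K → ℝ} {V G : ℝ}

/-- The density `e^{S_n g(w, j)} / Z_n(g, w)`. -/
noncomputable def gibbsDens (M : Fin K → Fin K → Bool) (g : GaSp N K → ℝ) (n : ℕ)
    (w : ℕ → Fin N) (j : ℕ → Fin K) : ℝ :=
  Real.exp (SnS g n (w, j)) / Zn M g w n

/-- The cylinder of length `l` around `j`, shifted by `k`. -/
def cylAt (k l : ℕ) (j : ℕ → Fin K) : Set (ℕ → Fin K) := {x | ∀ i < l, x (k + i) = j i}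

theorem shift_preimage_cylAt (k l m : ℕ) (j : ℕ → Fin K) :
    shift^[k] ⁻¹' cylAt m l j = cylAt (m + k) l j := by
  ext x
  simp only [cylAt, mem_preimage, mem_ofPred_eq, shift_iterate_apply]
  refine forall₂_congr fun i _ => ?_
  rw [show m + i + k = m + k + i by omega]

theorem cylAt_zero_eq (l : ℕ) (j : ℕ → Fin K) :
    cylAt 0 l j = initWord l ⁻¹' {initWord l j} := by
  ext x
  simp only [cylAt, zero_add, mem_ofPred_eq, mem_preimage, mem_singleton_iff, funext_iff,
    initWord]
  exact ⟨fun h i => h i i.2, fun h i hi => h ⟨i, hi⟩⟩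

theorem isClopen_cylAt (k l : ℕ) (j : ℕ → Fin K) : IsClopen (cylAt k l j) := by
  have h := shift_preimage_cylAt k l 0 j
  rw [zero_add] at h
  rw [← h, cylAt_zero_eq]
  exact (isClopen_initWord_preimage l _).preimage (continuous_shift.iterate k)

namespace IsPotential

theorem continuous_gibbsDens (hg : IsPotential M g V G) (hne : (SigmaA M).Nonempty) (n : ℕ)
    (j : ℕ → Fin K) : Continuous fun w => gibbsDens M g n w j := by
  refine Continuous.div ?_ (hg.continuous_Zn n) fun w => (hg.Zn_pos hne w n).ne'
  exact Real.continuous_exp.comp ((continuous_SnS hg.cont n).comp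
    (continuous_id.prodMk continuous_const))

theorem gibbsDens_pos (hg : IsPotential M g V G) (hne : (SigmaA M).Nonempty) (n : ℕ)
    (w : ℕ → Fin N) (j : ℕ → Fin K) : 0 < gibbsDens M g n w j :=
  div_pos (Real.exp_pos _) (hg.Zn_pos hne w n)

theorem continuous_wordWeight_div (hg : IsPotential M g V G) (hne : (SigmaA M).Nonempty) (n : ℕ)
    (v : Fin n → Fin K) : Continuous fun w => wordWeight M g w n v / Zn M g w n :=
  (hg.continuous_wordWeight n v).div (hg.continuous_Zn n) fun w => (hg.Zn_pos hne w n).ne'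

theorem wordWeight_div_nonneg (hg : IsPotential M g V G) (hne : (SigmaA M).Nonempty) (n : ℕ)
    (v : Fin n → Fin K) (w : ℕ → Fin N) : 0 ≤ wordWeight M g w n v / Zn M g w n :=
  div_nonneg (wordWeight_nonneg _ _ _ _ _) (hg.Zn_pos hne w n).le

end IsPotential

theorem integrable_of_continuous {X : Type*} [MeasurableSpace X] [TopologicalSpace X]
    [CompactSpace X] [BorelSpace X] {μ : Measure X} [IsFiniteMeasure μ] {h : X → ℝ}
    (hh : Continuous h) : Integrable h μ :=
  hh.integrable_of_hasCompactSupport (HasCompactSupport.of_compactSpace h)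

variable [NeZero K]

/-- The finite volume Gibbs measure of level `n`. -/
noncomputable def gibbsApprox (M : Fin K → Fin K → Bool) (g : GaSp N K → ℝ)
    (ν : Measure (ℕ → Fin N)) (n : ℕ) : Measure (GaSp N K) :=
  ∑ v : Fin n → Fin K,
    (ν.withDensity fun w => ENNReal.ofReal (wordWeight M g w n v / Zn M g w n)).map
      fun w => (w, wordPt M v)

variable {ν : Measure (ℕ → Fin N)} [IsProbabilityMeasure ν]

namespace IsPotential

theorem gibbsApprox_real_prod (hg : IsPotential M g V G) (hne : (SigmaA M).Nonempty) (n : ℕ)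
    {B : Set (ℕ → Fin N)} (hB : MeasurableSet B) {E : Set (ℕ → Fin K)} (hE : MeasurableSet E) :
    (gibbsApprox M g ν n).real (B ×ˢ E) = ∫ w in B, ZnOn M g w n E / Zn M g w n ∂ν := by
  classical
  have hterm : ∀ v : Fin n → Fin K,
      ((ν.withDensity fun w => ENNReal.ofReal (wordWeight M g w n v / Zn M g w n)).map
        fun w => (w, wordPt M v)) (B ×ˢ E) =
      ENNReal.ofReal (if v ∈ admWords M n E then
        ∫ w in B, wordWeight M g w n v / Zn M g w n ∂ν else 0) := by
    intro v
    have hm : Measurable fun w : ℕ → Fin N => (w, wordPt M v) :=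
      measurable_id.prodMk measurable_const
    have hc := hg.continuous_wordWeight_div hne n v
    rw [Measure.map_apply hm (hB.prod hE)]
    by_cases hv : wordPt M v ∈ E
    · have : (fun w : ℕ → Fin N => (w, wordPt M v)) ⁻¹' (B ×ˢ E) = B := by
        ext w; simp [hv]
      rw [this]
      have hr := withDensity_ofReal_real (μ := ν) hc.measurable
        (hg.wordWeight_div_nonneg hne n v) hB
      by_cases hadm : IsAdm M v
      · rw [if_pos (mem_admWords.2 ⟨hadm, hv⟩), ← hr, measureReal_def, ENNReal.ofReal_toReal]
        rw [withDensity_apply _ hB]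
        exact (integrable_of_continuous (μ := ν.restrict B) hc).lintegral_lt_top.ne
      · rw [if_neg fun h => hadm (mem_admWords.1 h).1, withDensity_apply _ hB]
        simp [wordWeight_eq_zero g _ hadm]
    · have : (fun w : ℕ → Fin N => (w, wordPt M v)) ⁻¹' (B ×ˢ E) = ∅ := by
        ext w; simp [hv]
      rw [this, measure_empty, if_neg fun h => hv (mem_admWords.1 h).2, ENNReal.ofReal_zero]
  have hnn : ∀ v : Fin n → Fin K, 0 ≤ if v ∈ admWords M n E then
        ∫ w in B, wordWeight M g w n v / Zn M g w n ∂ν else 0 := by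
    intro v
    split_ifs
    · exact integral_nonneg (hg.wordWeight_div_nonneg hne n v)
    · exact le_rfl
  rw [gibbsApprox, measureReal_def, Measure.finsetSum_apply, Finset.sum_congr rfl fun v _ => hterm v,
    ENNReal.toReal_sum fun v _ => ENNReal.ofReal_ne_top]
  simp only [ENNReal.toReal_ofReal (hnn _)]
  rw [Finset.sum_ite_mem, Finset.univ_inter, ← integral_finsetSum]
  · simp only [ZnOn, Finset.sum_div]
  · exact fun v _ => integrable_of_continuous (hg.continuous_wordWeight_div hne n v)

theorem isProbabilityMeasure_gibbsApprox (hg : IsPotential M g V G) (hne : (SigmaA M).Nonempty)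
    (n : ℕ) : IsProbabilityMeasure (gibbsApprox M g ν n) := by
  have h := hg.gibbsApprox_real_prod (ν := ν) hne n MeasurableSet.univ MeasurableSet.univ
  simp only [ZnOn_univ, univ_prod_univ, Measure.restrict_univ,
    div_self (hg.Zn_pos hne _ n).ne'] at h
  simp only [integral_const, probReal_univ, smul_eq_mul, mul_one] at h
  refine ⟨?_⟩
  rwa [measureReal_def, ENNReal.toReal_eq_one_iff] at h

theorem ZnOn_cylAt_div_le (hg : IsPotential M g V G) {r : ℕ} (hr : HasGap M r)
    (hne : (SigmaA M).Nonempty) (w : ℕ → Fin N) {j : ℕ → Fin K} (hj : j ∈ SigmaA M) (k l b : ℕ) :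
    ZnOn M g w (k + l + b) (cylAt k l j) / Zn M g w (k + l + b) ≤
      Real.exp (2 * V) * gapConst K r V G ^ 2 * gibbsDens M g l (shift^[k] w) j := by
  have h1 := hg.ZnOn_le_mul w k hj l b
  have h2 := hg.Zn_mul_le hr hne w (k + l) b
  have h3 := hg.Zn_mul_le hr hne w k l
  have hC := gapConst_pos (K := K) r V G
  have z0 := hg.Zn_pos hne w (k + l + b)
  have z1 := hg.Zn_pos hne w k
  have z2 := hg.Zn_pos hne (shift^[k] w) l
  have z3 := hg.Zn_pos hne (shift^[k + l] w) b
  rw [gibbsDens, div_le_iff₀ z0]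
  refine h1.trans ?_
  set C := gapConst K r V G
  set e := Real.exp (SnS g l (shift^[k] w, j))
  have he : 0 < e := Real.exp_pos _
  calc Real.exp (2 * V) * (Zn M g w k * e * Zn M g (shift^[k + l] w) b)
      = Real.exp (2 * V) * (e / Zn M g (shift^[k] w) l) *
        (Zn M g w k * Zn M g (shift^[k] w) l * Zn M g (shift^[k + l] w) b) := by
        field_simp
    _ ≤ Real.exp (2 * V) * (e / Zn M g (shift^[k] w) l) *
        (C * Zn M g w (k + l) * Zn M g (shift^[k + l] w) b) := by gcongr
    _ = Real.exp (2 * V) * (e / Zn M g (shift^[k] w) l) *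
        (C * (Zn M g w (k + l) * Zn M g (shift^[k + l] w) b)) := by ring
    _ ≤ Real.exp (2 * V) * (e / Zn M g (shift^[k] w) l) *
        (C * (C * Zn M g w (k + l + b))) := by gcongr
    _ = _ := by ring

theorem le_ZnOn_cylAt_div (hg : IsPotential M g V G) {r : ℕ} (hr : HasGap M r)
    (hne : (SigmaA M).Nonempty) (w : ℕ → Fin N) {j : ℕ → Fin K} (hj : j ∈ SigmaA M) (k l b : ℕ) :
    (gapConst K r V G * Real.exp (4 * V))⁻¹ * gibbsDens M g l (shift^[k] w) j ≤
      ZnOn M g w (k + l + b) (cylAt k l j) / Zn M g w (k + l + b) := by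
  have h1 := hg.ZnOn_mul_le hr w (D := univ) (k := k) (by simp) hj l b
  simp only [mem_univ, true_and, ZnOn_univ] at h1
  have h2 := hg.Zn_add_le hne w (k + l) b
  have h3 := hg.Zn_add_le hne w k l
  have hC := gapConst_pos (K := K) r V G
  have z0 := hg.Zn_pos hne w (k + l + b)
  have z1 := hg.Zn_pos hne w k
  have z2 := hg.Zn_pos hne (shift^[k] w) l
  have z3 := hg.Zn_pos hne (shift^[k + l] w) b
  change _ ≤ _ * ZnOn M g w (k + l + b) (cylAt k l j) at h1
  rw [gibbsDens, le_div_iff₀ z0, inv_mul_eq_div, div_mul_eq_mul_div,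
    div_le_iff₀ (mul_pos hC (Real.exp_pos _))]
  set C := gapConst K r V G
  set e := Real.exp (SnS g l (shift^[k] w, j))
  have he : 0 < e := Real.exp_pos _
  have hV : Real.exp (4 * V) = Real.exp (2 * V) * Real.exp (2 * V) := by
    rw [← Real.exp_add]; congr 1; ring
  calc e / Zn M g (shift^[k] w) l * Zn M g w (k + l + b)
      ≤ e / Zn M g (shift^[k] w) l *
        (Real.exp (2 * V) * (Zn M g w (k + l) * Zn M g (shift^[k + l] w) b)) := by gcongr
    _ ≤ e / Zn M g (shift^[k] w) l * (Real.exp (2 * V) * ((Real.exp (2 * V) *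
        (Zn M g w k * Zn M g (shift^[k] w) l)) * Zn M g (shift^[k + l] w) b)) := by gcongr
    _ = Real.exp (4 * V) * (Zn M g w k * e * Zn M g (shift^[k + l] w) b) := by
        rw [hV]; field_simp
    _ ≤ Real.exp (4 * V) * (C * ZnOn M g w (k + l + b) (cylAt k l j)) := by gcongr
    _ = _ := by ring

theorem integrable_ZnOn_div (hg : IsPotential M g V G) (hne : (SigmaA M).Nonempty) (n : ℕ)
    (E : Set (ℕ → Fin K)) {ρ : Measure (ℕ → Fin N)} [IsFiniteMeasure ρ] :
    Integrable (fun w => ZnOn M g w n E / Zn M g w n) ρ :=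
  integrable_of_continuous ((continuous_finsetSum _ fun v _ => hg.continuous_wordWeight n v).div
    (hg.continuous_Zn n) fun w => (hg.Zn_pos hne w n).ne')

end IsPotential

end Gibbs

section GibbsExistence

variable {N K : ℕ} {M : Fin K → Fin K → Bool} {g : GaSp N K → ℝ} {V G : ℝ}

/-- Gibbs measures for the potential `g` relative to `ν`. -/
structure IsGibbs (M : Fin K → Fin K → Bool) (g : GaSp N K → ℝ) (ν : Measure (ℕ → Fin N))
    (μ : Measure (GaSp N K)) (c C : ℝ) : Prop where
  mem : MemMnu M ν μ
  pos : 0 < c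
  le_real : ∀ (l : ℕ), ∀ j ∈ SigmaA M, ∀ B, MeasurableSet B →
    c * ∫ w in B, gibbsDens M g l w j ∂ν ≤ μ.real (B ×ˢ cylAt 0 l j)
  real_le : ∀ (l : ℕ), ∀ j ∈ SigmaA M, ∀ B, MeasurableSet B →
    μ.real (B ×ˢ cylAt 0 l j) ≤ C * ∫ w in B, gibbsDens M g l w j ∂ν

theorem shift2_iterate_preimage_prod (k : ℕ) (B : Set (ℕ → Fin N)) (E : Set (ℕ → Fin K)) :
    shift2^[k] ⁻¹' (B ×ˢ E) = (shift^[k] ⁻¹' B) ×ˢ (shift^[k] ⁻¹' E) := by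
  ext p
  simp [shift2_iterate]

theorem setIntegral_comp_of_measurePreserving {X : Type*} [MeasurableSpace X] {μ : Measure X}
    {T : X → X} (hT : MeasurePreserving T μ μ) {h : X → ℝ} (hh : Measurable h) {B : Set X}
    (hB : MeasurableSet B) : ∫ x in T ⁻¹' B, h (T x) ∂μ = ∫ x in B, h x ∂μ := by
  conv_rhs => rw [← hT.map_eq]
  rw [setIntegral_map hB hh.aestronglyMeasurable hT.measurable.aemeasurable]

variable {ν : Measure (ℕ → Fin N)} [IsProbabilityMeasure ν] [NeZero K]

namespace IsPotential

theorem orbitAvg_gibbsApprox_real (hg : IsPotential M g V G) (hne : (SigmaA M).Nonempty)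
    (m n : ℕ) {B : Set (ℕ → Fin N)} (hB : MeasurableSet B) {E : Set (ℕ → Fin K)}
    (hE : MeasurableSet E) :
    (orbitAvg shift2 (gibbsApprox M g ν m) n).real (B ×ˢ E) =
      ((n : ℝ) + 1)⁻¹ * ∑ k ∈ Finset.range (n + 1),
        ∫ w in shift^[k] ⁻¹' B, ZnOn M g w m (shift^[k] ⁻¹' E) / Zn M g w m ∂ν := by
  have := hg.isProbabilityMeasure_gibbsApprox (ν := ν) hne m
  rw [orbitAvg_real continuous_shift2.measurable _ _ (hB.prod hE)]
  congr 1
  refine Finset.sum_congr rfl fun k _ => ?_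
  rw [shift2_iterate_preimage_prod, hg.gibbsApprox_real_prod hne m
    ((continuous_shift.measurable.iterate k) hB) ((continuous_shift.measurable.iterate k) hE)]

theorem inv_mul_sum_range_succ_const (n : ℕ) (a : ℝ) :
    ((n : ℝ) + 1)⁻¹ * ∑ _k ∈ Finset.range (n + 1), a = a := by
  rw [Finset.sum_const, Finset.card_range, nsmul_eq_mul]
  push_cast
  field_simp

theorem orbitAvg_gibbsApprox_bounds (hg : IsPotential M g V G) {r : ℕ} (hr : HasGap M r)
    (hne : (SigmaA M).Nonempty) (hν : MeasurePreserving shift ν ν) {l n : ℕ} (hln : l ≤ n)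
    {j : ℕ → Fin K} (hj : j ∈ SigmaA M) {B : Set (ℕ → Fin N)} (hB : MeasurableSet B) :
    (gapConst K r V G * Real.exp (4 * V))⁻¹ * ∫ w in B, gibbsDens M g l w j ∂ν ≤
        (orbitAvg shift2 (gibbsApprox M g ν (2 * (n + 1))) n).real (B ×ˢ cylAt 0 l j) ∧
      (orbitAvg shift2 (gibbsApprox M g ν (2 * (n + 1))) n).real (B ×ˢ cylAt 0 l j) ≤
        Real.exp (2 * V) * gapConst K r V G ^ 2 * ∫ w in B, gibbsDens M g l w j ∂ν := by
  rw [hg.orbitAvg_gibbsApprox_real hne _ _ hB (isClopen_cylAt 0 l j).1.measurableSet]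
  have hcont := hg.continuous_gibbsDens hne l j
  have hint : ∀ k, ∫ w in shift^[k] ⁻¹' B, gibbsDens M g l (shift^[k] w) j ∂ν =
      ∫ w in B, gibbsDens M g l w j ∂ν := fun k =>
    setIntegral_comp_of_measurePreserving (hν.iterate k) hcont.measurable hB
  have hi : ∀ k, Integrable (fun w => gibbsDens M g l (shift^[k] w) j)
      (ν.restrict (shift^[k] ⁻¹' B)) := fun k =>
    integrable_of_continuous (hcont.comp (continuous_shift.iterate k))
  have hn : (0 : ℝ) < ((n : ℝ) + 1)⁻¹ := by positivity
  have hk : ∀ k ∈ Finset.range (n + 1), ∃ b, 2 * (n + 1) = k + l + b := fun k hk =>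
    ⟨2 * (n + 1) - (k + l), by have := Finset.mem_range.1 hk; omega⟩
  simp only [shift_preimage_cylAt, zero_add]
  constructor
  · rw [← inv_mul_sum_range_succ_const n (_ * _)]
    refine mul_le_mul_of_nonneg_left (Finset.sum_le_sum fun k hkn => ?_) hn.le
    obtain ⟨b, hb⟩ := hk k hkn
    rw [← hint k, ← integral_const_mul]
    refine integral_mono ((hi k).const_mul _) (hg.integrable_ZnOn_div hne _ _) fun w => ?_
    rw [hb]
    exact hg.le_ZnOn_cylAt_div hr hne w hj k l b
  · rw [← inv_mul_sum_range_succ_const n (_ * _ * _)]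
    refine mul_le_mul_of_nonneg_left (Finset.sum_le_sum fun k hkn => ?_) hn.le
    obtain ⟨b, hb⟩ := hk k hkn
    rw [← hint k, ← integral_const_mul]
    refine integral_mono (hg.integrable_ZnOn_div hne _ _) ((hi k).const_mul _) fun w => ?_
    rw [hb]
    exact hg.ZnOn_cylAt_div_le hr hne w hj k l b

theorem exists_isGibbs (hg : IsPotential M g V G) {r : ℕ} (hr : HasGap M r)
    (hne : (SigmaA M).Nonempty) (hν : MeasurePreserving shift ν ν) :
    ∃ μ c C, IsGibbs M g ν μ c C := by
  have hprob := fun n => hg.isProbabilityMeasure_gibbsApprox (ν := ν) hne (2 * (n + 1))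
  obtain ⟨U, μ, hU, hμ, hinv, hlim⟩ := exists_measurePreserving_limit
    (isGeneratingSeq_initWord_prod N K) (fun n a => isClopen_initWord_prod_preimage n {a})
    continuous_shift2 (fun n => gibbsApprox M g ν (2 * (n + 1)))
  have hlim' : ∀ {B : Set (ℕ → Fin N)} {E : Set (ℕ → Fin K)}, IsClopen B → IsClopen E →
      Tendsto (fun n => (orbitAvg shift2 (gibbsApprox M g ν (2 * (n + 1))) n).real (B ×ˢ E)) U
        (nhds (μ.real (B ×ˢ E))) := fun hB hE => hlim _ (hB.prod hE)
  set c := (gapConst K r V G * Real.exp (4 * V))⁻¹ with hc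
  set C := Real.exp (2 * V) * gapConst K r V G ^ 2 with hC
  have hgap := gapConst_pos (K := K) r V G
  have hc0 : 0 < c := inv_pos.2 (mul_pos hgap (Real.exp_pos _))
  have hC0 : 0 < C := mul_pos (Real.exp_pos _) (pow_pos hgap 2)
  have hdens : ∀ l j, Measurable fun w => gibbsDens M g l w j := fun l j =>
    (hg.continuous_gibbsDens hne l j).measurable
  have hbase : ∀ l, ∀ j ∈ SigmaA M, ∀ {B}, IsClopen B →
      c * ∫ w in B, gibbsDens M g l w j ∂ν ≤ μ.real (B ×ˢ cylAt 0 l j) ∧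
      μ.real (B ×ˢ cylAt 0 l j) ≤ C * ∫ w in B, gibbsDens M g l w j ∂ν := by
    intro l j hj B hB
    have hev : ∀ᶠ n in (U : Filter ℕ), l ≤ n := hU (eventually_ge_atTop l)
    have ht := hlim' hB (isClopen_cylAt 0 l j)
    exact ⟨ge_of_tendsto ht (hev.mono fun n hn =>
        (hg.orbitAvg_gibbsApprox_bounds hr hne hν hn hj hB.1.measurableSet).1),
      le_of_tendsto ht (hev.mono fun n hn =>
        (hg.orbitAvg_gibbsApprox_bounds hr hne hν hn hj hB.1.measurableSet).2)⟩
  have hfib : ∀ l j (B : Set (ℕ → Fin N)), MeasurableSet B → μ.real (B ×ˢ cylAt 0 l j) =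
      ((μ.restrict (univ ×ˢ cylAt 0 l j)).map Prod.fst).real B := by
    intro l j B hB
    rw [map_measureReal_apply measurable_fst hB, measureReal_restrict_apply (measurable_fst hB)]
    congr 1
    ext p; simp
  have hwd : ∀ l j a (B : Set (ℕ → Fin N)), 0 < a → MeasurableSet B →
      (ν.withDensity fun w => ENNReal.ofReal (a * gibbsDens M g l w j)).real B =
        a * ∫ w in B, gibbsDens M g l w j ∂ν := by
    intro l j a B ha hB
    rw [withDensity_ofReal_real ((hdens l j).const_mul a)
      (fun w => mul_nonneg ha.le (hg.gibbsDens_pos hne l w j).le) hB, integral_const_mul]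
  have hfin : ∀ l j a,
      IsFiniteMeasure (ν.withDensity fun w => ENNReal.ofReal (a * gibbsDens M g l w j)) :=
    fun l j a => isFiniteMeasure_withDensity_ofReal
      (integrable_of_continuous ((hg.continuous_gibbsDens hne l j).const_mul a)).2
  have hclop := fun n (a : Fin n → Fin N) => isClopen_initWord_preimage n {a}
  refine ⟨μ, c, C, ⟨hμ, hinv, ?_, ?_⟩, hc0, ?_, ?_⟩
  · have : IsProbabilityMeasure (μ.map Prod.fst) :=
      Measure.isProbabilityMeasure_map measurable_fst.aemeasurable
    refine (isGeneratingSeq_initWord N).measure_ext fun n a => ?_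
    have hB := hclop n a
    rw [map_measureReal_apply measurable_fst hB.1.measurableSet, ← prod_univ]
    refine tendsto_nhds_unique (hlim' hB isClopen_univ) ?_
    refine tendsto_const_nhds.congr fun m => ?_
    rw [hg.orbitAvg_gibbsApprox_real hne _ _ hB.1.measurableSet MeasurableSet.univ]
    simp only [preimage_univ, ZnOn_univ, div_self (hg.Zn_pos hne _ _).ne']
    rw [eq_comm]
    convert inv_mul_sum_range_succ_const m (ν.real (initWord n ⁻¹' {a})) using 3 with k hk
    simp only [integral_const, smul_eq_mul, mul_one, measureReal_restrict_apply_univ]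
    exact (hν.iterate k).measureReal_preimage hB.1.measurableSet.nullMeasurableSet
  · have hEk : ∀ k, IsClopen {x : ℕ → Fin K | M (x k) (x (k + 1)) = false} := fun k => by
      have h : Continuous fun x : ℕ → Fin K => (x k, x (k + 1)) :=
        (continuous_apply k).prodMk (continuous_apply (k + 1))
      exact (isClopen_discrete {q : Fin K × Fin K | M q.1 q.2 = false}).preimage h
    have h0 : ∀ k, μ.real (univ ×ˢ {x : ℕ → Fin K | M (x k) (x (k + 1)) = false}) = 0 := by
      intro k
      refine tendsto_nhds_unique (hlim' isClopen_univ (hEk k)) ?_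
      refine tendsto_const_nhds.congr fun m => ?_
      rw [hg.orbitAvg_gibbsApprox_real hne _ _ MeasurableSet.univ (hEk k).1.measurableSet]
      have : ∀ i w, ZnOn M g w (2 * (m + 1))
          (shift^[i] ⁻¹' {x : ℕ → Fin K | M (x k) (x (k + 1)) = false}) = 0 := by
        intro i w
        refine Finset.sum_eq_zero fun v hv => ?_
        obtain ⟨h1, h2⟩ := mem_admWords.1 hv
        have h3 := shift_iterate_mem_SigmaA h1.wordPt_mem i k
        simp only [mem_preimage, mem_ofPred_eq, h3] at h2
        exact absurd h2 (by simp)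
      simp only [this, zero_div, integral_zero, Finset.sum_const_zero, mul_zero]
    rw [← prob_compl_eq_zero_iff]
    · refine measure_mono_null (t := ⋃ k, univ ×ˢ {x | M (x k) (x (k + 1)) = false}) ?_
        (measure_iUnion_null fun k => (measureReal_eq_zero_iff).1 (h0 k))
      intro p hp
      simpa [SigmaA] using hp
    · exact measurable_snd (isCompact_SigmaA M).measurableSet
  · intro l j hj B hB
    rw [← hwd l j c B hc0 hB, hfib l j B hB]
    have := hfin l j c
    refine (isGeneratingSeq_initWord N).measureReal_le (fun n a => ?_) hB
    have hB' := (hclop n a).1.measurableSet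
    rw [hwd l j c _ hc0 hB', ← hfib l j _ hB']
    exact (hbase l j hj (hclop n a)).1
  · intro l j hj B hB
    rw [← hwd l j C B hC0 hB, hfib l j B hB]
    have := hfin l j C
    refine (isGeneratingSeq_initWord N).measureReal_le (fun n a => ?_) hB
    have hB' := (hclop n a).1.measurableSet
    rw [hwd l j C _ hC0 hB', ← hfib l j _ hB']
    exact (hbase l j hj (hclop n a)).2

end IsPotential

end GibbsExistence

/-! ### Ergodicity of Gibbs measures -/

theorem initWord_inter_shift_preimage_eq {α : Type*} {n l : ℕ} (z : Fin n → α) (b : Fin l → α) :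
    initWord n ⁻¹' {z} ∩ shift^[n] ⁻¹' (initWord l ⁻¹' {b}) =
      cylL (List.ofFn z ++ List.ofFn b) := by
  ext x
  simp only [mem_inter_iff, mem_preimage, mem_singleton_iff, cylL, mem_ofPred_eq, funext_iff,
    initWord, shift_iterate_apply, List.length_append, List.length_ofFn, List.get_eq_getElem]
  constructor
  · rintro ⟨h1, h2⟩ k hk
    rcases lt_or_ge k n with hkn | hkn
    · rw [List.getElem_append_left (by simpa using hkn)]
      simpa using h1 ⟨k, hkn⟩
    · rw [List.getElem_append_right (by simpa using hkn)]
      have := h2 ⟨k - n, by omega⟩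
      simp only [Nat.sub_add_cancel hkn] at this
      simpa using this
  · intro h
    refine ⟨fun k => ?_, fun k => ?_⟩
    · have := h k (by omega)
      rw [List.getElem_append_left (by simp)] at this
      simpa using this
    · have := h (k + n) (by omega)
      rw [List.getElem_append_right (by simp)] at this
      simpa using this

theorem initWord_preimage_singleton_eq {α : Type*} {n : ℕ} (z : Fin n → α) :
    initWord n ⁻¹' {z} = cylL (List.ofFn z) := by
  have := initWord_inter_shift_preimage_eq z (Fin.elim0 : Fin 0 → α)
  simp only [List.ofFn_zero, List.append_nil] at this
  rw [← this, eq_comm, inter_eq_left]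
  intro x _
  simp only [mem_preimage, mem_singleton_iff]
  exact Subsingleton.elim _ _

theorem QuasiBernoulli.exists_pos_mul_le {N : ℕ} {ν : Measure (ℕ → Fin N)} [IsFiniteMeasure ν]
    (h : QuasiBernoulli ν) : ∃ c : ℝ, 0 < c ∧ ∀ (l n : ℕ) (a b : Fin l → Fin N), l ≤ n →
      c * (ν.real (initWord l ⁻¹' {a}) * ν.real (initWord l ⁻¹' {b})) ≤
        ν.real (initWord l ⁻¹' {a} ∩ shift^[n] ⁻¹' (initWord l ⁻¹' {b})) := by
  classical
  obtain ⟨C, hC0, hCt, hC⟩ := h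
  have hq := isGeneratingSeq_initWord N
  refine ⟨C⁻¹.toReal, ENNReal.toReal_pos (ENNReal.inv_ne_zero.2 hCt) (ENNReal.inv_ne_top.2 hC0.ne'),
    fun l n a b hln => ?_⟩
  obtain ⟨ψ, hψ⟩ := hq.refine' hln
  set S : Finset (Fin n → Fin N) := Finset.univ.filter fun z => ψ z = a
  have hA : initWord l ⁻¹' {a} = initWord n ⁻¹' (S : Set (Fin n → Fin N)) := by
    ext x
    simp [S, hψ]
  have hE : MeasurableSet (shift^[n] ⁻¹' (initWord l ⁻¹' {b})) :=
    (continuous_shift.measurable.iterate n) (hq.measurable l {b})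
  rw [hA, inter_comm, hq.measureReal_inter_preimage ν n S hE, hq.measureReal_preimage ν n S,
    Finset.sum_mul, Finset.mul_sum]
  refine Finset.sum_le_sum fun z _ => ?_
  rw [inter_comm, initWord_inter_shift_preimage_eq, initWord_preimage_singleton_eq,
    initWord_preimage_singleton_eq, measureReal_def, measureReal_def, measureReal_def,
    ← ENNReal.toReal_mul, ← ENNReal.toReal_mul]
  exact ENNReal.toReal_mono (measure_ne_top _ _) (hC _ _).1

section

variable {N K : ℕ} {M : Fin K → Fin K → Bool} {g : GaSp N K → ℝ} {V G c C : ℝ}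
  {ν : Measure (ℕ → Fin N)} {μ : Measure (GaSp N K)}

theorem MemMnu.ae_mem (hμ : MemMnu M ν μ) : ∀ᵐ p ∂μ, p.2 ∈ SigmaA M := by
  have := hμ.1
  exact mem_ae_iff_prob_eq_one
    (measurable_snd (isCompact_SigmaA M).measurableSet) |>.2 hμ.2.2.2

theorem IsPotential.gibbsDens_le_of_agree (hg : IsPotential M g V G)
    (hne : (SigmaA M).Nonempty) {n : ℕ} {w w' : ℕ → Fin N} (h : ∀ k < n, w k = w' k)
    {j : ℕ → Fin K} (hj : j ∈ SigmaA M) :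
    gibbsDens M g n w j ≤ Real.exp (2 * V) * gibbsDens M g n w' j := by
  have h1 := (abs_le.1 (hg.var n (w, j) (w', j) hj hj h fun _ _ => rfl)).2
  have h2 := hg.Zn_le_of_agree fun k hk => (h k hk).symm
  have z := hg.Zn_pos hne w n
  have z' := hg.Zn_pos hne w' n
  rw [gibbsDens, gibbsDens, mul_div_assoc', div_le_div_iff₀ z z']
  have h3 : Real.exp (SnS g n (w, j)) ≤ Real.exp V * Real.exp (SnS g n (w', j)) := by
    rw [← Real.exp_add, Real.exp_le_exp]
    linarith
  calc Real.exp (SnS g n (w, j)) * Zn M g w' n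
      ≤ Real.exp V * Real.exp (SnS g n (w', j)) * (Real.exp V * Zn M g w n) := by gcongr
    _ = _ := by rw [two_mul, Real.exp_add]; ring

theorem IsGibbs.const_pos [IsProbabilityMeasure ν] (hμ : IsGibbs M g ν μ c C)
    (hg : IsPotential M g V G) (hne : (SigmaA M).Nonempty) : 0 < C := by
  have := hμ.mem.1
  obtain ⟨j, hj⟩ := hne
  have h := hμ.real_le 0 j hj univ MeasurableSet.univ
  have hI : 0 ≤ ∫ w in univ, gibbsDens M g 0 w j ∂ν :=
    integral_nonneg fun w => (hg.gibbsDens_pos ⟨j, hj⟩ 0 w j).le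
  have h1 : cylAt 0 0 j = univ := by simp [cylAt]
  rw [h1, univ_prod_univ, probReal_univ] at h
  by_contra! hC
  linarith [mul_nonpos_of_nonpos_of_nonneg hC hI]

theorem IsGibbs.exists_word_eq (hμ : IsGibbs M g ν μ c C) {l : ℕ}
    {a : (Fin l → Fin N) × (Fin l → Fin K)}
    (h : μ.real ((fun p : GaSp N K => (initWord l p.1, initWord l p.2)) ⁻¹' {a}) ≠ 0) :
    ∃ x : ℕ → Fin N, ∃ i ∈ SigmaA M, a = (initWord l x, initWord l i) := by
  have := hμ.mem.1
  obtain ⟨p, hp1, hp2⟩ : ∃ p, p ∈ (fun p : GaSp N K => (initWord l p.1, initWord l p.2)) ⁻¹' {a} ∧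
      p.2 ∈ SigmaA M := by
    by_contra! hcon
    refine h ((measureReal_eq_zero_iff).2 ?_)
    exact measure_mono_null (fun p hp => hcon p hp) (ae_iff.1 hμ.mem.ae_mem)
  exact ⟨p.1, p.2, hp2, hp1.symm⟩

theorem IsPotential.setIntegral_gibbsDens_le [IsProbabilityMeasure ν] (hg : IsPotential M g V G)
    (hne : (SigmaA M).Nonempty) {l : ℕ} {j : ℕ → Fin K} (hj : j ∈ SigmaA M) (x : ℕ → Fin N) :
    ∫ w in initWord l ⁻¹' {initWord l x}, gibbsDens M g l w j ∂ν ≤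
      Real.exp (2 * V) * gibbsDens M g l x j * ν.real (initWord l ⁻¹' {initWord l x}) := by
  refine (setIntegral_mono_on (integrable_of_continuous (hg.continuous_gibbsDens hne l j))
    (integrable_const (Real.exp (2 * V) * gibbsDens M g l x j))
    (isClopen_initWord_preimage l _).1.measurableSet fun w hw => ?_).trans_eq ?_
  · exact hg.gibbsDens_le_of_agree hne (fun k hk => congrFun hw ⟨k, hk⟩) hj
  · rw [setIntegral_const, smul_eq_mul, mul_comm]

variable [NeZero K]

theorem IsGibbs.le_real_of_words [IsProbabilityMeasure ν] (hg : IsPotential M g V G)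
    (hne : (SigmaA M).Nonempty)
    (hμ : IsGibbs M g ν μ c C) (n : ℕ) {B : Set (ℕ → Fin N)} (hB : MeasurableSet B)
    {E : Set (ℕ → Fin K)} (hE : ∀ x y : ℕ → Fin K, (∀ i < n, x i = y i) → x ∈ E → y ∈ E) :
    c * Real.exp (-V) * ∫ w in B, ZnOn M g w n E / Zn M g w n ∂ν ≤ μ.real (B ×ˢ E) := by
  have := hμ.mem.1
  calc c * Real.exp (-V) * ∫ w in B, ZnOn M g w n E / Zn M g w n ∂ν
      = ∑ v ∈ admWords M n E,
          c * Real.exp (-V) * ∫ w in B, wordWeight M g w n v / Zn M g w n ∂ν := by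
        simp only [ZnOn, Finset.sum_div]
        rw [integral_finsetSum, Finset.mul_sum]
        exact fun v _ => integrable_of_continuous (hg.continuous_wordWeight_div hne n v)
    _ ≤ ∑ v ∈ admWords M n E, μ.real (B ×ˢ cylAt 0 n (wordPt M v)) := by
        refine Finset.sum_le_sum fun v hv => ?_
        have hv' := (mem_admWords.1 hv).1
        refine le_trans ?_ (hμ.le_real n _ hv'.wordPt_mem B hB)
        rw [mul_assoc, ← integral_const_mul]
        refine mul_le_mul_of_nonneg_left (integral_mono ?_ ?_ fun w => ?_) hμ.pos.le
        · exact (integrable_of_continuous (hg.continuous_wordWeight_div hne n v)).const_mul _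
        · exact integrable_of_continuous (hg.continuous_gibbsDens hne n _)
        · have h1 := hg.wordWeight_le (w := w) (fun _ _ => rfl) (n := n) hv'.wordPt_mem
          rw [hv'.initWord_wordPt] at h1
          have z := hg.Zn_pos hne w n
          change Real.exp (-V) * (wordWeight M g w n v / Zn M g w n) ≤ _ / _
          rw [mul_div_assoc', Real.exp_neg]
          gcongr
          rwa [inv_mul_le_iff₀ (Real.exp_pos _)]
    _ = μ.real (⋃ v ∈ admWords M n E, B ×ˢ cylAt 0 n (wordPt M v)) := by
        rw [measureReal_biUnion_finset]
        · intro v hv u hu hvu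
          refine disjoint_left.2 fun p hp hq => hvu ?_
          have hv' := (mem_admWords.1 hv).1
          have hu' := (mem_admWords.1 hu).1
          have h1 := hp.2
          have h2 := hq.2
          rw [cylAt_zero_eq, hv'.initWord_wordPt] at h1
          rw [cylAt_zero_eq, hu'.initWord_wordPt] at h2
          exact h1.symm.trans h2
        · exact fun v _ => hB.prod (isClopen_cylAt 0 n _).1.measurableSet
    _ ≤ μ.real (B ×ˢ E) := by
        refine measureReal_mono ?_
        refine iUnion₂_subset fun v hv p hp => ⟨hp.1, ?_⟩
        refine hE _ _ (fun i hi => ?_) (mem_admWords.1 hv).2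
        have := hp.2 i hi
        rw [zero_add] at this
        exact this.symm

theorem IsPotential.le_ZnOn_inter_div (hg : IsPotential M g V G) {r : ℕ} (hr : HasGap M r)
    (hne : (SigmaA M).Nonempty) (w : ℕ → Fin N) {i j : ℕ → Fin K} (hi : i ∈ SigmaA M)
    (hj : j ∈ SigmaA M) (l : ℕ) :
    (gapConst K r V G ^ 2 * Real.exp (4 * V))⁻¹ *
        (gibbsDens M g l w i * gibbsDens M g l (shift^[l + r] w) j) ≤
      ZnOn M g w (l + r + l) (cylAt 0 l i ∩ cylAt (l + r) l j) / Zn M g w (l + r + l) := by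
  have h1 := hg.ZnOn_mul_le hr w (D := univ) (k := 0) (by simp) hi l r
  have h1' := hg.exp_le_Zn hne w 0
  simp only [mem_univ, true_and, ZnOn_univ, zero_add, Function.iterate_zero, id_eq] at h1
  have e1 : {x : ℕ → Fin K | ∀ k < l, x k = i k} = cylAt 0 l i := by simp [cylAt]
  rw [e1] at h1
  have h2 := hg.ZnOn_mul_le hr w (D := cylAt 0 l i) (k := l + r) (by
    intro x y hxy hx k hk
    rw [← hx k hk, zero_add]
    exact (hxy k (by omega) (by omega)).symm) hj l 0
  have h2' := hg.exp_le_Zn hne (shift^[l + r + l] w) 0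
  change _ ≤ gapConst K r V G * ZnOn M g w (l + r + l) (cylAt 0 l i ∩ cylAt (l + r) l j) at h2
  simp only [Nat.cast_zero, zero_mul, neg_zero, Real.exp_zero] at h1' h2'
  have h3 := hg.Zn_add_le hne w (l + r) l
  have h4 := hg.Zn_add_le hne w l r
  have hC := gapConst_pos (K := K) r V G
  have z0 := hg.Zn_pos hne w (l + r + l)
  have z1 := hg.Zn_pos hne w l
  have z2 := hg.Zn_pos hne (shift^[l] w) r
  have z3 := hg.Zn_pos hne (shift^[l + r] w) l
  have z4 := ZnOn_nonneg (M := M) g w (l + r) (cylAt 0 l i)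
  have z5 := ZnOn_nonneg (M := M) g w (l + r + l) (cylAt 0 l i ∩ cylAt (l + r) l j)
  rw [gibbsDens, gibbsDens, le_div_iff₀ z0, inv_mul_eq_div, div_mul_eq_mul_div,
    div_le_iff₀ (mul_pos (pow_pos hC 2) (Real.exp_pos _))]
  set Q := gapConst K r V G
  set e := Real.exp (SnS g l (w, i))
  set e' := Real.exp (SnS g l (shift^[l + r] w, j))
  have he : 0 < e := Real.exp_pos _
  have he' : 0 < e' := Real.exp_pos _
  have hV : Real.exp (4 * V) = Real.exp (2 * V) * Real.exp (2 * V) := by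
    rw [← Real.exp_add]; congr 1; ring
  have h5 : e * Zn M g (shift^[l] w) r ≤ Q * ZnOn M g w (l + r) (cylAt 0 l i) :=
    le_trans (by
      rw [mul_assoc]
      exact le_mul_of_one_le_left (mul_pos he z2).le h1') h1
  have h6 : ZnOn M g w (l + r) (cylAt 0 l i) * e' ≤
      Q * ZnOn M g w (l + r + l) (cylAt 0 l i ∩ cylAt (l + r) l j) :=
    le_trans (le_mul_of_one_le_right (mul_nonneg z4 he'.le) h2') h2
  calc e / Zn M g w l * (e' / Zn M g (shift^[l + r] w) l) * Zn M g w (l + r + l)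
      ≤ e / Zn M g w l * (e' / Zn M g (shift^[l + r] w) l) *
        (Real.exp (2 * V) * (Zn M g w (l + r) * Zn M g (shift^[l + r] w) l)) := by gcongr
    _ ≤ e / Zn M g w l * (e' / Zn M g (shift^[l + r] w) l) * (Real.exp (2 * V) *
        ((Real.exp (2 * V) * (Zn M g w l * Zn M g (shift^[l] w) r)) *
          Zn M g (shift^[l + r] w) l)) := by gcongr
    _ = Real.exp (4 * V) * ((e * Zn M g (shift^[l] w) r) * e') := by
        rw [hV]; field_simp
    _ ≤ Real.exp (4 * V) * ((Q * ZnOn M g w (l + r) (cylAt 0 l i)) * e') := by gcongr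
    _ = Real.exp (4 * V) * (Q * (ZnOn M g w (l + r) (cylAt 0 l i) * e')) := by ring
    _ ≤ Real.exp (4 * V) * (Q *
        (Q * ZnOn M g w (l + r + l) (cylAt 0 l i ∩ cylAt (l + r) l j))) := by gcongr
    _ = _ := by ring

theorem IsGibbs.ergodic [IsProbabilityMeasure ν] (hμ : IsGibbs M g ν μ c C)
    (hg : IsPotential M g V G) {r : ℕ} (hr : HasGap M r) (hne : (SigmaA M).Nonempty)
    (hν : QuasiBernoulli ν) : Ergodic shift2 μ := by
  have := hμ.mem.1
  have hC := hμ.const_pos hg hne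
  obtain ⟨b, hb, hqb⟩ := hν.exists_pos_mul_le
  have hc := hμ.pos
  have hQ := gapConst_pos (K := K) r V G
  set Q := gapConst K r V G
  set E := Real.exp (2 * V) with hE
  have hE0 : 0 < E := Real.exp_pos _
  set κ := c * Real.exp (-V) * (Q ^ 2 * Real.exp (4 * V))⁻¹ with hκ
  have hκ0 : 0 < κ := by positivity
  refine (isGeneratingSeq_initWord_prod N K).ergodic hμ.mem.2.1
    (c := κ * b * (E ^ 4 * C ^ 2)⁻¹) (by positivity) fun l => ⟨l + r, fun u v => ?_⟩
  by_cases hu : μ.real ((fun p : GaSp N K => (initWord l p.1, initWord l p.2)) ⁻¹' {u}) = 0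
  · rw [hu]; simp
  by_cases hv : μ.real ((fun p : GaSp N K => (initWord l p.1, initWord l p.2)) ⁻¹' {v}) = 0
  · rw [hv]; simp
  obtain ⟨x, i, hi, rfl⟩ := hμ.exists_word_eq hu
  obtain ⟨y, j, hj, rfl⟩ := hμ.exists_word_eq hv
  have hset : ∀ (x : ℕ → Fin N) (i : ℕ → Fin K),
      (fun p : GaSp N K => (initWord l p.1, initWord l p.2)) ⁻¹' {(initWord l x, initWord l i)} =
        (initWord l ⁻¹' {initWord l x}) ×ˢ cylAt 0 l i := by
    intro x i
    ext p
    simp [cylAt_zero_eq]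
  simp only [hset] at *
  rw [shift2_iterate_preimage_prod, shift_preimage_cylAt, zero_add, prod_inter_prod]
  set A := initWord l ⁻¹' {initWord l x} with hA
  set B := initWord l ⁻¹' {initWord l y} with hB
  have hAm : MeasurableSet A := (isClopen_initWord_preimage l _).1.measurableSet
  have hBm : MeasurableSet B := (isClopen_initWord_preimage l _).1.measurableSet
  have hABm : MeasurableSet (A ∩ shift^[l + r] ⁻¹' B) :=
    hAm.inter ((continuous_shift.measurable.iterate _) hBm)
  set s := gibbsDens M g l x i with hs
  set t := gibbsDens M g l y j with ht
  have hs0 : 0 < s := hg.gibbsDens_pos hne l x i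
  have ht0 : 0 < t := hg.gibbsDens_pos hne l y j
  have hμA : μ.real (A ×ˢ cylAt 0 l i) ≤ C * (E * s * ν.real A) :=
    (hμ.real_le l i hi A hAm).trans
      (mul_le_mul_of_nonneg_left (hg.setIntegral_gibbsDens_le hne hi x) hC.le)
  have hμB : μ.real (B ×ˢ cylAt 0 l j) ≤ C * (E * t * ν.real B) :=
    (hμ.real_le l j hj B hBm).trans
      (mul_le_mul_of_nonneg_left (hg.setIntegral_gibbsDens_le hne hj y) hC.le)
  have hlow := hμ.le_real_of_words hg hne (l + r + l) hABm
    (E := cylAt 0 l i ∩ cylAt (l + r) l j) (by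
      rintro p q hpq ⟨h1, h2⟩
      refine ⟨fun k hk => ?_, fun k hk => ?_⟩
      · rw [← h1 k hk]; exact (hpq _ (by omega)).symm
      · rw [← h2 k hk]; exact (hpq _ (by omega)).symm)
  have hint : (E ^ 2)⁻¹ * (s * t) * ν.real (A ∩ shift^[l + r] ⁻¹' B) ≤
      ∫ w in A ∩ shift^[l + r] ⁻¹' B,
        gibbsDens M g l w i * gibbsDens M g l (shift^[l + r] w) j ∂ν := by
    rw [mul_comm, ← smul_eq_mul, ← setIntegral_const]
    refine setIntegral_mono_on (integrable_const _) (integrable_of_continuous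
      ((hg.continuous_gibbsDens hne l i).mul ((hg.continuous_gibbsDens hne l j).comp
        (continuous_shift.iterate _)))) hABm fun w hw => ?_
    have h1 : s ≤ E * gibbsDens M g l w i :=
      hg.gibbsDens_le_of_agree hne (fun k hk => (congrFun hw.1 ⟨k, hk⟩).symm) hi
    have h2 : t ≤ E * gibbsDens M g l (shift^[l + r] w) j :=
      hg.gibbsDens_le_of_agree hne (fun k hk => (congrFun hw.2 ⟨k, hk⟩).symm) hj
    rw [inv_mul_le_iff₀ (by positivity)]
    calc s * t ≤ (E * gibbsDens M g l w i) * (E * gibbsDens M g l (shift^[l + r] w) j) :=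
          mul_le_mul h1 h2 ht0.le (hs0.le.trans h1)
      _ = _ := by ring
  have hint2 : (Q ^ 2 * Real.exp (4 * V))⁻¹ * ∫ w in A ∩ shift^[l + r] ⁻¹' B,
        gibbsDens M g l w i * gibbsDens M g l (shift^[l + r] w) j ∂ν ≤
      ∫ w in A ∩ shift^[l + r] ⁻¹' B,
        ZnOn M g w (l + r + l) (cylAt 0 l i ∩ cylAt (l + r) l j) / Zn M g w (l + r + l) ∂ν := by
    rw [← integral_const_mul]
    refine integral_mono ((integrable_of_continuous
      ((hg.continuous_gibbsDens hne l i).mul ((hg.continuous_gibbsDens hne l j).comp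
        (continuous_shift.iterate _)))).const_mul _) (hg.integrable_ZnOn_div hne _ _) fun w => ?_
    exact hg.le_ZnOn_inter_div hr hne w hi hj l
  have hq := hqb l (l + r) (initWord l x) (initWord l y) (Nat.le_add_right _ _)
  calc κ * b * (E ^ 4 * C ^ 2)⁻¹ * μ.real (A ×ˢ cylAt 0 l i) * μ.real (B ×ˢ cylAt 0 l j)
      ≤ κ * b * (E ^ 4 * C ^ 2)⁻¹ * (C * (E * s * ν.real A)) * (C * (E * t * ν.real B)) := by
        gcongr
    _ = κ * ((E ^ 2)⁻¹ * (s * t) * (b * (ν.real A * ν.real B))) := by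
        field_simp
    _ ≤ κ * ((E ^ 2)⁻¹ * (s * t) * ν.real (A ∩ shift^[l + r] ⁻¹' B)) := by gcongr
    _ ≤ κ * ∫ w in A ∩ shift^[l + r] ⁻¹' B,
        gibbsDens M g l w i * gibbsDens M g l (shift^[l + r] w) j ∂ν := by gcongr
    _ = c * Real.exp (-V) * ((Q ^ 2 * Real.exp (4 * V))⁻¹ * ∫ w in A ∩ shift^[l + r] ⁻¹' B,
        gibbsDens M g l w i * gibbsDens M g l (shift^[l + r] w) j ∂ν) := by rw [hκ]; ring
    _ ≤ _ := le_trans (mul_le_mul_of_nonneg_left hint2 (by positivity)) hlow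

end

/-! ### Entropy of measures over `ν` -/

theorem limsup_le_limsup_add {u v e : ℕ → ℝ} {L a b : ℝ} (h : ∀ n, u n ≤ v n + e n)
    (he : Tendsto e atTop (nhds L)) (hu : ∀ n, a ≤ u n) (hv : ∀ n, v n ≤ b) :
    limsup u atTop ≤ limsup v atTop + L := by
  refine le_of_forall_pos_le_add fun ε hε => ?_
  have h1 : ∀ᶠ n in atTop, v n < limsup v atTop + ε / 2 :=
    eventually_lt_of_limsup_lt (by linarith) ⟨b, eventually_map.2 (Eventually.of_forall hv)⟩
  have h2 : ∀ᶠ n in atTop, e n < L + ε / 2 := he.eventually_lt_const (by linarith)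
  have hb : IsCoboundedUnder (· ≤ ·) atTop u :=
    IsBoundedUnder.isCoboundedUnder_le ⟨a, eventually_map.2 (Eventually.of_forall hu)⟩
  refine limsup_le_of_le hb ?_
  filter_upwards [h1, h2] with n hn1 hn2
  linarith [h n]

theorem integral_comp_of_finite {X F : Type*} [MeasurableSpace X] [Fintype F]
    [MeasurableSpace F] [MeasurableSingletonClass F] {μ : Measure X} [IsFiniteMeasure μ]
    {q : X → F} (hq : Measurable q) (φ : F → ℝ) :
    ∫ x, φ (q x) ∂μ = ∑ a, μ.real (q ⁻¹' {a}) * φ a := by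
  have hφ : Measurable φ := measurable_of_finite φ
  rw [← integral_map hq.aemeasurable hφ.aestronglyMeasurable, integral_fintype Integrable.of_finite]
  refine Finset.sum_congr rfl fun a _ => ?_
  rw [map_measureReal_apply hq (measurableSet_singleton a), smul_eq_mul]

theorem nlog_eq (x : ℝ) : nlog x = x * -Real.log x := by rw [nlog, mul_neg]

theorem sum_nlog_nonneg {F : Type*} [Fintype F] {m : F → ℝ} (h0 : ∀ a, 0 ≤ m a)
    (h1 : ∑ a, m a = 1) : 0 ≤ ∑ a, nlog (m a) := by
  refine Finset.sum_nonneg fun a ha => ?_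
  rw [nlog_eq]
  refine mul_nonneg (h0 a) (neg_nonneg.2 (Real.log_nonpos (h0 a) ?_))
  rw [← h1]
  exact Finset.single_le_sum (fun b _ => h0 b) ha

theorem sum_nlog_le {F : Type*} [Fintype F] {m : F → ℝ} (h0 : ∀ a, 0 ≤ m a)
    (h1 : ∑ a, m a = 1) : ∑ a, nlog (m a) ≤ Real.log (Fintype.card F) := by
  have hF : 0 < Fintype.card F := by
    rw [Fintype.card_pos_iff]
    by_contra hF
    rw [not_nonempty_iff] at hF
    simp at h1
  have hF' : (0 : ℝ) < Fintype.card F := Nat.cast_pos.2 hF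
  have h : ∀ a, nlog (m a) ≤ m a * Real.log (Fintype.card F) + (1 / Fintype.card F - m a) := by
    intro a
    rcases (h0 a).eq_or_lt with ha | ha
    · rw [← ha]; simp [nlog]
    · have := Real.log_le_sub_one_of_pos (x := 1 / (Fintype.card F * m a)) (by positivity)
      rw [one_div, Real.log_inv, Real.log_mul hF'.ne' ha.ne'] at this
      have h2 := mul_le_mul_of_nonneg_left this ha.le
      have h3 : m a * ((Fintype.card F * m a)⁻¹ - 1) = 1 / Fintype.card F - m a := by
        field_simp
      rw [nlog]
      linarith
  refine (Finset.sum_le_sum fun a _ => h a).trans ?_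
  rw [Finset.sum_add_distrib, ← Finset.sum_mul, Finset.sum_sub_distrib, h1, Finset.sum_const,
    Finset.card_univ, nsmul_eq_mul]
  field_simp
  linarith

section

variable {N K : ℕ}

/-- The pair of initial words of length `n`. -/
def initPair (n : ℕ) (p : GaSp N K) : (Fin n → Fin N) × (Fin n → Fin K) :=
  (initWord n p.1, initWord n p.2)

theorem measurable_initPair (n : ℕ) : Measurable (initPair n : GaSp N K → _) :=
  ((measurable_initWord n).comp measurable_fst).prodMk
    ((measurable_initWord n).comp measurable_snd)

/-- The conditional information of the `n`-cylinders of `μ` relative to `ν`. -/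
noncomputable def condInfo (ν : Measure (ℕ → Fin N)) (μ : Measure (GaSp N K)) (n : ℕ)
    (a : (Fin n → Fin N) × (Fin n → Fin K)) : ℝ :=
  Real.log (ν.real (initWord n ⁻¹' {a.1})) - Real.log (μ.real (initPair n ⁻¹' {a}))

theorem cyl_eq {α : Type*} {n : ℕ} (w : Fin n → α) : cyl w = initWord n ⁻¹' {w} := by
  ext x
  simp [cyl, initWord, funext_iff]

theorem cylP_eq {n : ℕ} (w : Fin n → Fin N) (v : Fin n → Fin K) :
    cylP w v = initPair n ⁻¹' {(w, v)} := by
  ext x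
  simp [cylP, initPair, initWord, funext_iff, Prod.ext_iff]

variable {ν : Measure (ℕ → Fin N)} {μ : Measure (GaSp N K)}

theorem sum_real_initPair [IsFiniteMeasure μ] (hμ : μ.map Prod.fst = ν) {n : ℕ}
    (w : Fin n → Fin N) :
    ∑ v : Fin n → Fin K, μ.real (initPair n ⁻¹' {(w, v)}) = ν.real (initWord n ⁻¹' {w}) := by
  rw [← hμ, map_measureReal_apply measurable_fst (measurable_initWord n (measurableSet_singleton w)),
    ← measureReal_biUnion_finset]
  · congr 1
    ext p
    simp [initPair]
  · intro v _ u _ hvu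
    exact Disjoint.preimage _ (by simpa using hvu)
  · exact fun v _ => measurable_initPair n (measurableSet_singleton _)

theorem sum_nlog_sub [IsFiniteMeasure μ] (hμ : μ.map Prod.fst = ν) (n : ℕ) :
    (∑ w : Fin n → Fin N, ∑ v : Fin n → Fin K, nlog ((μ (cylP w v)).toReal)) -
      ∑ w : Fin n → Fin N, nlog ((ν (cyl w)).toReal) = ∫ p, condInfo ν μ n (initPair n p) ∂μ := by
  rw [integral_comp_of_finite (measurable_initPair n), Fintype.sum_prod_type,
    ← Finset.sum_sub_distrib]
  refine Finset.sum_congr rfl fun w _ => ?_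
  simp only [cyl_eq, cylP_eq, ← measureReal_def, condInfo, mul_sub, Finset.sum_sub_distrib,
    ← Finset.sum_mul, sum_real_initPair hμ, nlog, Finset.sum_neg_distrib]
  ring

theorem entGa_term_bounds [IsProbabilityMeasure μ] (n : ℕ) :
    0 ≤ (∑ w : Fin n → Fin N, ∑ v : Fin n → Fin K, nlog ((μ (cylP w v)).toReal)) / n ∧
      (∑ w : Fin n → Fin N, ∑ v : Fin n → Fin K, nlog ((μ (cylP w v)).toReal)) / n ≤
        Real.log (N * K : ℕ) := by
  have h1 : ∑ a : (Fin n → Fin N) × (Fin n → Fin K), μ.real (initPair n ⁻¹' {a}) = 1 := by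
    have := integral_comp_of_finite (μ := μ) (measurable_initPair (N := N) (K := K) n) fun _ => 1
    simpa using this.symm
  simp only [cylP_eq, ← measureReal_def]
  rw [← Fintype.sum_prod_type (f := fun a => nlog (μ.real (initPair n ⁻¹' {a})))]
  have h2 := sum_nlog_nonneg (fun a => measureReal_nonneg (μ := μ) (s := initPair n ⁻¹' {a})) h1
  have h3 := sum_nlog_le (fun a => measureReal_nonneg (μ := μ) (s := initPair n ⁻¹' {a})) h1
  refine ⟨by positivity, div_le_of_le_mul₀ (by positivity) (Real.log_natCast_nonneg _) ?_⟩
  refine h3.trans_eq ?_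
  rw [Fintype.card_prod, Fintype.card_fun, Fintype.card_fun, Fintype.card_fin, Fintype.card_fin,
    Fintype.card_fin, ← mul_pow, Nat.cast_pow, Real.log_pow, mul_comm]

theorem entOm_term_bounds [IsProbabilityMeasure ν] (n : ℕ) :
    0 ≤ (∑ w : Fin n → Fin N, nlog ((ν (cyl w)).toReal)) / n ∧
      (∑ w : Fin n → Fin N, nlog ((ν (cyl w)).toReal)) / n ≤ Real.log N := by
  have h1 : ∑ a : (Fin n → Fin N), ν.real (initWord n ⁻¹' {a}) = 1 := by
    have := integral_comp_of_finite (μ := ν) (measurable_initWord (α := Fin N) n) fun _ => 1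
    simpa using this.symm
  simp only [cyl_eq, ← measureReal_def]
  have h2 := sum_nlog_nonneg (fun a => measureReal_nonneg (μ := ν) (s := initWord n ⁻¹' {a})) h1
  have h3 := sum_nlog_le (fun a => measureReal_nonneg (μ := ν) (s := initWord n ⁻¹' {a})) h1
  refine ⟨by positivity, div_le_of_le_mul₀ (by positivity) (Real.log_natCast_nonneg _) ?_⟩
  refine h3.trans_eq ?_
  rw [Fintype.card_fun, Fintype.card_fin, Fintype.card_fin, Nat.cast_pow, Real.log_pow, mul_comm]

variable [IsProbabilityMeasure ν] [IsProbabilityMeasure μ]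

theorem entGa_le_entOm_add (hμ : μ.map Prod.fst = ν) {e : ℕ → ℝ} {L : ℝ}
    (he : Tendsto e atTop (nhds L))
    (h : ∀ n, (∫ p, condInfo ν μ n (initPair n p) ∂μ) / n ≤ e n) :
    entGa μ ≤ entOm ν + L := by
  refine limsup_le_limsup_add (fun n => ?_) he (fun n => (entGa_term_bounds n).1)
    fun n => (entOm_term_bounds n).2
  have := h n
  rw [← sum_nlog_sub hμ, sub_div] at this
  linarith

theorem entOm_le_entGa_add (hμ : μ.map Prod.fst = ν) {e : ℕ → ℝ} {L : ℝ}
    (he : Tendsto e atTop (nhds L))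
    (h : ∀ n, -e n ≤ (∫ p, condInfo ν μ n (initPair n p) ∂μ) / n) :
    entOm ν ≤ entGa μ + L := by
  refine limsup_le_limsup_add (fun n => ?_) he (fun n => (entOm_term_bounds n).1)
    fun n => (entGa_term_bounds n).2
  have := h n
  rw [← sum_nlog_sub hμ, sub_div] at this
  linarith

theorem entOm_le_entGa (hμ : μ.map Prod.fst = ν) : entOm ν ≤ entGa μ := by
  have := entOm_le_entGa_add hμ (e := fun _ => 0) tendsto_const_nhds fun n => by
    rw [neg_zero, integral_comp_of_finite (measurable_initPair n)]
    refine div_nonneg (Finset.sum_nonneg fun a _ => ?_) n.cast_nonneg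
    rcases (measureReal_nonneg (μ := μ) (s := initPair n ⁻¹' {a})).eq_or_lt with ha | ha
    · rw [← ha, zero_mul]
    · refine mul_nonneg ha.le (sub_nonneg.2 (Real.log_le_log ha ?_))
      rw [← sum_real_initPair hμ]
      exact Finset.single_le_sum (f := fun v => μ.real (initPair n ⁻¹' {(a.1, v)}))
        (fun _ _ => measureReal_nonneg) (Finset.mem_univ a.2)
  simpa using this

end

/-! ### The variational principle -/

section

variable {N K : ℕ} {M : Fin K → Fin K → Bool} {g : GaSp N K → ℝ} {V G c C : ℝ}
  {ν : Measure (ℕ → Fin N)} {μ : Measure (GaSp N K)}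

theorem ae_real_initPair_pos [IsFiniteMeasure μ] (n : ℕ) :
    ∀ᵐ p ∂μ, 0 < μ.real (initPair n ⁻¹' {initPair n p}) := by
  have h : ∀ a, ∀ᵐ p ∂μ, initPair n p = a → 0 < μ.real (initPair n ⁻¹' {a}) := by
    intro a
    by_cases ha : μ.real (initPair n ⁻¹' {a}) = 0
    · rw [measureReal_eq_zero_iff] at ha
      filter_upwards [measure_eq_zero_iff_ae_notMem.1 ha] with p hp hpa
      exact absurd hpa hp
    · exact ae_of_all _ fun p _ => lt_of_le_of_ne measureReal_nonneg (Ne.symm ha)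
  filter_upwards [ae_all_iff.2 h] with p hp
  exact hp _ rfl

theorem integral_SnS (hinv : MeasurePreserving shift2 μ μ) (hi : Integrable g μ) (n : ℕ) :
    ∫ p, SnS g n p ∂μ = n * ∫ p, g p ∂μ := by
  simp only [SnS]
  rw [integral_finsetSum]
  · rw [Finset.sum_congr rfl fun k _ =>
      integral_comp_of_measurePreserving (hinv.iterate k) hi.aestronglyMeasurable]
    simp
  · exact fun k _ => (hinv.iterate k).integrable_comp_of_integrable hi

theorem surjective_initWord {α : Type*} [Nonempty α] (n : ℕ) :
    Function.Surjective (initWord n : (ℕ → α) → Fin n → α) := by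
  intro w
  refine ⟨fun k => if h : k < n then w ⟨k, h⟩ else Classical.arbitrary α, ?_⟩
  ext i
  simp [initWord]

theorem tendsto_pressure_term [NeZero K] [IsProbabilityMeasure ν] (hg : IsPotential M g V G)
    {r : ℕ} (hr : HasGap M r) (hne : (SigmaA M).Nonempty) (hν : MeasurePreserving shift ν ν)
    (a b : ℝ) :
    Tendsto (fun n : ℕ => (∫ w, Real.log (Zn M g w n) ∂ν - n * a + b) / n) atTop
      (nhds (condPressure M ν g - a)) := by
  have h1 := hg.tendsto_condPressure hr hne hν
  have h2 := (h1.sub_const a).add (tendsto_const_div_atTop_nhds_zero_nat b)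
  rw [add_zero] at h2
  refine h2.congr' ?_
  filter_upwards [eventually_gt_atTop 0] with n hn
  have : (n : ℝ) ≠ 0 := by exact_mod_cast hn.ne'
  field_simp

namespace IsPotential

theorem integral_condInfo_le [NeZero K] [IsProbabilityMeasure ν] (hg : IsPotential M g V G)
    (hne : (SigmaA M).Nonempty) (hμ : MemMnu M ν μ) (n : ℕ) :
    ∫ p, condInfo ν μ n (initPair n p) ∂μ ≤
      ∫ w, Real.log (Zn M g w n) ∂ν - n * ∫ p, g p ∂μ + 2 * V := by
  have hprob := hμ.1
  have hfst := hμ.2.2.1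
  have : Nonempty (Fin N) := by
    obtain ⟨w⟩ := nonempty_of_isProbabilityMeasure ν
    exact ⟨w 0⟩
  set x := Function.surjInv (surjective_initWord (α := Fin N) n)
  have hx : ∀ w, initWord n (x w) = w := Function.surjInv_eq _
  set R : (Fin n → Fin N) × (Fin n → Fin K) → ℝ := fun a =>
    ν.real (initWord n ⁻¹' {a.1}) * wordWeight M g (x a.1) n a.2 /
      (μ.real (initPair n ⁻¹' {a}) * Zn M g (x a.1) n) with hR
  have hz : ∀ w, 0 < Zn M g w n := fun w => hg.Zn_pos hne w n
  have hpt : ∀ᵐ p ∂μ, condInfo ν μ n (initPair n p) ≤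
      Real.log (Zn M g p.1 n) - SnS g n p + (2 * V + (R (initPair n p) - 1)) := by
    filter_upwards [ae_real_initPair_pos n, hμ.ae_mem] with p hp hpA
    set a := initPair n p with ha
    have hagree : ∀ k < n, p.1 k = x a.1 k := fun k hk =>
      (congrFun (hx a.1) ⟨k, hk⟩).symm
    have h1 := (abs_le.1 (hg.var n p (x a.1, p.2) hpA hpA hagree fun _ _ => rfl)).2
    have h2 : Real.exp (SnS g n (x a.1, p.2)) ≤ wordWeight M g (x a.1) n a.2 :=
      hg.le_wordWeight (x a.1) n hpA
    have hw : 0 < wordWeight M g (x a.1) n a.2 := (Real.exp_pos _).trans_le h2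
    rw [← Real.le_log_iff_exp_le hw] at h2
    have h3 := Real.log_le_log (hz _) (hg.Zn_le_of_agree fun k hk => (hagree k hk).symm)
    rw [Real.log_mul (Real.exp_pos _).ne' (hz _).ne', Real.log_exp] at h3
    have hνa : 0 < ν.real (initWord n ⁻¹' {a.1}) := by
      refine hp.trans_le ?_
      rw [← sum_real_initPair hfst]
      exact Finset.single_le_sum (f := fun v => μ.real (initPair n ⁻¹' {(a.1, v)}))
        (fun _ _ => measureReal_nonneg) (Finset.mem_univ a.2)
    have h4 := Real.log_le_sub_one_of_pos (x := R a)
      (div_pos (mul_pos hνa hw) (mul_pos hp (hz _)))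
    have h5 : Real.log (R a) = Real.log (ν.real (initWord n ⁻¹' {a.1})) +
        Real.log (wordWeight M g (x a.1) n a.2) - (Real.log (μ.real (initPair n ⁻¹' {a})) +
          Real.log (Zn M g (x a.1) n)) := by
      rw [hR, Real.log_div (mul_pos hνa hw).ne' (mul_pos hp (hz _)).ne',
        Real.log_mul hνa.ne' hw.ne', Real.log_mul hp.ne' (hz _).ne']
    rw [condInfo]
    linarith
  have hsum : ∫ p, R (initPair n p) ∂μ ≤ 1 := by
    rw [integral_comp_of_finite (measurable_initPair n), Fintype.sum_prod_type]
    calc _ ≤ ∑ w : Fin n → Fin N, ∑ v : Fin n → Fin K,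
          ν.real (initWord n ⁻¹' {w}) * (wordWeight M g (x w) n v / Zn M g (x w) n) := by
          refine Finset.sum_le_sum fun w _ => Finset.sum_le_sum fun v _ => ?_
          rcases eq_or_ne (μ.real (initPair n ⁻¹' {(w, v)})) 0 with h0 | h0
          · rw [h0, zero_mul]
            exact mul_nonneg measureReal_nonneg (hg.wordWeight_div_nonneg hne n v _)
          · simp only [hR]
            have := (hz (x w)).ne'
            field_simp
            exact le_rfl
      _ = ∑ w : Fin n → Fin N, ν.real (initWord n ⁻¹' {w}) := by
          refine Finset.sum_congr rfl fun w _ => ?_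
          rw [← Finset.mul_sum, ← Finset.sum_div, ← Zn_eq_sum, div_self (hz _).ne', mul_one]
      _ = 1 := by
          have := integral_comp_of_finite (μ := ν) (measurable_initWord (α := Fin N) n) fun _ => 1
          simpa using this.symm
  have hiS : Integrable (SnS g n) μ := integrable_of_continuous (continuous_SnS hg.cont n)
  have hiZ : Integrable (fun p : GaSp N K => Real.log (Zn M g p.1 n)) μ := by
    have := hg.integrable_log_Zn (ν := ν) hne n
    rw [← hfst] at this
    exact this.comp_measurable measurable_fst
  have hfin : ∀ φ : (Fin n → Fin N) × (Fin n → Fin K) → ℝ,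
      Integrable (fun p => φ (initPair n p)) μ := fun φ =>
    (Integrable.of_finite (f := φ)).comp_measurable (measurable_initPair n)
  refine (integral_mono_ae (hfin _) ((hiZ.sub hiS).add
    ((integrable_const (2 * V)).add ((hfin R).sub (integrable_const 1)))) hpt).trans ?_
  rw [integral_add' (hiZ.sub hiS) ((integrable_const (2 * V)).add ((hfin R).sub
    (integrable_const 1))), integral_sub' hiZ hiS, integral_add' (integrable_const (2 * V))
    ((hfin R).sub (integrable_const 1)), integral_sub' (hfin R) (integrable_const 1),
    integral_SnS hμ.2.1 (integrable_of_continuous hg.cont)]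
  have hZ : ∫ p : GaSp N K, Real.log (Zn M g p.1 n) ∂μ = ∫ w, Real.log (Zn M g w n) ∂ν :=
    integral_comp_of_measurePreserving ⟨measurable_fst, hfst⟩
      (hg.measurable_log_Zn n).aestronglyMeasurable
  rw [hZ]
  simp only [integral_const, probReal_univ, smul_eq_mul, one_mul]
  linarith

theorem entGa_add_integral_le [NeZero K] [IsProbabilityMeasure ν] (hg : IsPotential M g V G)
    {r : ℕ} (hr : HasGap M r) (hne : (SigmaA M).Nonempty) (hν : MeasurePreserving shift ν ν)
    (hμ : MemMnu M ν μ) : entGa μ + ∫ p, g p ∂μ ≤ entOm ν + condPressure M ν g := by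
  have hprob := hμ.1
  have := entGa_le_entOm_add hμ.2.2.1
    (tendsto_pressure_term hg hr hne hν (∫ p, g p ∂μ) (2 * V)) fun n =>
      div_le_div_of_nonneg_right (hg.integral_condInfo_le hne hμ n) n.cast_nonneg
  linarith

theorem le_integral_condInfo [NeZero K] [IsProbabilityMeasure ν] (hg : IsPotential M g V G)
    (hne : (SigmaA M).Nonempty) (hμ : IsGibbs M g ν μ c C) (n : ℕ) :
    ∫ w, Real.log (Zn M g w n) ∂ν - n * ∫ p, g p ∂μ - (Real.log C + 2 * V) ≤
      ∫ p, condInfo ν μ n (initPair n p) ∂μ := by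
  have hprob := hμ.mem.1
  have hfst := hμ.mem.2.2.1
  have hC := hμ.const_pos hg hne
  have hz : ∀ w, 0 < Zn M g w n := fun w => hg.Zn_pos hne w n
  have hpt : ∀ᵐ p ∂μ, Real.log (Zn M g p.1 n) - SnS g n p - (Real.log C + 2 * V) ≤
      condInfo ν μ n (initPair n p) := by
    filter_upwards [ae_real_initPair_pos n, hμ.mem.ae_mem] with p hp hpA
    have hset : initPair n ⁻¹' {initPair n p} =
        (initWord n ⁻¹' {initWord n p.1}) ×ˢ cylAt 0 n p.2 := by
      ext q
      simp [cylAt_zero_eq, initPair]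
    have h1 : μ.real (initPair n ⁻¹' {initPair n p}) ≤ C * (Real.exp (2 * V) *
        gibbsDens M g n p.1 p.2 * ν.real (initWord n ⁻¹' {initWord n p.1})) := by
      rw [hset]
      exact (hμ.real_le n _ hpA _ (isClopen_initWord_preimage n _).1.measurableSet).trans
        (mul_le_mul_of_nonneg_left (hg.setIntegral_gibbsDens_le hne hpA p.1) hC.le)
    have hd := hg.gibbsDens_pos hne n p.1 p.2
    have hν0 : ν.real (initWord n ⁻¹' {initWord n p.1}) ≠ 0 := by
      intro h0
      rw [h0] at h1
      linarith
    have h2 := Real.log_le_log hp h1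
    rw [Real.log_mul hC.ne' (by positivity), Real.log_mul (by positivity) hν0,
      Real.log_mul (by positivity) hd.ne', Real.log_exp, gibbsDens,
      Real.log_div (Real.exp_pos _).ne' (hz _).ne', Real.log_exp] at h2
    rw [condInfo]
    change _ ≤ Real.log (ν.real (initWord n ⁻¹' {initWord n p.1})) - _
    linarith
  have hiS : Integrable (SnS g n) μ := integrable_of_continuous (continuous_SnS hg.cont n)
  have hiZ : Integrable (fun p : GaSp N K => Real.log (Zn M g p.1 n)) μ := by
    have := hg.integrable_log_Zn (ν := ν) hne n
    rw [← hfst] at this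
    exact this.comp_measurable measurable_fst
  have hfin : ∀ φ : (Fin n → Fin N) × (Fin n → Fin K) → ℝ,
      Integrable (fun p => φ (initPair n p)) μ := fun φ =>
    (Integrable.of_finite (f := φ)).comp_measurable (measurable_initPair n)
  refine le_trans ?_ (integral_mono_ae ((hiZ.sub hiS).sub (integrable_const _)) (hfin _) hpt)
  have hZ : ∫ p : GaSp N K, Real.log (Zn M g p.1 n) ∂μ = ∫ w, Real.log (Zn M g w n) ∂ν :=
    integral_comp_of_measurePreserving ⟨measurable_fst, hfst⟩
      (hg.measurable_log_Zn n).aestronglyMeasurable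
  rw [integral_sub' (hiZ.sub hiS) (integrable_const _), integral_sub' hiZ hiS,
    integral_SnS hμ.mem.2.1 (integrable_of_continuous hg.cont), hZ]
  simp

theorem entGa_add_integral_eq [NeZero K] [IsProbabilityMeasure ν] (hg : IsPotential M g V G)
    {r : ℕ} (hr : HasGap M r) (hne : (SigmaA M).Nonempty) (hν : MeasurePreserving shift ν ν)
    (hμ : IsGibbs M g ν μ c C) : entGa μ + ∫ p, g p ∂μ = entOm ν + condPressure M ν g := by
  have hprob := hμ.mem.1
  refine le_antisymm (hg.entGa_add_integral_le hr hne hν hμ.mem) ?_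
  have := entOm_le_entGa_add hμ.mem.2.2.1
    (tendsto_pressure_term hg hr hne hν (∫ p, g p ∂μ) (-(Real.log C + 2 * V))).neg fun n => by
      rw [neg_neg, ← sub_eq_add_neg]
      exact div_le_div_of_nonneg_right (hg.le_integral_condInfo hne hμ n) n.cast_nonneg
  linarith

end IsPotential

end

/-! ### Topological entropy -/

section

variable {α : Type*}

instance Word.instCountable [Countable α] : Countable (Word α) :=
  inferInstanceAs (Countable (Σ n : ℕ, Fin n → α))

theorem mem_cylSet_initWord (x : ℕ → α) (n : ℕ) :
    x ∈ Word.cylSet (⟨n, initWord n x⟩ : Word α) := fun _ => rfl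

theorem Hsr_mono_level (E : Set (ℕ → α)) (s : ℝ) {r r' : ℕ} (h : r ≤ r') :
    Hsr E s r ≤ Hsr E s r' :=
  le_iInf fun S => le_iInf fun hS => le_iInf fun hE =>
    iInf_le_of_le S (iInf_le_of_le (fun w hw => h.trans_lt (hS w hw)) (iInf_le _ hE))

theorem Hentm_mono {E F : Set (ℕ → α)} (h : E ⊆ F) (s : ℝ) : Hentm E s ≤ Hentm F s :=
  iSup_mono fun _ => le_iInf fun S => le_iInf fun hS => le_iInf fun hE =>
    iInf_le_of_le S (iInf_le_of_le hS (iInf_le _ (h.trans hE)))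

theorem Hsr_le_tsum_word {E : Set (ℕ → α)} {t : ℝ} {r : ℕ} (a : Word α → ℝ≥0∞)
    (h : ∀ x ∈ E, ∃ n, r < n ∧ ENNReal.ofReal (Real.exp (-t * n)) ≤ a ⟨n, initWord n x⟩) :
    Hsr E t r ≤ ∑' w : {w : Word α | r < w.len}, a w := by
  set S : Set (Word α) := {w | r < w.len ∧ ENNReal.ofReal (Real.exp (-t * w.len)) ≤ a w}
  have hcov : E ⊆ ⋃ w ∈ S, w.cylSet := by
    intro x hx
    obtain ⟨n, hn, hna⟩ := h x hx
    exact mem_iUnion₂.2 ⟨⟨n, initWord n x⟩, ⟨hn, hna⟩, mem_cylSet_initWord x n⟩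
  refine (iInf₂_le_of_le S (fun w hw => hw.1) (iInf_le _ hcov)).trans ?_
  refine (ENNReal.tsum_le_tsum fun w : S => w.2.2).trans ?_
  exact ENNReal.tsum_mono_subtype a fun w hw => hw.1

theorem tsum_word_eq {K : ℕ} (a : Word (Fin K) → ℝ≥0∞) (r : ℕ) :
    ∑' w : {w : Word (Fin K) | r < w.len}, a w =
      ∑' n : ℕ, if r < n then ∑ v : Fin n → Fin K, a ⟨n, v⟩ else 0 := by
  rw [tsum_subtype]
  refine (ENNReal.tsum_sigma' _).trans (tsum_congr fun n => ?_)
  rw [tsum_fintype]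
  split_ifs with h
  · exact Finset.sum_congr rfl fun v _ => indicator_of_mem
      (s := {w : Word (Fin K) | r < w.len}) (a := (⟨n, v⟩ : Word (Fin K))) h a
  · exact Finset.sum_eq_zero fun v _ => indicator_of_notMem
      (s := {w : Word (Fin K) | r < w.len}) (a := (⟨n, v⟩ : Word (Fin K))) h a

theorem Hsr_le_tsum {K : ℕ} {E : Set (ℕ → Fin K)} {t : ℝ} {r : ℕ}
    (a : (n : ℕ) → (Fin n → Fin K) → ℝ≥0∞)
    (h : ∀ x ∈ E, ∃ n, r < n ∧ ENNReal.ofReal (Real.exp (-t * n)) ≤ a n (initWord n x)) :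
    Hsr E t r ≤ ∑' n : ℕ, if r < n then ∑ v : Fin n → Fin K, a n v else 0 :=
  (Hsr_le_tsum_word (fun w => a w.1 w.2) h).trans (tsum_word_eq (fun w => a w.1 w.2) r).le

theorem htop_le_of_Hentm_ne_top {E : Set (ℕ → α)} {s : ℝ} (hs : 0 ≤ s) (h : Hentm E s ≠ ⊤) :
    htop E ≤ s := by
  rw [htop]
  split_ifs
  · exact bot_le
  · exact EReal.coe_le_coe_iff.2 (csInf_le ⟨0, fun t ht => ht.1⟩ ⟨hs, h⟩)

variable {K : ℕ} [NeZero K]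

theorem Hentm_log_ne_top (E : Set (ℕ → Fin K)) : Hentm E (Real.log K) ≠ ⊤ := by
  have hK : (0 : ℝ) < K := Nat.cast_pos.2 (NeZero.pos K)
  refine ne_top_of_le_ne_top ENNReal.one_ne_top (iSup_le fun r => ?_)
  refine (Hsr_le_tsum (r := r)
    (fun n _ => if n = r + 1 then ENNReal.ofReal (Real.exp (-Real.log K * (r + 1 : ℕ))) else 0)
    fun x _ => ⟨r + 1, by omega, ?_⟩).trans ?_
  · simp
  · rw [tsum_eq_single (r + 1)]
    · simp only [lt_add_iff_pos_right, zero_lt_one, if_true, Finset.sum_const,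
        Finset.card_univ, Fintype.card_fun, Fintype.card_fin, nsmul_eq_mul]
      rw [neg_mul, Real.exp_neg, mul_comm (Real.log _), Real.exp_nat_mul, Real.exp_log hK,
        ← ENNReal.ofReal_natCast, ← ENNReal.ofReal_mul (by positivity), Nat.cast_pow,
        mul_inv_cancel₀ (by positivity), ENNReal.ofReal_one]
    · intro n hn
      simp [hn]

theorem htop_mono {E F : Set (ℕ → Fin K)} (h : E ⊆ F) : htop E ≤ htop F := by
  rw [htop, htop]
  split_ifs with h1 h2 h2
  · exact le_rfl
  · exact bot_le
  · exact absurd (subset_empty_iff.1 (h2 ▸ h)) h1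
  · refine EReal.coe_le_coe_iff.2 (csInf_le_csInf ⟨0, fun t ht => ht.1⟩ ?_ fun t ht =>
      ⟨ht.1, ne_top_of_le_ne_top ht.2 (Hentm_mono h t)⟩)
    exact ⟨_, Real.log_natCast_nonneg K, Hentm_log_ne_top F⟩

/-- The mass distribution principle. -/
theorem le_htop_of_measure {m : Measure (ℕ → Fin K)} [IsFiniteMeasure m]
    {E : Set (ℕ → Fin K)} (hE : m E ≠ 0) {s : ℝ}
    (h : ∀ x ∈ E, ∀ᶠ n : ℕ in atTop,
      m.real (initWord n ⁻¹' {initWord n x}) ≤ Real.exp (-s * n)) : (s : EReal) ≤ htop E := by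
  have hne : E ≠ ∅ := by rintro rfl; simp at hE
  rw [htop, if_neg hne]
  refine EReal.coe_le_coe_iff.2 (le_csInf
    ⟨_, Real.log_natCast_nonneg K, Hentm_log_ne_top E⟩ fun t ht => ?_)
  by_contra! hts
  refine ht.2 ?_
  set F : ℕ → Set (ℕ → Fin K) := fun j => {x ∈ E | ∀ n ≥ j,
    m.real (initWord n ⁻¹' {initWord n x}) ≤ Real.exp (-s * n)} with hF
  obtain ⟨j, hj⟩ : ∃ j, m (F j) ≠ 0 := by
    by_contra! h0
    refine hE (measure_mono_null (fun x hx => ?_) (measure_iUnion_null h0))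
    obtain ⟨j, hj⟩ := eventually_atTop.1 (h x hx)
    exact mem_iUnion.2 ⟨j, hx, hj⟩
  have key : ∀ r ≥ j, ENNReal.ofReal (Real.exp ((s - t) * r)) * m (F j) ≤ Hentm E t := by
    intro r hr
    refine le_trans ?_ (le_iSup _ r)
    refine le_iInf fun S => le_iInf fun hS => le_iInf fun hcov => ?_
    have hterm : ∀ w : S, ENNReal.ofReal (Real.exp ((s - t) * r)) * m (F j ∩ (w : Word _).cylSet) ≤
        ENNReal.ofReal (Real.exp (-t * (w : Word (Fin K)).len)) := by
      rintro ⟨w, hw⟩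
      rcases (F j ∩ w.cylSet).eq_empty_or_nonempty with h0 | ⟨x, hx, hxw⟩
      · simp [h0]
      · have hrw : r < w.len := hS w hw
        have hsub : F j ∩ w.cylSet ⊆ initWord w.len ⁻¹' {initWord w.len x} := by
          rintro y ⟨-, hy⟩
          ext i
          simp only [initWord]
          rw [hy i, hxw i]
        have h1 := hx.2 w.len (hr.trans hrw.le)
        have h2 : m (F j ∩ w.cylSet) ≤ ENNReal.ofReal (Real.exp (-s * w.len)) := by
          refine (measure_mono hsub).trans ?_
          rw [measureReal_def] at h1
          exact (ENNReal.le_ofReal_iff_toReal_le (measure_ne_top _ _) (Real.exp_pos _).le).2 h1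
        refine (mul_le_mul_right h2 _).trans ?_
        rw [← ENNReal.ofReal_mul (Real.exp_pos _).le, ← Real.exp_add]
        refine ENNReal.ofReal_le_ofReal (Real.exp_le_exp.2 ?_)
        have : (r : ℝ) ≤ w.len := by exact_mod_cast hrw.le
        nlinarith [mul_le_mul_of_nonneg_left this (sub_pos.2 hts).le]
    refine le_trans ?_ (ENNReal.tsum_le_tsum hterm)
    rw [ENNReal.tsum_mul_left]
    refine mul_le_mul_right (le_trans (measure_mono ?_)
      (measure_biUnion_le m S.to_countable fun w => F j ∩ w.cylSet)) _
    intro x hx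
    obtain ⟨w, hw, hxw⟩ := mem_iUnion₂.1 (hcov hx.1)
    exact mem_iUnion₂.2 ⟨w, hw, hx, hxw⟩
  have hlim : Tendsto (fun r : ℕ => ENNReal.ofReal (Real.exp ((s - t) * r)) * m (F j)) atTop
      (nhds (⊤ * m (F j))) := by
    refine ENNReal.Tendsto.mul_const ?_ (Or.inl ENNReal.top_ne_zero)
    refine ENNReal.tendsto_ofReal_nhds_top.2 (Real.tendsto_exp_atTop.comp ?_)
    exact tendsto_natCast_atTop_atTop.const_mul_atTop (sub_pos.2 hts)
  rw [ENNReal.top_mul hj] at hlim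
  exact top_le_iff.1 (le_of_tendsto hlim (eventually_atTop.2 ⟨j, key⟩))

end

section

variable {N K : ℕ} {M : Fin K → Fin K → Bool} {g : GaSp N K → ℝ} {V G P : ℝ}

theorem IsPotential.htop_le (hg : IsPotential M g V G) {w : ℕ → Fin N} (hne : (SigmaA M).Nonempty)
    (hw : Tendsto (fun n : ℕ => Real.log (Zn M g w n) / n) atTop (nhds P)) (hP : 0 ≤ P)
    {E : Set (ℕ → Fin K)} (hE : ∀ j ∈ E, j ∈ SigmaA M ∧
      ∀ ε > 0, ∀ᶠ n : ℕ in atTop, -ε * n ≤ SnS g n (w, j)) : htop E ≤ P := by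
  refine EReal.le_of_forall_lt_iff_le.1 fun t ht => ?_
  have ht' : P < t := EReal.coe_lt_coe_iff.1 ht
  refine htop_le_of_Hentm_ne_top (hP.trans ht'.le) ?_
  set ε := (t - P) / 3 with hε
  have hε0 : 0 < ε := by rw [hε]; linarith
  have hZ : ∀ᶠ n : ℕ in atTop, Zn M g w n ≤ Real.exp ((P + ε) * n) := by
    filter_upwards [hw.eventually_lt_const (show P < P + ε by linarith),
      eventually_gt_atTop 0] with n hn hn0
    have hn' : (0 : ℝ) < n := Nat.cast_pos.2 hn0
    rw [div_lt_iff₀ hn'] at hn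
    exact (Real.log_le_iff_le_exp (hg.Zn_pos hne w n)).1 hn.le
  obtain ⟨n₀, hn₀⟩ := eventually_atTop.1 hZ
  have hsum : ∑' n : ℕ, ENNReal.ofReal (Real.exp (-ε) ^ n) ≠ ⊤ := by
    rw [← ENNReal.ofReal_tsum_of_nonneg (fun n => by positivity)
      (summable_geometric_of_lt_one (Real.exp_pos _).le (by simpa using hε0))]
    exact ENNReal.ofReal_ne_top
  refine ne_top_of_le_ne_top hsum (iSup_le fun r => ?_)
  refine (Hsr_mono_level E t (le_max_left r n₀)).trans ?_
  refine (Hsr_le_tsum (fun n v => ENNReal.ofReal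
    (wordWeight M g w n v * Real.exp ((ε - t) * n))) fun x hx => ?_).trans ?_
  · obtain ⟨n, hn, hn'⟩ := (((hE x hx).2 ε hε0).and (eventually_gt_atTop (max r n₀))).exists
    refine ⟨n, hn', ENNReal.ofReal_le_ofReal ?_⟩
    have h1 := hg.le_wordWeight w n (hE x hx).1
    refine le_trans ?_ (mul_le_mul_of_nonneg_right h1 (Real.exp_pos _).le)
    rw [← Real.exp_add]
    refine Real.exp_le_exp.2 ?_
    linarith
  · refine ENNReal.tsum_le_tsum fun n => ?_
    split_ifs with h
    · rw [← ENNReal.ofReal_sum_of_nonneg fun v _ =>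
        mul_nonneg (wordWeight_nonneg _ _ _ _ _) (Real.exp_pos _).le, ← Finset.sum_mul, ← Zn_eq_sum]
      refine ENNReal.ofReal_le_ofReal ?_
      refine (mul_le_mul_of_nonneg_right (hn₀ n (le_trans (le_max_right _ _) h.le))
        (Real.exp_pos _).le).trans_eq ?_
      rw [← Real.exp_add, ← Real.exp_nat_mul]
      congr 1
      rw [show t = P + 3 * ε by rw [hε]; ring]
      ring
    · exact zero_le

end

/-! ### The lower bound -/

section

variable {N K d : ℕ} {M : Fin K → Fin K → Bool} {g : GaSp N K → ℝ} {V G c C : ℝ}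
  {ν : Measure (ℕ → Fin N)} {μ : Measure (GaSp N K)}

theorem SnS_eq_birkhoffSum (g : GaSp N K → ℝ) (n : ℕ) (p : GaSp N K) :
    SnS g n p = birkhoffSum shift2 g n p := rfl

theorem IsPotential.le_htop [NeZero K] (hg : IsPotential M g V G) (hne : (SigmaA M).Nonempty)
    {w : ℕ → Fin N} {P a : ℝ}
    (hw : Tendsto (fun n : ℕ => Real.log (Zn M g w n) / n) atTop (nhds P))
    {m : Measure (ℕ → Fin K)} [IsFiniteMeasure m] (hC : 0 < C) {E : Set (ℕ → Fin K)}
    (hE : m E ≠ 0) (h : ∀ j ∈ E,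
      (∀ n, m.real (initWord n ⁻¹' {initWord n j}) ≤ C * gibbsDens M g n w j) ∧
      Tendsto (fun n : ℕ => SnS g n (w, j) / n) atTop (nhds a)) :
    ((P - a : ℝ) : EReal) ≤ htop E := by
  refine EReal.ge_of_forall_gt_iff_ge.1 fun s hs => ?_
  have hs' : s < P - a := EReal.coe_lt_coe_iff.1 hs
  refine le_htop_of_measure hE fun j hj => ?_
  obtain ⟨h1, h2⟩ := h j hj
  have hlim : Tendsto (fun n : ℕ => Real.log C / n + SnS g n (w, j) / n -
      Real.log (Zn M g w n) / n) atTop (nhds (0 + a - P)) :=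
    ((tendsto_const_div_atTop_nhds_zero_nat _).add h2).sub hw
  filter_upwards [hlim.eventually_lt_const (show 0 + a - P < -s by linarith),
    eventually_gt_atTop 0] with n hn hn0
  have hn' : (0 : ℝ) < n := Nat.cast_pos.2 hn0
  refine (h1 n).trans ?_
  have hZ := hg.Zn_pos hne w n
  rw [← add_div, ← sub_div, div_lt_iff₀ hn'] at hn
  calc C * gibbsDens M g n w j
      = Real.exp (Real.log C + SnS g n (w, j) - Real.log (Zn M g w n)) := by
        rw [Real.exp_sub, Real.exp_add, Real.exp_log hC, Real.exp_log hZ, gibbsDens, mul_div_assoc]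
    _ ≤ Real.exp (-s * n) := Real.exp_le_exp.2 hn.le

theorem IsGibbs.ae_condKernel_le [NeZero K] [IsProbabilityMeasure ν] (hμ : IsGibbs M g ν μ c C)
    (hg : IsPotential M g V G) (hne : (SigmaA M).Nonempty) [IsFiniteMeasure μ] :
    ∀ᵐ w ∂ν, ∀ (n : ℕ), ∀ j ∈ SigmaA M, (μ.condKernel w).real (initWord n ⁻¹' {initWord n j}) ≤
      C * Real.exp V * gibbsDens M g n w j := by
  have hC := hμ.const_pos hg hne
  have hfst : μ.fst = ν := hμ.mem.2.2.1
  have key : ∀ (n : ℕ) (v : Fin n → Fin K), ∀ᵐ w ∂ν, IsAdm M v →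
      μ.condKernel w (initWord n ⁻¹' {v}) ≤
        ENNReal.ofReal (C * gibbsDens M g n w (wordPt M v)) := by
    intro n v
    by_cases hv : IsAdm M v
    swap
    · exact ae_of_all _ fun w h => absurd h hv
    have hms : MeasurableSet (initWord n ⁻¹' {v} : Set (ℕ → Fin K)) :=
      (isClopen_initWord_preimage n _).1.measurableSet
    have hcont := hg.continuous_gibbsDens hne n (wordPt M v)
    refine (ae_le_of_forall_setLIntegral_le_of_sigmaFinite
      (ProbabilityTheory.Kernel.measurable_coe _ hms) fun B hB _ => ?_).mono fun w hw _ => hw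
    conv_lhs => rw [← hfst]
    rw [Measure.setLIntegral_condKernel_eq_measure_prod hB hms,
      ← ofReal_integral_eq_lintegral_ofReal (integrable_of_continuous (hcont.const_mul C))
        (ae_of_all _ fun w => mul_nonneg hC.le (hg.gibbsDens_pos hne n w _).le),
      integral_const_mul]
    refine (ENNReal.le_ofReal_iff_toReal_le (measure_ne_top _ _) (mul_nonneg hC.le
      (integral_nonneg fun w => (hg.gibbsDens_pos hne n w _).le))).2 ?_
    have := hμ.real_le n (wordPt M v) hv.wordPt_mem B hB
    rwa [cylAt_zero_eq, hv.initWord_wordPt] at this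
  filter_upwards [ae_all_iff.2 fun n => ae_all_iff.2 fun v => key n v] with w hw n j hj
  have h1 := hw n (initWord n j) (isAdm_initWord hj n)
  refine (ENNReal.toReal_le_of_le_ofReal (mul_nonneg hC.le
    (hg.gibbsDens_pos hne n w _).le) h1).trans ?_
  rw [mul_assoc]
  refine mul_le_mul_of_nonneg_left ?_ hC.le
  rw [gibbsDens, gibbsDens, ← mul_div_assoc, ← Real.exp_add]
  refine div_le_div_of_nonneg_right (Real.exp_le_exp.2 ?_) (hg.Zn_pos hne w n).le
  have := hg.var n (w, wordPt M (initWord n j)) (w, j) (wordPt_initWord_mem hj n) hj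
    (fun _ _ => rfl) fun k hk => wordPt_initWord_apply hj hk
  linarith [(abs_le.1 this).2]

theorem ae_tendsto_average_vec [IsProbabilityMeasure μ] (hμ : Ergodic shift2 μ)
    {f : GaSp N K → Fin d → ℝ} (hf : Continuous f) :
    ∀ᵐ p ∂μ, Tendsto (fun n : ℕ => (n : ℝ)⁻¹ • ∑ k ∈ Finset.range n, f (shift2^[k] p)) atTop
      (nhds (∫ p, f p ∂μ)) := by
  have hft : ∀ t, Continuous fun p => f p t := fun t => (continuous_apply t).comp hf
  have key : ∀ t, ∀ᵐ p ∂μ, Tendsto (fun n : ℕ => birkhoffSum shift2 (fun p => f p t) n p / n)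
      atTop (nhds (∫ p, f p t ∂μ)) := fun t =>
    hμ.ae_tendsto_birkhoffSum_div (hft t).measurable (integrable_of_continuous (hft t))
  filter_upwards [ae_all_iff.2 key] with p hp
  refine tendsto_pi_nhds.2 fun t => ?_
  have hint : (∫ p, f p ∂μ) t = ∫ p, f p t ∂μ :=
    (eval_integral (E := fun _ => ℝ) fun t => integrable_of_continuous (hft t)) t
  rw [hint]
  refine (hp t).congr fun n => ?_
  simp only [birkhoffSum, Pi.smul_apply, Finset.sum_apply, smul_eq_mul]
  rw [div_eq_inv_mul]

theorem IsGibbs.ae_le_htop_EwVec [NeZero K] [IsProbabilityMeasure ν] (hμ : IsGibbs M g ν μ c C)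
    (hg : IsPotential M g V G) {r : ℕ} (hr : HasGap M r) (hne : (SigmaA M).Nonempty)
    (hν : Ergodic shift ν) (hqb : QuasiBernoulli ν) {f : GaSp N K → Fin d → ℝ}
    (hf : Continuous f) :
    ∀ᵐ w ∂ν, ((condPressure M ν g - ∫ p, g p ∂μ : ℝ) : EReal) ≤
      htop (EwVec M f w (∫ p, f p ∂μ)) := by
  have := hμ.mem.1
  have herg := hμ.ergodic hg hr hne hqb
  have hfst : μ.fst = ν := hμ.mem.2.2.1
  have hae : ∀ᵐ p ∂μ, p.2 ∈ SigmaA M ∧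
      Tendsto (fun n : ℕ => (n : ℝ)⁻¹ • ∑ k ∈ Finset.range n, f (shift2^[k] p)) atTop
        (nhds (∫ p, f p ∂μ)) ∧
      Tendsto (fun n : ℕ => SnS g n p / n) atTop (nhds (∫ p, g p ∂μ)) :=
    hμ.mem.ae_mem.and ((ae_tendsto_average_vec herg hf).and
      (herg.ae_tendsto_birkhoffSum_div hg.cont.measurable (integrable_of_continuous hg.cont)))
  generalize ∫ p, f p ∂μ = I at hae ⊢
  generalize ∫ p, g p ∂μ = J at hae ⊢
  have hae' := Measure.ae_ae_of_ae_compProd ((μ.disintegrate μ.condKernel).symm ▸ hae)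
  rw [hfst] at hae'
  filter_upwards [hae', hμ.ae_condKernel_le hg hne, hg.ae_tendsto_log_Zn_div hr hne hν]
    with w h1 h2 h3
  set E : Set (ℕ → Fin K) := {j | j ∈ SigmaA M ∧
      Tendsto (fun n : ℕ => (n : ℝ)⁻¹ • ∑ k ∈ Finset.range n, f (shift2^[k] (w, j))) atTop
        (nhds I) ∧
      Tendsto (fun n : ℕ => SnS g n (w, j) / n) atTop (nhds J)}
  have hE : μ.condKernel w E ≠ 0 := by
    have : μ.condKernel w E = μ.condKernel w univ := measure_congr (eventuallyEq_univ.2 h1)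
    rw [this, measure_univ]
    exact one_ne_zero
  refine (hg.le_htop hne h3 (mul_pos (hμ.const_pos hg hne) (Real.exp_pos V)) hE
    fun j hj => ⟨fun n => h2 n j hj.1, hj.2.2⟩).trans (htop_mono fun j hj => ⟨hj.1, hj.2.1⟩)

end

/-! ### The derivative of the pressure -/

section

variable {N K : ℕ} {M : Fin K → Fin K → Bool} {g h : GaSp N K → ℝ} {V G V' G' c C : ℝ}
  {ν : Measure (ℕ → Fin N)} {μ : Measure (GaSp N K)}

theorem SnS_add_fun (g h : GaSp N K → ℝ) (n : ℕ) (p : GaSp N K) :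
    SnS (fun p => g p + h p) n p = SnS g n p + SnS h n p := Finset.sum_add_distrib

theorem SnS_const_mul (t : ℝ) (h : GaSp N K → ℝ) (n : ℕ) (p : GaSp N K) :
    SnS (fun p => t * h p) n p = t * SnS h n p := (Finset.mul_sum _ _ _).symm

theorem IsPotential.add (hg : IsPotential M g V G) (hh : IsPotential M h V' G') :
    IsPotential M (fun p => g p + h p) (V + V') (G + G') where
  cont := hg.cont.add hh.cont
  bound p := (abs_add_le _ _).trans (add_le_add (hg.bound p) (hh.bound p))
  var n p q hp hq h1 h2 := by
    rw [SnS_add_fun, SnS_add_fun, add_sub_add_comm]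
    exact (abs_add_le _ _).trans (add_le_add (hg.var n p q hp hq h1 h2) (hh.var n p q hp hq h1 h2))

theorem IsPotential.const_mul (hh : IsPotential M h V' G') (t : ℝ) :
    IsPotential M (fun p => t * h p) (|t| * V') (|t| * G') where
  cont := hh.cont.const_mul t
  bound p := (abs_mul _ _).trans_le (mul_le_mul_of_nonneg_left (hh.bound p) (abs_nonneg t))
  var n p q hp hq h1 h2 := by
    rw [SnS_const_mul, SnS_const_mul, ← mul_sub, abs_mul]
    exact mul_le_mul_of_nonneg_left (hh.var n p q hp hq h1 h2) (abs_nonneg t)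

theorem IsPotential.mono {V₁ G₁ : ℝ} (hg : IsPotential M g V G) (hV : V ≤ V₁) (hG : G ≤ G₁) :
    IsPotential M g V₁ G₁ where
  cont := hg.cont
  bound p := (hg.bound p).trans hG
  var n p q hp hq h1 h2 := (hg.var n p q hp hq h1 h2).trans hV

theorem measurableSet_snd_cylAt (n : ℕ) (j : ℕ → Fin K) :
    MeasurableSet {p : GaSp N K | p.2 ∈ cylAt 0 n j} :=
  measurable_snd (isClopen_cylAt 0 n j).1.measurableSet

theorem IsGibbs.lintegral_gibbsDens_mul_le [IsProbabilityMeasure ν] (hμ : IsGibbs M g ν μ c C)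
    (hg : IsPotential M g V G) (hne : (SigmaA M).Nonempty) (n : ℕ) {j : ℕ → Fin K}
    (hj : j ∈ SigmaA M) {φ : (ℕ → Fin N) → ℝ≥0∞} (hφ : Measurable φ) :
    ∫⁻ w, ENNReal.ofReal (c * gibbsDens M g n w j) * φ w ∂ν ≤
      ∫⁻ p in {p | p.2 ∈ cylAt 0 n j}, φ p.1 ∂μ := by
  have := hμ.mem.1
  have hcont : Continuous fun w => c * gibbsDens M g n w j :=
    (hg.continuous_gibbsDens hne n j).const_mul c
  have h0 : ∀ w, 0 ≤ c * gibbsDens M g n w j :=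
    fun w => mul_nonneg hμ.pos.le (hg.gibbsDens_pos hne n w j).le
  have hle : ν.withDensity (fun w => ENNReal.ofReal (c * gibbsDens M g n w j)) ≤
      (μ.restrict {p | p.2 ∈ cylAt 0 n j}).map Prod.fst := by
    refine Measure.le_iff.2 fun B hB => ?_
    rw [Measure.map_apply measurable_fst hB, Measure.restrict_apply (measurable_fst hB),
      withDensity_apply _ hB, ← ofReal_integral_eq_lintegral_ofReal
        (integrable_of_continuous hcont) (ae_of_all _ h0), integral_const_mul]
    refine (ENNReal.ofReal_le_ofReal (hμ.le_real n j hj B hB)).trans_eq ?_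
    rw [ofReal_measureReal]
    rfl
  calc ∫⁻ w, ENNReal.ofReal (c * gibbsDens M g n w j) * φ w ∂ν
      = ∫⁻ w, φ w ∂ν.withDensity (fun w => ENNReal.ofReal (c * gibbsDens M g n w j)) :=
        (lintegral_withDensity_eq_lintegral_mul _ hcont.measurable.ennreal_ofReal hφ).symm
    _ ≤ ∫⁻ w, φ w ∂(μ.restrict {p | p.2 ∈ cylAt 0 n j}).map Prod.fst := lintegral_mono' hle le_rfl
    _ = _ := lintegral_map hφ measurable_fst

variable [NeZero K]

theorem IsGibbs.lintegral_Zn_div_le [IsProbabilityMeasure ν] (hμ : IsGibbs M g ν μ c C)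
    (hg : IsPotential M g V G) (hh : IsPotential M h V' G') (hne : (SigmaA M).Nonempty) (n : ℕ) :
    ∫⁻ w, ENNReal.ofReal (Zn M (fun p => g p + h p) w n / Zn M g w n) ∂ν ≤
      ENNReal.ofReal (c⁻¹ * Real.exp (V + 2 * V')) *
        ∫⁻ p, ENNReal.ofReal (Real.exp (SnS h n p)) ∂μ := by
  classical
  have := hμ.mem.1
  have hgh := hg.add hh
  set A : Finset (Fin n → Fin K) := admWords M n univ with hA
  have hmemA : ∀ v, v ∈ A ↔ IsAdm M v := fun v => by simp [hA, mem_admWords]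
  have hpt : ∀ w, Zn M (fun p => g p + h p) w n / Zn M g w n ≤
      ∑ v ∈ A, Real.exp (V + V') * (gibbsDens M g n w (wordPt M v) *
        Real.exp (SnS h n (w, wordPt M v))) := by
    intro w
    rw [Zn_eq_sum, Finset.sum_div, ← Finset.sum_subset (Finset.subset_univ A) fun v _ hv => by
      rw [wordWeight_eq_zero _ _ (mt (hmemA v).2 hv), zero_div]]
    refine Finset.sum_le_sum fun v hv => ?_
    have hv' := (hmemA v).1 hv
    have := hgh.wordWeight_le (n := n) (w := w) (w' := w) (fun _ _ => rfl) hv'.wordPt_mem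
    rw [hv'.initWord_wordPt, SnS_add_fun, Real.exp_add (SnS g _ _)] at this
    rw [gibbsDens, div_mul_eq_mul_div, ← mul_div_assoc]
    exact div_le_div_of_nonneg_right this (hg.Zn_pos hne w n).le
  have hSmeas : ∀ j, Measurable fun w : ℕ → Fin N => ENNReal.ofReal (Real.exp (SnS h n (w, j))) :=
    fun j => (Real.continuous_exp.comp ((continuous_SnS hh.cont n).comp
      (continuous_id.prodMk continuous_const))).measurable.ennreal_ofReal
  have hword : ∀ v ∈ A, ∫⁻ w, ENNReal.ofReal (gibbsDens M g n w (wordPt M v) *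
        Real.exp (SnS h n (w, wordPt M v))) ∂ν ≤ ENNReal.ofReal (c⁻¹ * Real.exp V') *
        ∫⁻ p in {p | p.2 ∈ cylAt 0 n (wordPt M v)}, ENNReal.ofReal (Real.exp (SnS h n p)) ∂μ := by
    intro v hv
    have hv' := (hmemA v).1 hv
    have h1 := hμ.lintegral_gibbsDens_mul_le hg hne n hv'.wordPt_mem (hSmeas (wordPt M v))
    have h2 : ∫⁻ p in {p | p.2 ∈ cylAt 0 n (wordPt M v)},
        ENNReal.ofReal (Real.exp (SnS h n (p.1, wordPt M v))) ∂μ ≤ ENNReal.ofReal (Real.exp V') *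
        ∫⁻ p in {p | p.2 ∈ cylAt 0 n (wordPt M v)}, ENNReal.ofReal (Real.exp (SnS h n p)) ∂μ := by
      rw [← lintegral_const_mul' _ _ ENNReal.ofReal_ne_top]
      refine lintegral_mono_ae ?_
      filter_upwards [ae_restrict_mem (measurableSet_snd_cylAt n (wordPt M v)),
        ae_restrict_of_ae hμ.mem.ae_mem] with p hp hpA
      rw [← ENNReal.ofReal_mul (Real.exp_pos _).le, ← Real.exp_add]
      refine ENNReal.ofReal_le_ofReal (Real.exp_le_exp.2 ?_)
      have := hh.var n (p.1, wordPt M v) p hv'.wordPt_mem hpA (fun _ _ => rfl)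
        fun k hk => by simpa using (hp k hk).symm
      linarith [(abs_le.1 this).2]
    calc ∫⁻ w, ENNReal.ofReal (gibbsDens M g n w (wordPt M v) *
          Real.exp (SnS h n (w, wordPt M v))) ∂ν
        = ∫⁻ w, ENNReal.ofReal c⁻¹ * (ENNReal.ofReal (c * gibbsDens M g n w (wordPt M v)) *
          ENNReal.ofReal (Real.exp (SnS h n (w, wordPt M v)))) ∂ν := by
          refine lintegral_congr fun w => ?_
          rw [← ENNReal.ofReal_mul (mul_nonneg hμ.pos.le (hg.gibbsDens_pos hne n w _).le),
            ← ENNReal.ofReal_mul (inv_nonneg.2 hμ.pos.le), mul_assoc c,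
            inv_mul_cancel_left₀ hμ.pos.ne']
      _ ≤ ENNReal.ofReal c⁻¹ * (ENNReal.ofReal (Real.exp V') *
        ∫⁻ p in {p | p.2 ∈ cylAt 0 n (wordPt M v)},
          ENNReal.ofReal (Real.exp (SnS h n p)) ∂μ) := by
          rw [lintegral_const_mul' _ _ ENNReal.ofReal_ne_top]
          exact mul_le_mul_right (h1.trans h2) _
      _ = _ := by rw [← mul_assoc, ENNReal.ofReal_mul (inv_nonneg.2 hμ.pos.le)]
  have hdisj : ((A : Set (Fin n → Fin K)).PairwiseDisjoint
      fun v => {p : GaSp N K | p.2 ∈ cylAt 0 n (wordPt M v)}) := by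
    intro v hv v' hv' hne'
    refine disjoint_left.2 fun p hp hp' => hne' ?_
    rw [← ((hmemA v).1 hv).initWord_wordPt, ← ((hmemA v').1 hv').initWord_wordPt]
    ext i
    exact congrArg _ ((hp i i.2).symm.trans (hp' i i.2))
  calc ∫⁻ w, ENNReal.ofReal (Zn M (fun p => g p + h p) w n / Zn M g w n) ∂ν
      ≤ ∫⁻ w, ENNReal.ofReal (Real.exp (V + V')) * ∑ v ∈ A, ENNReal.ofReal
          (gibbsDens M g n w (wordPt M v) * Real.exp (SnS h n (w, wordPt M v))) ∂ν := by
        refine lintegral_mono fun w => ?_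
        have h0 : ∀ v ∈ A, 0 ≤ gibbsDens M g n w (wordPt M v) *
            Real.exp (SnS h n (w, wordPt M v)) := fun v _ =>
          mul_nonneg (hg.gibbsDens_pos hne n w _).le (Real.exp_pos _).le
        rw [← ENNReal.ofReal_sum_of_nonneg h0, ← ENNReal.ofReal_mul (Real.exp_pos _).le,
          Finset.mul_sum]
        exact ENNReal.ofReal_le_ofReal (hpt w)
    _ = ENNReal.ofReal (Real.exp (V + V')) * ∑ v ∈ A, ∫⁻ w, ENNReal.ofReal
          (gibbsDens M g n w (wordPt M v) * Real.exp (SnS h n (w, wordPt M v))) ∂ν := by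
        rw [lintegral_const_mul' _ _ ENNReal.ofReal_ne_top, lintegral_finsetSum]
        exact fun v _ => ((hg.continuous_gibbsDens hne n _).mul
          (Real.continuous_exp.comp ((continuous_SnS hh.cont n).comp
            (continuous_id.prodMk continuous_const)))).measurable.ennreal_ofReal
    _ ≤ ENNReal.ofReal (Real.exp (V + V')) * ∑ v ∈ A, ENNReal.ofReal (c⁻¹ * Real.exp V') *
        ∫⁻ p in {p | p.2 ∈ cylAt 0 n (wordPt M v)}, ENNReal.ofReal (Real.exp (SnS h n p)) ∂μ :=
        mul_le_mul_right (Finset.sum_le_sum hword) _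
    _ = ENNReal.ofReal (c⁻¹ * Real.exp (V + 2 * V')) *
        ∫⁻ p in ⋃ v ∈ A, {p | p.2 ∈ cylAt 0 n (wordPt M v)},
          ENNReal.ofReal (Real.exp (SnS h n p)) ∂μ := by
        rw [lintegral_biUnion_finset hdisj fun v _ => measurableSet_snd_cylAt n (wordPt M v),
          ← Finset.mul_sum, ← mul_assoc, ← ENNReal.ofReal_mul (Real.exp_pos _).le]
        congr 2
        rw [mul_left_comm, ← Real.exp_add]
        ring_nf
    _ ≤ _ := mul_le_mul_right (setLIntegral_le_lintegral _ _) _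

theorem IsGibbs.integral_log_Zn_le [IsProbabilityMeasure ν] (hμ : IsGibbs M g ν μ c C)
    (hg : IsPotential M g V G) (hh : IsPotential M h V' G') (hne : (SigmaA M).Nonempty) (n : ℕ) :
    ∫ w, Real.log (Zn M (fun p => g p + h p) w n) ∂ν ≤ ∫ w, Real.log (Zn M g w n) ∂ν +
      (V + 2 * V' - Real.log c) + Real.log (∫ p, Real.exp (SnS h n p) ∂μ) := by
  have := hμ.mem.1
  have hgh := hg.add hh
  have hpos : ∀ w, 0 < Zn M (fun p => g p + h p) w n / Zn M g w n := fun w =>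
    div_pos (hgh.Zn_pos hne w n) (hg.Zn_pos hne w n)
  have hcont : Continuous fun w => Zn M (fun p => g p + h p) w n / Zn M g w n :=
    (hgh.continuous_Zn n).div (hg.continuous_Zn n) fun w => (hg.Zn_pos hne w n).ne'
  have hcexp : Continuous fun p => Real.exp (SnS h n p) :=
    Real.continuous_exp.comp (continuous_SnS hh.cont n)
  set b := ∫ w, Zn M (fun p => g p + h p) w n / Zn M g w n ∂ν with hb
  have hi := integrable_of_continuous (μ := ν) hcont
  have hb0 : 0 < b := by
    rw [hb, integral_pos_iff_support_of_nonneg (fun w => (hpos w).le) hi,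
      Function.support_eq_univ fun w => (hpos w).ne']
    simp
  have hexp0 : 0 < ∫ p, Real.exp (SnS h n p) ∂μ := integral_exp_pos (integrable_of_continuous hcexp)
  have hble : b ≤ c⁻¹ * Real.exp (V + 2 * V') * ∫ p, Real.exp (SnS h n p) ∂μ := by
    have hk : 0 ≤ c⁻¹ * Real.exp (V + 2 * V') :=
      mul_nonneg (inv_nonneg.2 hμ.pos.le) (Real.exp_pos _).le
    have := hμ.lintegral_Zn_div_le hg hh hne n
    rw [← ofReal_integral_eq_lintegral_ofReal hi (ae_of_all _ fun w => (hpos w).le),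
      ← ofReal_integral_eq_lintegral_ofReal (integrable_of_continuous hcexp)
        (ae_of_all _ fun w => (Real.exp_pos _).le), ← ENNReal.ofReal_mul hk] at this
    exact (ENNReal.ofReal_le_ofReal_iff (mul_nonneg hk hexp0.le)).1 this
  have hlogb : Real.log b ≤ V + 2 * V' - Real.log c + Real.log (∫ p, Real.exp (SnS h n p) ∂μ) := by
    refine (Real.log_le_log hb0 hble).trans_eq ?_
    rw [Real.log_mul (mul_ne_zero (inv_ne_zero hμ.pos.ne') (Real.exp_ne_zero _)) hexp0.ne',
      Real.log_mul (inv_ne_zero hμ.pos.ne') (Real.exp_ne_zero _), Real.log_inv, Real.log_exp]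
    ring
  have hi' : Integrable (fun w => Real.log b - 1 +
      Zn M (fun p => g p + h p) w n / Zn M g w n / b) ν := (integrable_const _).add (hi.div_const b)
  have hjensen : ∫ w, Real.log (Zn M (fun p => g p + h p) w n) ∂ν ≤
      ∫ w, (Real.log (Zn M g w n) + (Real.log b - 1 +
        Zn M (fun p => g p + h p) w n / Zn M g w n / b)) ∂ν := by
    refine integral_mono (hgh.integrable_log_Zn hne n)
      ((hg.integrable_log_Zn hne n).add hi') fun w => ?_
    have h1 := Real.log_le_sub_one_of_pos (div_pos (hpos w) hb0)
    rw [Real.log_div (hpos w).ne' hb0.ne', Real.log_div (hgh.Zn_pos hne w n).ne'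
      (hg.Zn_pos hne w n).ne'] at h1
    change Real.log _ ≤ Real.log _ + _
    linarith
  rw [integral_add (hg.integrable_log_Zn hne n) hi',
    integral_add (integrable_const _) (hi.div_const b), integral_div, ← hb, div_self hb0.ne',
    integral_const, probReal_univ, one_smul] at hjensen
  linarith

theorem IsGibbs.integral_nonneg_of_condPressure_le [IsProbabilityMeasure ν]
    (hμ : IsGibbs M g ν μ c C) (hg : IsPotential M g V G) (hh : IsPotential M h V' G') {r : ℕ}
    (hr : HasGap M r) (hne : (SigmaA M).Nonempty) (hν : MeasurePreserving shift ν ν)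
    (hqb : QuasiBernoulli ν)
    (hmin : ∀ t, condPressure M ν g ≤ condPressure M ν fun p => g p + t * h p) :
    0 ≤ ∫ p, h p ∂μ := by
  have := hμ.mem.1
  obtain ⟨w₀⟩ := nonempty_of_isProbabilityMeasure ν
  by_contra! hneg
  obtain ⟨D, hD⟩ : ∃ D : ℝ, ∀ (n : ℕ) (t : ℝ), |t| ≤ 1 →
      0 ≤ D + Real.log (∫ p, Real.exp (t * SnS h n p) ∂μ) := by
    refine ⟨Real.log (gapConst K r (V + V') (G + G')) + Real.log (gapConst K r V G) +
      (V + 2 * V' - Real.log c), fun n t ht => ?_⟩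
    have hth : IsPotential M (fun p => t * h p) V' G' := (hh.const_mul t).mono
      (mul_le_of_le_one_left (hh.V_nonneg hne w₀) ht) (mul_le_of_le_one_left (hh.G_nonneg w₀) ht)
    have h1 := (abs_le.1 (hg.abs_integral_log_Zn_sub_le hr hne hν n)).2
    have h2 := (abs_le.1 ((hg.add hth).abs_integral_log_Zn_sub_le hr hne hν n)).1
    have h3 := hμ.integral_log_Zn_le hg hth hne n
    simp only [SnS_const_mul] at h3
    have h4 := mul_le_mul_of_nonneg_left (hmin t) n.cast_nonneg
    linarith
  set a := ∫ p, h p ∂μ with ha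
  set A := (|D| + 1) / -a with hAdef
  have hA : 0 < A := div_pos (by positivity) (neg_pos.2 hneg)
  have hlim : Tendsto (fun n : ℕ => ∫ p, Real.exp (A / n * SnS h n p) ∂μ) atTop
      (nhds (∫ _p, Real.exp (A * a) ∂μ)) := by
    refine tendsto_integral_of_dominated_convergence (fun _ => Real.exp (A * G'))
      (fun n => (Real.continuous_exp.comp
        ((continuous_SnS hh.cont n).const_mul _)).aestronglyMeasurable)
      (integrable_const _) (fun n => ae_of_all _ fun p => ?_) ?_
    · rw [Real.norm_eq_abs, Real.abs_exp]
      refine Real.exp_le_exp.2 ?_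
      rcases n.eq_zero_or_pos with rfl | hn
      · simpa using mul_nonneg hA.le (hh.G_nonneg w₀)
      · have hn' : (0 : ℝ) < n := Nat.cast_pos.2 hn
        refine (mul_le_mul_of_nonneg_left ((le_abs_self _).trans (abs_SnS_le hh.bound n p))
          (div_pos hA hn').le).trans_eq ?_
        field_simp
    · filter_upwards [(hμ.ergodic hg hr hne hqb).ae_tendsto_birkhoffSum_div hh.cont.measurable
        (integrable_of_continuous hh.cont)] with p hp
      refine (Real.continuous_exp.tendsto _).comp ((hp.const_mul A).congr fun n => ?_)
      rw [SnS_eq_birkhoffSum]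
      ring
  rw [integral_const, probReal_univ, one_smul] at hlim
  have hlog := (hlim.log (Real.exp_ne_zero _)).const_add D
  rw [Real.log_exp] at hlog
  have hfin : 0 ≤ D + A * a := by
    refine ge_of_tendsto hlog ?_
    filter_upwards [eventually_ge_atTop ⌈A⌉₊, eventually_gt_atTop 0] with n hn hn0
    have hn' : (0 : ℝ) < n := Nat.cast_pos.2 hn0
    refine hD n (A / n) ?_
    rw [abs_of_pos (div_pos hA hn'), div_le_one hn']
    exact Nat.ceil_le.1 hn
  have : A * a = -(|D| + 1) := by
    rw [hAdef, div_neg, neg_mul, div_mul_cancel₀ _ hneg.ne]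
  linarith [le_abs_self D]

end

/-! ### Coercivity at relative interior points -/

section

variable {d : ℕ} {S : Set (Fin d → ℝ)} {α : Fin d → ℝ}

theorem exists_sub_smul_mem_of_mem_intrinsicInterior (hα : α ∈ intrinsicInterior ℝ S)
    {x : Fin d → ℝ} (hx : x ∈ S) : ∃ t > (0 : ℝ), α - t • (x - α) ∈ S := by
  obtain ⟨y, hy, rfl⟩ := mem_intrinsicInterior.1 hα
  have hmem : ∀ t : ℝ, AffineMap.lineMap (y : Fin d → ℝ) x (-t) ∈ affineSpan ℝ S := fun t =>
    AffineMap.lineMap_mem _ y.2 (subset_affineSpan ℝ S hx)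
  have hcont : Continuous fun t : ℝ =>
      (⟨AffineMap.lineMap (y : Fin d → ℝ) x (-t), hmem t⟩ : affineSpan ℝ S) :=
    (AffineMap.lineMap_continuous.comp continuous_neg).subtype_mk _
  have h0 : (⟨AffineMap.lineMap (y : Fin d → ℝ) x (-0 : ℝ), hmem 0⟩ : affineSpan ℝ S) = y := by
    ext1
    simp
  have hy' : Subtype.val ⁻¹' S ∈
      nhds (⟨AffineMap.lineMap (y : Fin d → ℝ) x (-0 : ℝ), hmem 0⟩ : affineSpan ℝ S) := by
    rw [h0]
    exact mem_interior_iff_mem_nhds.1 hy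
  have hev : ∀ᶠ t : ℝ in nhds 0, AffineMap.lineMap (y : Fin d → ℝ) x (-t) ∈ S :=
    hcont.continuousAt.preimage_mem_nhds hy'
  obtain ⟨t, ht, ht0⟩ := ((hev.filter_mono nhdsWithin_le_nhds).and
    (self_mem_nhdsWithin (s := Ioi (0 : ℝ)))).exists
  refine ⟨t, ht0, ?_⟩
  rwa [AffineMap.lineMap_apply, vsub_eq_sub, vadd_eq_add, neg_smul, neg_add_eq_sub] at ht

theorem exists_forall_le_of_mem_intrinsicInterior (hα : α ∈ intrinsicInterior ℝ S)
    {P : (Fin d → ℝ) → ℝ} (hP : Continuous P) (hle : ∀ p, ∀ x ∈ S, p ⬝ᵥ (x - α) ≤ P p)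
    (hinv : ∀ p q, (∀ x ∈ S, q ⬝ᵥ (x - α) = 0) → P (p + q) = P p) : ∃ p₀, ∀ p, P p₀ ≤ P p := by
  set D : Submodule ℝ (Fin d → ℝ) :=
    { carrier := {q | ∀ x ∈ S, q ⬝ᵥ (x - α) = 0}
      add_mem' := fun ha hb x hx => by rw [add_dotProduct, ha x hx, hb x hx, add_zero]
      zero_mem' := fun x _ => zero_dotProduct _
      smul_mem' := fun c a ha x hx => by rw [smul_dotProduct, ha x hx, smul_zero] } with hD
  obtain ⟨L, hL⟩ := D.exists_isCompl
  have hpos : ∀ q : L, q ≠ 0 → ∃ x ∈ S, 0 < (q : Fin d → ℝ) ⬝ᵥ (x - α) := by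
    intro q hq
    by_contra! h
    refine hq (Subtype.ext (Submodule.disjoint_def.1 hL.disjoint q (fun x hx => ?_) q.2))
    refine le_antisymm (h x hx) ?_
    obtain ⟨t, ht, hmem⟩ := exists_sub_smul_mem_of_mem_intrinsicInterior hα hx
    have := h _ hmem
    rw [sub_sub_cancel_left, dotProduct_neg, dotProduct_smul, smul_eq_mul, neg_nonpos] at this
    exact nonneg_of_mul_nonneg_right this ht
  have hcover : ∃ n : ℕ, Metric.sphere (0 : L) 1 ⊆
      {q | ∃ x ∈ S, 1 / ((n : ℝ) + 1) < (q : Fin d → ℝ) ⬝ᵥ (x - α)} := by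
    refine (isCompact_sphere (0 : L) 1).elim_directed_cover _ (fun n => ?_) (fun q hq => ?_) ?_
    · have : {q : L | ∃ x ∈ S, 1 / ((n : ℝ) + 1) < (q : Fin d → ℝ) ⬝ᵥ (x - α)} =
          ⋃ x ∈ S, {q : L | 1 / ((n : ℝ) + 1) < (q : Fin d → ℝ) ⬝ᵥ (x - α)} := by
        ext q
        simp
      rw [this]
      exact isOpen_biUnion fun x _ => isOpen_lt continuous_const
        (continuous_subtype_val.dotProduct continuous_const)
    · have hq0 : q ≠ 0 := by
        rintro rfl
        simp at hq
      obtain ⟨x, hx, hqx⟩ := hpos q hq0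
      obtain ⟨n, hn⟩ := exists_nat_one_div_lt hqx
      exact mem_iUnion.2 ⟨n, x, hx, hn⟩
    · refine Monotone.directed_le fun m n hmn q ⟨x, hx, hq⟩ => ⟨x, hx, lt_of_le_of_lt ?_ hq⟩
      exact one_div_le_one_div_of_le (by positivity) (by gcongr)
  obtain ⟨n, hn⟩ := hcover
  have hcoer : ∀ q : L, 1 / ((n : ℝ) + 1) * ‖q‖ ≤ P q := by
    intro q
    rcases eq_or_ne q 0 with rfl | hq
    · have := hle 0 α (intrinsicInterior_subset hα)
      simpa using this
    · have hq' : 0 < ‖q‖ := norm_pos_iff.2 hq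
      obtain ⟨x, hx, hlt⟩ := hn (show ‖q‖⁻¹ • q ∈ Metric.sphere (0 : L) 1 by
        rw [mem_sphere_zero_iff_norm, norm_smul, norm_inv, norm_norm, inv_mul_cancel₀ hq'.ne'])
      rw [Submodule.coe_smul, smul_dotProduct, smul_eq_mul, inv_mul_eq_div, lt_div_iff₀ hq'] at hlt
      exact hlt.le.trans (hle q x hx)
  obtain ⟨p₀, hp₀⟩ := (hP.comp continuous_subtype_val).exists_forall_le (β := L)
    (tendsto_atTop_mono hcoer ((tendsto_norm_cocompact_atTop).const_mul_atTop (by positivity)))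
  refine ⟨p₀, fun p => ?_⟩
  obtain ⟨b, hb, a, ha, rfl⟩ := Submodule.mem_sup.1 (hL.sup_eq_top ▸ Submodule.mem_top (x := p))
  rw [add_comm, hinv a b hb]
  exact hp₀ ⟨a, ha⟩

end

/-! ### Linear families of potentials -/

section

variable {N K d : ℕ} {M : Fin K → Fin K → Bool} {ν : Measure (ℕ → Fin N)}
  {μ : Measure (GaSp N K)} {f : GaSp N K → Fin d → ℝ}

theorem isPotential_const (M : Fin K → Fin K → Bool) (a : ℝ) :
    IsPotential M (fun _ : GaSp N K => a) 0 |a| where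
  cont := continuous_const
  bound _ := le_rfl
  var n p q _ _ _ _ := by simp [SnS]

theorem exists_isPotential_sum {ι : Type*} {h : ι → GaSp N K → ℝ} (s : Finset ι)
    (hs : ∀ t ∈ s, ∃ V G, IsPotential M (h t) V G) :
    ∃ V G, IsPotential M (fun p => ∑ t ∈ s, h t p) V G := by
  classical
  induction s using Finset.induction_on with
  | empty => exact ⟨_, _, by simpa using isPotential_const M 0⟩
  | insert a s ha ih =>
    obtain ⟨V, G, hVG⟩ := hs a (Finset.mem_insert_self a s)
    obtain ⟨V', G', hVG'⟩ := ih fun t ht => hs t (Finset.mem_insert_of_mem ht)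
    exact ⟨_, _, by simpa only [Finset.sum_insert ha] using hVG.add hVG'⟩

theorem exists_forall_norm_le (hf : Continuous f) : ∃ F, ∀ p, ‖f p‖ ≤ F := by
  obtain ⟨F, hF⟩ := isCompact_univ.exists_bound_of_continuousOn hf.continuousOn
  exact ⟨F, fun p => hF p (mem_univ p)⟩

theorem BddVar.exists_isPotential (hbv : BddVar M f) (hf : Continuous f) (t : Fin d) :
    ∃ V G, IsPotential M (fun p => f p t) V G := by
  obtain ⟨B, hB⟩ := hbv
  obtain ⟨F, hF⟩ := exists_forall_norm_le hf
  set D : ℕ → Set ℝ := fun k => {d : ℝ | ∃ p q : GaSp N K, p.2 ∈ SigmaA M ∧ q.2 ∈ SigmaA M ∧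
        (∀ t < k, p.1 t = q.1 t) ∧ (∀ t < k, p.2 t = q.2 t) ∧ d = ‖f p - f q‖} with hD
  have hbdd : ∀ k, BddAbove (D k) := by
    refine fun k => ⟨F + F, ?_⟩
    rintro _ ⟨p, q, -, -, -, -, rfl⟩
    exact (norm_sub_le _ _).trans (add_le_add (hF p) (hF q))
  have h0 : 0 ≤ sSup (D 0) := by
    refine Real.sSup_nonneg ?_
    rintro _ ⟨p, q, -, -, -, -, rfl⟩
    exact norm_nonneg _
  refine ⟨B, F, (continuous_apply t).comp hf, fun p => (norm_le_pi_norm (f p) t).trans (hF p),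
    fun n p q hp hq h1 h2 => ?_⟩
  calc |SnS (fun p => f p t) n p - SnS (fun p => f p t) n q|
      ≤ ∑ k ∈ Finset.range n, |f (shift2^[k] p) t - f (shift2^[k] q) t| := by
        rw [SnS, SnS, ← Finset.sum_sub_distrib]
        exact Finset.abs_sum_le_sum_abs _ _
    _ ≤ ∑ k ∈ Finset.range n, sSup (D (n - 1 - k + 1)) := by
        refine Finset.sum_le_sum fun k hk => ?_
        have hk' := Finset.mem_range.1 hk
        refine (norm_le_pi_norm (f (shift2^[k] p) - f (shift2^[k] q)) t).trans
          (le_csSup (hbdd _) ⟨_, _, ?_, ?_, ?_, ?_, rfl⟩)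
        · rw [shift2_iterate]
          exact shift_iterate_mem_SigmaA hp k
        · rw [shift2_iterate]
          exact shift_iterate_mem_SigmaA hq k
        · intro s hs
          simp only [shift2_iterate, shift_iterate_apply]
          exact h1 _ (by omega)
        · intro s hs
          simp only [shift2_iterate, shift_iterate_apply]
          exact h2 _ (by omega)
    _ = ∑ k ∈ Finset.range n, sSup (D (k + 1)) :=
        Finset.sum_range_reflect (fun k => sSup (D (k + 1))) n
    _ ≤ ∑ k ∈ Finset.range (n + 1), sSup (D k) := by
        rw [Finset.sum_range_succ']
        exact le_add_of_nonneg_right h0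
    _ ≤ B := hB (n + 1)

/-- The potential `⟨p, f - α⟩`. -/
noncomputable def linPot (f : GaSp N K → Fin d → ℝ) (α p : Fin d → ℝ) (q : GaSp N K) : ℝ :=
  ∑ t, p t * (f q t - α t)

theorem BddVar.exists_isPotential_linPot (hbv : BddVar M f) (hf : Continuous f)
    (α p : Fin d → ℝ) : ∃ V G, IsPotential M (linPot f α p) V G := by
  refine exists_isPotential_sum Finset.univ fun t _ => ?_
  obtain ⟨V, G, h⟩ := hbv.exists_isPotential hf t
  exact ⟨_, _, (h.add (isPotential_const M (-α t))).const_mul (p t)⟩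

theorem linPot_add_const_mul (f : GaSp N K → Fin d → ℝ) (α p v : Fin d → ℝ) (s : ℝ)
    (q : GaSp N K) : linPot f α (p + s • v) q = linPot f α p q + s * linPot f α v q := by
  simp only [linPot, Pi.add_apply, Pi.smul_apply, smul_eq_mul, Finset.mul_sum,
    ← Finset.sum_add_distrib]
  exact Finset.sum_congr rfl fun t _ => by ring

theorem integral_linPot [IsProbabilityMeasure μ] (hf : Continuous f) (α p : Fin d → ℝ) :
    ∫ q, linPot f α p q ∂μ = p ⬝ᵥ ((∫ q, f q ∂μ) - α) := by
  have hft : ∀ t, Integrable (fun q => f q t) μ := fun t =>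
    integrable_of_continuous ((continuous_apply t).comp hf)
  have hft' : ∀ t, Integrable (fun q => p t * (f q t - α t)) μ := fun t =>
    ((hft t).sub (integrable_const _)).const_mul _
  simp only [linPot, dotProduct, Pi.sub_apply]
  rw [integral_finsetSum _ fun t _ => hft' t]
  refine Finset.sum_congr rfl fun t _ => ?_
  rw [integral_const_mul, integral_sub (hft t) (integrable_const _), integral_const,
    probReal_univ, one_smul, eval_integral (E := fun _ => ℝ) hft]

theorem tendsto_SnS_linPot_div {w : ℕ → Fin N} {α : Fin d → ℝ} {j : ℕ → Fin K}
    (hj : j ∈ EwVec M f w α) (p : Fin d → ℝ) :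
    Tendsto (fun n : ℕ => SnS (linPot f α p) n (w, j) / n) atTop (nhds 0) := by
  have h1 := tendsto_finsetSum Finset.univ fun t _ =>
    ((tendsto_pi_nhds.1 hj.2 t).sub_const (α t)).const_mul (p t)
  simp only [sub_self, mul_zero, Finset.sum_const_zero] at h1
  refine h1.congr' ?_
  filter_upwards [eventually_gt_atTop 0] with n hn
  have hn' : (n : ℝ) ≠ 0 := Nat.cast_ne_zero.2 hn.ne'
  rw [SnS]
  simp only [linPot]
  rw [Finset.sum_comm, Finset.sum_div]
  refine Finset.sum_congr rfl fun t _ => ?_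
  rw [← Finset.mul_sum, Finset.sum_sub_distrib, Finset.sum_const, Finset.card_range,
    nsmul_eq_mul, Pi.smul_apply, Finset.sum_apply, smul_eq_mul]
  field_simp

variable [NeZero K] [IsProbabilityMeasure ν]

theorem dotProduct_le_condPressure (hbv : BddVar M f) (hf : Continuous f) {r : ℕ}
    (hr : HasGap M r) (hne : (SigmaA M).Nonempty) (hν : MeasurePreserving shift ν ν)
    (α p : Fin d → ℝ) {x : Fin d → ℝ} (hx : x ∈ PAset M ν f) :
    p ⬝ᵥ (x - α) ≤ condPressure M ν (linPot f α p) := by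
  obtain ⟨μ, hμ, rfl⟩ := hx
  have := hμ.1
  obtain ⟨V, G, hg⟩ := hbv.exists_isPotential_linPot hf α p
  have h1 := hg.entGa_add_integral_le hr hne hν hμ
  have h2 := entOm_le_entGa hμ.2.2.1
  rw [integral_linPot hf] at h1
  linarith

theorem condPressure_linPot_add_le (hbv : BddVar M f) (hf : Continuous f) {r : ℕ}
    (hr : HasGap M r) (hne : (SigmaA M).Nonempty) (hν : MeasurePreserving shift ν ν)
    (α p : Fin d → ℝ) {q : Fin d → ℝ} (hq : ∀ x ∈ PAset M ν f, q ⬝ᵥ (x - α) = 0) :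
    condPressure M ν (linPot f α (p + q)) ≤ condPressure M ν (linPot f α p) := by
  obtain ⟨V, G, hg⟩ := hbv.exists_isPotential_linPot hf α (p + q)
  obtain ⟨V', G', hg'⟩ := hbv.exists_isPotential_linPot hf α p
  obtain ⟨μ, c, C, hμ⟩ := hg.exists_isGibbs hr hne hν
  have := hμ.mem.1
  have h1 := hg.entGa_add_integral_eq hr hne hν hμ
  have h2 := hg'.entGa_add_integral_le hr hne hν hμ.mem
  rw [integral_linPot hf] at h1 h2
  rw [add_dotProduct, hq _ ⟨μ, hμ.mem, rfl⟩] at h1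
  linarith

theorem continuous_condPressure_linPot (hbv : BddVar M f) (hf : Continuous f) {r : ℕ}
    (hr : HasGap M r) (hne : (SigmaA M).Nonempty) (hν : MeasurePreserving shift ν ν)
    (α : Fin d → ℝ) : Continuous fun p => condPressure M ν (linPot f α p) := by
  obtain ⟨F, hF⟩ := exists_forall_norm_le hf
  obtain ⟨w₀⟩ := nonempty_of_isProbabilityMeasure ν
  have hF0 : 0 ≤ F := (norm_nonneg _).trans (hF (w₀, fun _ => 0))
  refine (LipschitzWith.of_le_add_mul (⟨∑ t, (F + |α t|), by positivity⟩ : NNReal)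
    fun p p' => ?_).continuous
  obtain ⟨V, G, hg⟩ := hbv.exists_isPotential_linPot hf α p
  obtain ⟨V', G', hg'⟩ := hbv.exists_isPotential_linPot hf α p'
  refine hg.condPressure_le_add hg' hr hne hν fun q _ => ?_
  rw [← sub_le_iff_le_add', linPot, linPot, ← Finset.sum_sub_distrib]
  change _ ≤ (∑ t, (F + |α t|)) * dist p p'
  rw [Finset.sum_mul]
  refine Finset.sum_le_sum fun t _ => ?_
  rw [← sub_mul, mul_comm]
  refine (le_abs_self _).trans ((abs_mul _ _).trans_le ?_)
  refine mul_le_mul ((abs_sub _ _).trans (by gcongr; exact (norm_le_pi_norm (f q) t).trans (hF q)))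
    ?_ (abs_nonneg _) (by positivity)
  rw [← Real.dist_eq]
  exact dist_le_pi_dist p p' t

end

/-! ### The multifractal formula -/

section

variable {N K d : ℕ} {M : Fin K → Fin K → Bool} {ν : Measure (ℕ → Fin N)}
  {μ : Measure (GaSp N K)} {f : GaSp N K → Fin d → ℝ}

theorem IsGibbs.sSup_entGa_sub_entOm_eq [NeZero K] [IsProbabilityMeasure ν] {g : GaSp N K → ℝ}
    {V G c C : ℝ} (hμ : IsGibbs M g ν μ c C) (hg : IsPotential M g V G) {r : ℕ}
    (hr : HasGap M r) (hne : (SigmaA M).Nonempty) (hν : MeasurePreserving shift ν ν)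
    {α : Fin d → ℝ} (hα : ∫ p, f p ∂μ = α)
    (hg0 : ∀ μ', MemMnu M ν μ' → ∫ p, f p ∂μ' = α → ∫ p, g p ∂μ' = 0)
    (Q : Measure (GaSp N K) → Prop) (hQ : Q μ) :
    sSup {x : EReal | ∃ μ' : Measure (GaSp N K), MemMnu M ν μ' ∧ Q μ' ∧
      (∫ p, f p ∂μ') = α ∧ x = ((entGa μ' : ℝ) : EReal)} - ((entOm ν : ℝ) : EReal) =
      condPressure M ν g := by
  have hmax : sSup {x : EReal | ∃ μ' : Measure (GaSp N K), MemMnu M ν μ' ∧ Q μ' ∧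
      (∫ p, f p ∂μ') = α ∧ x = ((entGa μ' : ℝ) : EReal)} = ((entGa μ : ℝ) : EReal) := by
    refine IsGreatest.csSup_eq ⟨⟨μ, hμ.mem, hQ, hα, rfl⟩, ?_⟩
    rintro _ ⟨μ', hμ', -, hα', rfl⟩
    have h1 := hg.entGa_add_integral_le hr hne hν hμ'
    have h2 := hg.entGa_add_integral_eq hr hne hν hμ
    rw [hg0 μ' hμ' hα'] at h1
    rw [hg0 μ hμ.mem hα] at h2
    exact EReal.coe_le_coe_iff.2 (by linarith)
  have h0 := hg.entGa_add_integral_eq hr hne hν hμ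
  rw [hg0 μ hμ.mem hα, add_zero] at h0
  rw [hmax, h0, ← EReal.coe_sub, add_sub_cancel_left]

theorem exists_isGibbs_of_mem_intrinsicInterior [NeZero K] [IsProbabilityMeasure ν]
    (hbv : BddVar M f) (hf : Continuous f) {r : ℕ} (hr : HasGap M r)
    (hne : (SigmaA M).Nonempty) (hν : MeasurePreserving shift ν ν) (hqb : QuasiBernoulli ν)
    {α : Fin d → ℝ} (hα : α ∈ intrinsicInterior ℝ (PAset M ν f)) :
    ∃ p₀, (∀ p, condPressure M ν (linPot f α p₀) ≤ condPressure M ν (linPot f α p)) ∧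
      ∃ μ c C, IsGibbs M (linPot f α p₀) ν μ c C ∧ ∫ q, f q ∂μ = α := by
  obtain ⟨p₀, hp₀⟩ := exists_forall_le_of_mem_intrinsicInterior hα
    (continuous_condPressure_linPot hbv hf hr hne hν α)
    (fun p x hx => dotProduct_le_condPressure hbv hf hr hne hν α p hx) fun p q hq => by
      refine le_antisymm (condPressure_linPot_add_le hbv hf hr hne hν α p hq) ?_
      have := condPressure_linPot_add_le hbv hf hr hne hν α (p + q) (q := -q)
        fun x hx => by rw [neg_dotProduct, hq x hx, neg_zero]
      rwa [add_neg_cancel_right] at this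
  obtain ⟨V, G, hg⟩ := hbv.exists_isPotential_linPot hf α p₀
  obtain ⟨μ, c, C, hμ⟩ := hg.exists_isGibbs hr hne hν
  have := hμ.mem.1
  refine ⟨p₀, hp₀, μ, c, C, hμ, ?_⟩
  set v := α - ∫ q, f q ∂μ with hv
  obtain ⟨V', G', hh⟩ := hbv.exists_isPotential_linPot hf α v
  have h := hμ.integral_nonneg_of_condPressure_le hg hh hr hne hν hqb fun t => by
    simpa only [← linPot_add_const_mul] using hp₀ (p₀ + t • v)
  rw [integral_linPot hf, ← neg_sub, ← hv, dotProduct_neg] at h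
  have h0 : v ⬝ᵥ v = 0 := le_antisymm (by linarith) (Finset.sum_nonneg fun i _ => mul_self_nonneg (v i))
  exact (sub_eq_zero.1 (dotProduct_self_eq_zero.1 h0)).symm

theorem ae_multifractal_of_continuous [NeZero K] [IsProbabilityMeasure ν]
    (hbv : BddVar M f) (hf : Continuous f) {r : ℕ} (hr : HasGap M r)
    (hne : (SigmaA M).Nonempty) (herg : Ergodic shift ν) (hqb : QuasiBernoulli ν)
    {α : Fin d → ℝ} (hα : α ∈ intrinsicInterior ℝ (PAset M ν f)) :
    ∀ᵐ w ∂ν,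
      htop (EwVec M f w α) =
          sSup {x : EReal | ∃ μ : Measure (GaSp N K), MemMnu M ν μ ∧
              Ergodic shift2 μ ∧ (∫ p, f p ∂μ) = α ∧ x = ((entGa μ : ℝ) : EReal)}
            - ((entOm ν : ℝ) : EReal) ∧
      htop (EwVec M f w α) =
          sSup {x : EReal | ∃ μ : Measure (GaSp N K), MemMnu M ν μ ∧
              (∫ p, f p ∂μ) = α ∧ x = ((entGa μ : ℝ) : EReal)}
            - ((entOm ν : ℝ) : EReal) ∧
      htop (EwVec M f w α) =
          ⨅ p : Fin d → ℝ, ((condPressure M ν (linPot f α p) : ℝ) : EReal) := by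
  have hν := herg.toMeasurePreserving
  obtain ⟨p₀, hp₀, μ, c, C, hμ, hμα⟩ :=
    exists_isGibbs_of_mem_intrinsicInterior hbv hf hr hne hν hqb hα
  obtain ⟨V, G, hg⟩ := hbv.exists_isPotential_linPot hf α p₀
  have h0 : ∀ μ', MemMnu M ν μ' → ∫ p, f p ∂μ' = α → ∫ p, linPot f α p₀ p ∂μ' = 0 := by
    intro μ' hμ' hα'
    have := hμ'.1
    rw [integral_linPot hf, hα', sub_self, dotProduct_zero]
  have h1 := hμ.sSup_entGa_sub_entOm_eq hg hr hne hν hμα h0 (fun μ => Ergodic shift2 μ)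
    (hμ.ergodic hg hr hne hqb)
  have h2 := hμ.sSup_entGa_sub_entOm_eq hg hr hne hν hμα h0 (fun _ => True) trivial
  simp only [true_and] at h2
  have hP : 0 ≤ condPressure M ν (linPot f α p₀) := by
    simpa using dotProduct_le_condPressure hbv hf hr hne hν α p₀ (intrinsicInterior_subset hα)
  filter_upwards [hμ.ae_le_htop_EwVec hg hr hne herg hqb hf,
    hg.ae_tendsto_log_Zn_div hr hne herg] with w hw hlim
  have h3 : htop (EwVec M f w α) = condPressure M ν (linPot f α p₀) := by
    refine le_antisymm (hg.htop_le hne hlim hP fun j hj => ⟨hj.1, fun ε hε => ?_⟩) ?_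
    · filter_upwards [(tendsto_SnS_linPot_div hj p₀).eventually_const_le (neg_lt_zero.2 hε),
        eventually_gt_atTop 0] with n hn hn0
      exact (le_div_iff₀ (Nat.cast_pos.2 hn0)).1 hn
    · rwa [h0 μ hμ.mem hμα, sub_zero, hμα] at hw
  rw [h1, h2, h3]
  exact ⟨rfl, rfl, le_antisymm (le_iInf fun p => EReal.coe_le_coe_iff.2 (hp₀ p))
    (iInf_le (fun p => ((condPressure M ν (linPot f α p) : ℝ) : EReal)) p₀)⟩

theorem exists_ae_htop_EwVec_eq_htop_SigmaA [NeZero K] [IsProbabilityMeasure ν]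
    (hf : Continuous f) {r : ℕ} (hr : HasGap M r) (hne : (SigmaA M).Nonempty)
    (herg : Ergodic shift ν) (hqb : QuasiBernoulli ν) :
    ∃ α, ∀ᵐ w ∂ν, htop (EwVec M f w α) = htop (SigmaA M) := by
  have hν := herg.toMeasurePreserving
  have hg : IsPotential M (fun _ : GaSp N K => (0 : ℝ)) 0 |0| := isPotential_const M 0
  obtain ⟨μ, c, C, hμ⟩ := hg.exists_isGibbs hr hne hν
  have := hμ.mem.1
  have hP : 0 ≤ condPressure M ν fun _ : GaSp N K => (0 : ℝ) := by
    have h1 := hg.entGa_add_integral_eq hr hne hν hμ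
    have h2 := entOm_le_entGa hμ.mem.2.2.1
    rw [integral_zero] at h1
    linarith
  refine ⟨∫ p, f p ∂μ, ?_⟩
  filter_upwards [hμ.ae_le_htop_EwVec hg hr hne herg hqb hf,
    hg.ae_tendsto_log_Zn_div hr hne herg] with w hw hlim
  rw [integral_zero, sub_zero] at hw
  refine le_antisymm (htop_mono fun j hj => hj.1) (le_trans ?_ hw)
  refine hg.htop_le hne hlim hP fun j hj => ⟨hj, fun ε hε => Eventually.of_forall fun n => ?_⟩
  rw [SnS, Finset.sum_const_zero]
  exact mul_nonpos_of_nonpos_of_nonneg (neg_nonpos.2 hε.le) n.cast_nonneg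

/-! ### Dependence on the restriction of the potential to the subshift -/

theorem exists_continuous_eqOn_SigmaA (hf : ContinuousOn f {p : GaSp N K | p.2 ∈ SigmaA M}) :
    ∃ f' : GaSp N K → Fin d → ℝ, Continuous f' ∧ ∀ p, p.2 ∈ SigmaA M → f' p = f p := by
  have hcl : IsClosed {p : GaSp N K | p.2 ∈ SigmaA M} :=
    (isCompact_SigmaA M).isClosed.preimage continuous_snd
  obtain ⟨f', hf'⟩ := ContinuousMap.exists_restrict_eq hcl ⟨_, hf.domRestrict⟩
  exact ⟨f', f'.continuous, fun p hp => congrArg (fun h => h ⟨p, hp⟩) hf'⟩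

variable {f' : GaSp N K → Fin d → ℝ}

theorem BddVar.congr (hbv : BddVar M f) (h : ∀ p, p.2 ∈ SigmaA M → f' p = f p) :
    BddVar M f' := by
  obtain ⟨B, hB⟩ := hbv
  refine ⟨B, fun m => (Finset.sum_le_sum fun k _ => ?_).trans (hB m)⟩
  refine (congrArg sSup (Set.ext fun x => exists_congr fun p => exists_congr fun q => ?_)).le
  refine and_congr_right fun hp => and_congr_right fun hq => ?_
  rw [h p hp, h q hq]

theorem shift2_iterate_mem {p : GaSp N K} (hp : p.2 ∈ SigmaA M) (k : ℕ) :
    (shift2^[k] p).2 ∈ SigmaA M := by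
  rw [shift2_iterate]
  exact shift_iterate_mem_SigmaA hp k

theorem EwVec_congr (h : ∀ p, p.2 ∈ SigmaA M → f' p = f p) (w : ℕ → Fin N) (α : Fin d → ℝ) :
    EwVec M f' w α = EwVec M f w α := by
  refine Set.ext fun j => and_congr_right fun hj => ?_
  simp only [fun k => h _ (shift2_iterate_mem (p := (w, j)) hj k)]

theorem MemMnu.integral_congr (hμ : MemMnu M ν μ) (h : ∀ p, p.2 ∈ SigmaA M → f' p = f p) :
    ∫ p, f' p ∂μ = ∫ p, f p ∂μ :=
  integral_congr_ae (hμ.ae_mem.mono h)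

theorem PAset_congr (h : ∀ p, p.2 ∈ SigmaA M → f' p = f p) : PAset M ν f' = PAset M ν f :=
  Set.ext fun α => exists_congr fun μ => and_congr_right fun hμ => by rw [hμ.integral_congr h]

theorem condPressure_congr {g g' : GaSp N K → ℝ} (h : ∀ p, p.2 ∈ SigmaA M → g' p = g p) :
    condPressure M ν g' = condPressure M ν g := by
  have hZ : Zn M g' = Zn M g := by
    funext w n
    refine Finset.sum_congr rfl fun v _ => congrArg sSup (Set.image_congr fun j hj => ?_)
    rw [SnS, SnS]
    simp only [fun k => h _ (shift2_iterate_mem (p := (w, j)) hj.1 k)]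
  rw [condPressure, condPressure, hZ]

theorem condPressure_linPot_congr (h : ∀ p, p.2 ∈ SigmaA M → f' p = f p) (α p : Fin d → ℝ) :
    condPressure M ν (linPot f' α p) = condPressure M ν (linPot f α p) :=
  condPressure_congr fun q hq => by rw [linPot, linPot, h q hq]

end

theorem typical_weights_multifractal_formula
    {N K d : ℕ} (M : Fin K → Fin K → Bool) (hA : ApIrr M)
    (ν : Measure (ℕ → Fin N)) [IsProbabilityMeasure ν]
    (hinv : MeasurePreserving shift ν ν) (herg : Ergodic shift ν)
    (hqb : QuasiBernoulli ν)
    (f : GaSp N K → (Fin d → ℝ)) (hf : ContinuousOn f {p : GaSp N K | p.2 ∈ SigmaA M})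
    (hbv : BddVar M f) :
    (∀ α ∈ intrinsicInterior ℝ (PAset M ν f),
      ∀ᵐ w ∂ν,
        htop (EwVec M f w α) =
            sSup {x : EReal | ∃ μ : Measure (GaSp N K), MemMnu M ν μ ∧
                Ergodic shift2 μ ∧ (∫ p, f p ∂μ) = α ∧ x = ((entGa μ : ℝ) : EReal)}
              - ((entOm ν : ℝ) : EReal) ∧
        htop (EwVec M f w α) =
            sSup {x : EReal | ∃ μ : Measure (GaSp N K), MemMnu M ν μ ∧
                (∫ p, f p ∂μ) = α ∧ x = ((entGa μ : ℝ) : EReal)}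
              - ((entOm ν : ℝ) : EReal) ∧
        htop (EwVec M f w α) =
            ⨅ p : Fin d → ℝ,
              ((condPressure M ν (fun gq => ∑ t, p t * (f gq t - α t)) : ℝ) : EReal)) ∧
    ∃ α₀ : Fin d → ℝ, ∀ᵐ w ∂ν, htop (EwVec M f w α₀) = htop (SigmaA M) := by
  rcases Nat.eq_zero_or_pos K with rfl | hK
  · have : IsEmpty (ℕ → Fin 0) := ⟨fun x => (x 0).elim0⟩
    refine ⟨fun α hα => ?_, 0, Eventually.of_forall fun w => congrArg htop (Subsingleton.elim _ _)⟩
    obtain ⟨μ, hμ, -⟩ := intrinsicInterior_subset hα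
    have := hμ.1
    exact isEmptyElim μ.nonempty_of_neZero.some
  have : NeZero K := ⟨hK.ne'⟩
  obtain ⟨r, hr⟩ := hA.exists_hasGap
  have hne := hA.nonempty_SigmaA
  obtain ⟨f', hf', h⟩ := exists_continuous_eqOn_SigmaA hf
  have hbv' := hbv.congr h
  constructor
  · intro α hα
    rw [← PAset_congr h] at hα
    filter_upwards [ae_multifractal_of_continuous hbv' hf' hr hne herg hqb hα] with w hw
    have h1 : ∀ Q : Measure (GaSp N K) → Prop,
        {x : EReal | ∃ μ : Measure (GaSp N K), MemMnu M ν μ ∧ Q μ ∧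
          (∫ p, f' p ∂μ) = α ∧ x = ((entGa μ : ℝ) : EReal)} =
        {x : EReal | ∃ μ : Measure (GaSp N K), MemMnu M ν μ ∧ Q μ ∧
          (∫ p, f p ∂μ) = α ∧ x = ((entGa μ : ℝ) : EReal)} := fun Q =>
      Set.ext fun x => exists_congr fun μ => and_congr_right fun hμ => by
        rw [hμ.integral_congr h]
    have h2 := h1 fun _ => True
    simp only [true_and] at h2
    rw [EwVec_congr h, h1 fun μ => Ergodic shift2 μ, h2] at hw
    simp only [condPressure_linPot_congr h] at hw
    exact hw
  · obtain ⟨α, hα⟩ := exists_ae_htop_EwVec_eq_htop_SigmaA hf' hr hne herg hqb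
    exact ⟨α, hα.mono fun w hw => by rwa [EwVec_congr h] at hw⟩
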